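/- arXiv:2303.16348 — 4 statements merged into one kernel-verified Lean document; each statement's English description precedes it below -/
import Mathlib

section
/- There is an absolute constant C > 0 with the following property. Let p be a prime, n ≥ 1, G = F_p^n, A ⊆ G with |A| = δN where δ > 0, let ε ∈ (0,1] be a parameter and k, l ≥ 2 integers. Then there exist a linear subspace V ≤ G and x ∈ G such that A ∩ (V+x) is ε-uniform relatively to E^k_l, μ_{V+x}(A) ≥ δ, and codim V ≤ C · ε^{-28·l^l} (8l)^{28·l^l} k^4 L(ε)^{4l} L(δ)^{5l}. -/
open scoped BigOperators

attribute [local instance] Classical.propDecidable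

noncomputable section

/-- The generalized convolution `C_l(f)(x) = Σ_z f(z+x_1)⋯f(z+x_l)`. -/
def conv (G : Type*) [AddCommGroup G] [Fintype G] (l : ℕ) (f : G → ℝ) (x : Fin l → G) : ℝ :=
  ∑ z : G, ∏ i : Fin l, f (z + x i)

/-- The higher energy `E^k_l(f) = Σ_{x ∈ G^l} C_l(f)(x)^k`. -/
def energy (G : Type*) [AddCommGroup G] [Fintype G] (k l : ℕ) (f : G → ℝ) : ℝ :=
  ∑ x : Fin l → G, conv G l f x ^ k

/-- Indicator function of a finite set, real valued. -/
def ind {G : Type*} (A : Finset G) : G → ℝ := fun x => if x ∈ A then 1 else 0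

/-- The balanced function `f_A = 1_A − |A|/N`. -/
def bal {G : Type*} [Fintype G] (A : Finset G) : G → ℝ := fun x =>
  ind A x - (A.card : ℝ) / (Fintype.card G : ℝ)

/-- `A` is `ε`-uniform relatively to `E^k_l`:  `E^k_l(f_A) ≤ ε^{kl} δ^{kl} N^{k+l}`
where `δ = |A|/N`. -/
def unif (G : Type*) [AddCommGroup G] [Fintype G] (ε : ℝ) (k l : ℕ) (A : Finset G) : Prop :=
  energy G k l (bal A) ≤
    ε ^ (k * l) * ((A.card : ℝ) / (Fintype.card G : ℝ)) ^ (k * l) * (Fintype.card G : ℝ) ^ (k + l)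

/-- `L(t) = log₂ (2/t)`. -/
def Lg (t : ℝ) : ℝ := Real.logb 2 (2 / t)

/-- `(f ∘ g)(x) = Σ_y f(y) g(y+x)`. -/
def circ {G : Type*} [AddCommGroup G] [Fintype G] (f g : G → ℝ) (x : G) : ℝ :=
  ∑ y : G, f y * g (y + x)

/-- `(f ∗ g)(x) = Σ_y f(y) g(x−y)`. -/
def convol {G : Type*} [AddCommGroup G] [Fintype G] (f g : G → ℝ) (x : G) : ℝ :=
  ∑ y : G, f y * g (x - y)

namespace HigherEnergy

open Finset Real
open scoped BigOperators

/-! ### Averages over finite types -/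

section Averages

variable {Ω : Type*} [Fintype Ω] [Nonempty Ω]

lemma rpow_expect_le (f : Ω → ℝ) (hf : ∀ x, 0 ≤ f x) {r : ℝ} (hr : 1 ≤ r) :
    (𝔼 x, f x) ^ r ≤ 𝔼 x, f x ^ r := by
  have hN : (0 : ℝ) < Fintype.card Ω := by exact_mod_cast Fintype.card_pos
  have h := Real.rpow_arith_mean_le_arith_mean_rpow univ
    (fun _ : Ω => (1 : ℝ) / Fintype.card Ω) f (fun _ _ => by positivity)
    (by simp [hN.ne']) (fun x _ => hf x) hr
  simpa only [Fintype.expect_eq_sum_div_card, div_eq_inv_mul, mul_one, ← Finset.mul_sum] using h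

lemma pow_expect_le (f : Ω → ℝ) (hf : ∀ x, 0 ≤ f x) (n : ℕ) :
    (𝔼 x, f x) ^ n ≤ 𝔼 x, f x ^ n := by
  have hN : (0 : ℝ) < Fintype.card Ω := by exact_mod_cast Fintype.card_pos
  have h := Real.pow_arith_mean_le_arith_mean_pow univ
    (fun _ : Ω => (1 : ℝ) / Fintype.card Ω) f (fun _ _ => by positivity)
    (by simp [hN.ne']) (fun x _ => hf x) n
  simpa only [Fintype.expect_eq_sum_div_card, div_eq_inv_mul, mul_one, ← Finset.mul_sum] using h

lemma pow_le_expect_pow_of_even (X : Ω → ℝ) {K j : ℕ} (hK : Even K) (hj : Even j) (hK0 : 0 < K)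
    (hKj : K ≤ j) {η : ℝ} (hη : 0 ≤ η) (h : η ^ K ≤ 𝔼 x, X x ^ K) : η ^ j ≤ 𝔼 x, X x ^ j := by
  have hK0' : (0 : ℝ) < K := by exact_mod_cast hK0
  have key : ∀ y : ℝ, 0 ≤ y → (y ^ K) ^ ((j : ℝ) / K) = y ^ j := fun y hy => by
    rw [← Real.rpow_natCast y K, ← Real.rpow_mul hy, mul_div_cancel₀ _ hK0'.ne',
      Real.rpow_natCast]
  have h1 := rpow_expect_le (fun x => X x ^ K) (fun x => hK.pow_nonneg _) (r := (j : ℝ) / K)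
    ((one_le_div hK0').2 (by exact_mod_cast hKj))
  have h2 : ∀ x, (X x ^ K) ^ ((j : ℝ) / K) = X x ^ j := fun x => by
    rw [← hK.pow_abs, key _ (abs_nonneg _), hj.pow_abs]
  simp only [h2] at h1
  refine le_trans ?_ h1
  rw [← key η hη]
  exact Real.rpow_le_rpow (by positivity) h (by positivity)

/-- If all moments of `X` are nonnegative, a large even moment of `X` forces large moments of
`1 + X`. -/
lemma one_add_pow_le_expect (X : Ω → ℝ) (hX : ∀ j : ℕ, 0 ≤ 𝔼 x, X x ^ j) {K q : ℕ}
    (hK : Even K) (hK0 : 0 < K) {η : ℝ} (hη : 0 < η) (hη1 : η ≤ 1) (h : η ^ K ≤ 𝔼 x, X x ^ K)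
    (hq : 3 * ((K : ℝ) + 3) ≤ q * η) : (1 + η / 2) ^ q ≤ 𝔼 x, (1 + X x) ^ q := by
  have hj : ∀ j : ℕ, (η ^ j + (-η) ^ j) / 2 - 2 ^ K * (η / 2) ^ j ≤ 𝔼 x, X x ^ j := by
    intro j
    rcases Nat.even_or_odd j with he | ho
    · rw [he.neg_pow]
      rcases le_or_gt K j with hKj | hKj
      · have := pow_le_expect_pow_of_even X hK he hK0 hKj hη.le h
        have : (0 : ℝ) ≤ 2 ^ K * (η / 2) ^ j := by positivity
        linarith
      · refine le_trans ?_ (hX j)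
        have h2 : (2 : ℝ) ^ j ≤ 2 ^ K := pow_le_pow_right₀ (by norm_num) hKj.le
        have h3 : η ^ j = 2 ^ j * (η / 2) ^ j := by rw [← mul_pow]; congr 1; ring
        have h4 : (2 : ℝ) ^ j * (η / 2) ^ j ≤ 2 ^ K * (η / 2) ^ j := by gcongr
        linarith
    · refine le_trans ?_ (hX j)
      rw [ho.neg_pow]
      have : (0 : ℝ) ≤ 2 ^ K * (η / 2) ^ j := by positivity
      linarith
  have hexp : 𝔼 x, (1 + X x) ^ q = ∑ j ∈ range (q + 1), (q.choose j : ℝ) * 𝔼 x, X x ^ j := by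
    simp_rw [add_comm (1 : ℝ), add_pow, one_pow, mul_one, Finset.expect_sum_comm]
    refine Finset.sum_congr rfl fun j _ => ?_
    rw [← Finset.expect_mul, mul_comm]
  have hbin : ∀ y : ℝ, (1 + y) ^ q = ∑ j ∈ range (q + 1), (q.choose j : ℝ) * y ^ j := fun y => by
    rw [add_comm, add_pow]
    exact Finset.sum_congr rfl fun j _ => by rw [one_pow, mul_one, mul_comm]
  have hlow : ((1 + η) ^ q + (1 + -η) ^ q) / 2 - 2 ^ K * (1 + η / 2) ^ q ≤
      𝔼 x, (1 + X x) ^ q := by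
    rw [hexp, hbin, hbin, hbin, ← Finset.sum_add_distrib, Finset.sum_div, Finset.mul_sum,
      ← Finset.sum_sub_distrib]
    refine Finset.sum_le_sum fun j _ => ?_
    have := mul_le_mul_of_nonneg_left (hj j) (Nat.cast_nonneg (α := ℝ) (q.choose j))
    linarith
  have hpos : (0 : ℝ) ≤ (1 + -η) ^ q := pow_nonneg (by linarith) _
  have hratio : (2 : ℝ) ^ (K + 3) * (1 + η / 2) ^ q ≤ (1 + η) ^ q := by
    have h1 : (1 + η / 3) * (1 + η / 2) ≤ 1 + η := by nlinarith
    have h2 : (2 : ℝ) ^ (K + 3) ≤ (1 + η / 3) ^ q := by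
      have h3 : (2 : ℝ) ^ (η / 3) ≤ 1 + η / 3 := by
        have := rpow_one_add_le_one_add_mul_self (s := 1) (by norm_num) (p := η / 3)
          (by positivity) (by linarith)
        norm_num at this
        linarith
      calc (2 : ℝ) ^ (K + 3) = (2 : ℝ) ^ ((K + 3 : ℕ) : ℝ) := (Real.rpow_natCast _ _).symm
        _ ≤ (2 : ℝ) ^ (η / 3 * q) := by
            apply Real.rpow_le_rpow_of_exponent_le (by norm_num)
            push_cast; linarith
        _ = ((2 : ℝ) ^ (η / 3)) ^ q := by rw [Real.rpow_mul (by norm_num), Real.rpow_natCast]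
        _ ≤ (1 + η / 3) ^ q := by gcongr
    calc (2 : ℝ) ^ (K + 3) * (1 + η / 2) ^ q ≤ (1 + η / 3) ^ q * (1 + η / 2) ^ q := by gcongr
      _ = ((1 + η / 3) * (1 + η / 2)) ^ q := by rw [mul_pow]
      _ ≤ (1 + η) ^ q := by gcongr
  have h1 : (1 : ℝ) ≤ 2 ^ K := one_le_pow₀ (by norm_num)
  have h2 : (0 : ℝ) ≤ (1 + η / 2) ^ q := by positivity
  rw [pow_add] at hratio
  nlinarith

end Averages

/-! ### Norms -/

section Norm

variable {Ω : Type*} [Fintype Ω]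

/-- The normalised `L^q` norm of a function on a finite type. -/
def nrm (q : ℕ) (F : Ω → ℝ) : ℝ := (𝔼 x, |F x| ^ q) ^ ((1 : ℝ) / q)

lemma nrm_nonneg (q : ℕ) (F : Ω → ℝ) : 0 ≤ nrm q F :=
  Real.rpow_nonneg (Finset.expect_nonneg fun _ _ => by positivity) _

lemma nrm_pow {q : ℕ} (hq : 0 < q) (F : Ω → ℝ) : nrm q F ^ q = 𝔼 x, |F x| ^ q := by
  have h : (0 : ℝ) ≤ 𝔼 x, |F x| ^ q := Finset.expect_nonneg fun _ _ => by positivity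
  rw [nrm, one_div, Real.rpow_inv_natCast_pow h hq.ne']

lemma nrm_pow_of_even {q : ℕ} (hq : 0 < q) (he : Even q) (F : Ω → ℝ) :
    nrm q F ^ q = 𝔼 x, F x ^ q := by
  simp only [nrm_pow hq, he.pow_abs]

lemma le_nrm {q : ℕ} (hq : 0 < q) {F : Ω → ℝ} {a : ℝ} (h : a ^ q ≤ 𝔼 x, |F x| ^ q) :
    a ≤ nrm q F := by
  rw [← nrm_pow hq] at h
  exact le_of_pow_le_pow_left₀ hq.ne' (nrm_nonneg _ _) h

lemma nrm_le {q : ℕ} (hq : 0 < q) {F : Ω → ℝ} {a : ℝ} (ha : 0 ≤ a) (h : 𝔼 x, |F x| ^ q ≤ a ^ q) :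
    nrm q F ≤ a := by
  rw [← nrm_pow hq] at h
  exact le_of_pow_le_pow_left₀ hq.ne' ha h

lemma nrm_add_le {q : ℕ} (hq : 0 < q) (F G : Ω → ℝ) :
    nrm q (fun x => F x + G x) ≤ nrm q F + nrm q G := by
  have h := Real.Lp_add_le univ F G (p := (q : ℝ)) (by exact_mod_cast hq)
  simp only [Real.rpow_natCast] at h
  simp only [nrm, Fintype.expect_eq_sum_div_card]
  have hs : ∀ H : Ω → ℝ, (0 : ℝ) ≤ ∑ x, |H x| ^ q := fun H =>
    Finset.sum_nonneg fun _ _ => by positivity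
  rw [Real.div_rpow (hs _) (by positivity), Real.div_rpow (hs _) (by positivity),
    Real.div_rpow (hs _) (by positivity), ← add_div]
  gcongr

lemma nrm_zero {q : ℕ} (hq : 0 < q) : nrm q (fun _ : Ω => (0 : ℝ)) = 0 := by
  have : (1 : ℝ) / q ≠ 0 := by positivity
  simp [nrm, hq.ne']

lemma nrm_neg (q : ℕ) (F : Ω → ℝ) : nrm q (fun x => -F x) = nrm q F := by
  simp [nrm]

lemma nrm_one [Nonempty Ω] (q : ℕ) : nrm q (fun _ : Ω => (1 : ℝ)) = 1 := by
  simp [nrm]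

lemma nrm_sum_le {ι : Type*} {q : ℕ} (hq : 0 < q) (s : Finset ι) (F : ι → Ω → ℝ) :
    nrm q (fun x => ∑ i ∈ s, F i x) ≤ ∑ i ∈ s, nrm q (F i) := by
  induction s using Finset.induction_on with
  | empty => simp [nrm_zero hq]
  | insert i s hi ih =>
    simp only [Finset.sum_insert hi]
    exact (nrm_add_le hq _ _).trans (by gcongr)

end Norm

/-! ### Correlations and their moments -/

section Correlation

variable {G : Type*} [AddCommGroup G] [Fintype G]

/-- The normalised correlation `𝔼_z ∏_{i ∈ S} f(z + x_i)`. -/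
def corr {ι : Type*} (f : G → ℝ) (S : Finset ι) (x : ι → G) : ℝ := 𝔼 z, ∏ i ∈ S, f (z + x i)

/-- The `j`-th moment of the correlations of order `q`. -/
def moment (f : G → ℝ) (q j : ℕ) : ℝ := 𝔼 z : Fin q → G, corr f univ z ^ j

lemma expect_pi_prod {ι Ω : Type*} [Fintype ι] [DecidableEq ι] [Fintype Ω] (F : ι → Ω → ℝ) :
    𝔼 x : ι → Ω, ∏ i, F i (x i) = ∏ i, 𝔼 y, F i y := by
  simp only [Fintype.expect_eq_sum_div_card, Finset.prod_div_distrib, Finset.prod_const,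
    Finset.prod_univ_sum, Fintype.piFinset_univ, Fintype.card_pi, Finset.card_univ, Nat.cast_pow]

lemma expect_pi_prod_mem {ι Ω : Type*} [Fintype ι] [DecidableEq ι] [Fintype Ω] [Nonempty Ω]
    (S : Finset ι) (F : ι → Ω → ℝ) :
    𝔼 x : ι → Ω, ∏ i ∈ S, F i (x i) = ∏ i ∈ S, 𝔼 y, F i y := by
  have h1 := expect_pi_prod (fun (i : ι) (y : Ω) => if i ∈ S then F i y else 1)
  have h2 : ∀ i : ι, 𝔼 y, (if i ∈ S then F i y else 1) = if i ∈ S then 𝔼 y, F i y else 1 := by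
    intro i
    split_ifs
    · rfl
    · exact Fintype.expect_one
  simpa [h2, Finset.prod_ite_mem] using h1

lemma corr_pow {ι : Type*} (f : G → ℝ) (S : Finset ι) (x : ι → G) (q : ℕ) :
    corr f S x ^ q = 𝔼 z : Fin q → G, ∏ i ∈ S, ∏ j, f (z j + x i) := by
  rw [corr, Finset.expect_pow, Fintype.piFinset_univ]
  exact Finset.expect_congr rfl fun z _ => Finset.prod_comm

lemma expect_corr_pow {ι : Type*} [Fintype ι] [DecidableEq ι] (f : G → ℝ) (S : Finset ι) (q : ℕ) :
    𝔼 x : ι → G, corr f S x ^ q = moment f q #S := by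
  simp only [corr_pow f S, moment]
  rw [Finset.expect_comm]
  refine Finset.expect_congr rfl fun z _ => ?_
  rw [expect_pi_prod_mem S (fun _ y => ∏ j, f (z j + y)), Finset.prod_const, corr]
  simp only [add_comm]

lemma moment_comm (f : G → ℝ) (q j : ℕ) : moment f q j = moment f j q := by
  have h := expect_corr_pow (ι := Fin j) f univ q
  rw [Finset.card_univ, Fintype.card_fin] at h
  exact h.symm

lemma moment_nonneg {f : G → ℝ} {q j : ℕ} (hj : Even j) : 0 ≤ moment f q j :=
  Finset.expect_nonneg fun _ _ => hj.pow_nonneg _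

lemma moment_sq_le (f : G → ℝ) (q j : ℕ) : moment f q j ^ 2 ≤ moment f q (2 * j) := by
  have h := Finset.expect_mul_sq_le_sq_mul_sq univ (fun z : Fin q → G => corr f univ z ^ j)
    (fun _ => 1)
  simpa [moment, ← pow_mul, mul_comm] using h

lemma moment_le_add {f : G → ℝ} {q j m : ℕ} {t : ℝ} (ht : 0 < t) (hm : Even m) (hj : 2 ≤ j)
    (hjm : j ≤ m) :
    moment f q j ≤ t ^ (j - 2) * moment f q 2 + moment f q m / t ^ (m - j) := by
  simp only [moment]
  rw [Finset.mul_expect, Finset.expect_div, ← Finset.expect_add_distrib]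
  refine Finset.expect_le_expect fun z _ => ?_
  set y := corr f univ z
  refine (le_abs_self _).trans ?_
  rw [abs_pow, ← (even_two).pow_abs y, ← hm.pow_abs y]
  set u := |y| with hu
  have hu0 : 0 ≤ u := abs_nonneg y
  rcases le_or_gt u t with h | h
  · have h1 : u ^ j ≤ t ^ (j - 2) * u ^ 2 := by
      calc u ^ j = u ^ (j - 2) * u ^ 2 := by rw [← pow_add]; congr 1; omega
        _ ≤ t ^ (j - 2) * u ^ 2 := by gcongr
    have h2 : 0 ≤ u ^ m / t ^ (m - j) := by positivity
    linarith
  · have h1 : u ^ j ≤ u ^ m / t ^ (m - j) := by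
      rw [le_div_iff₀ (by positivity)]
      calc u ^ j * t ^ (m - j) ≤ u ^ j * u ^ (m - j) := by gcongr
        _ = u ^ m := by rw [← pow_add]; congr 1; omega
    have h2 : 0 ≤ t ^ (j - 2) * u ^ 2 := by positivity
    linarith

lemma corr_one_add {ι : Type*} [Fintype ι] (g : G → ℝ) (x : ι → G) :
    corr (fun y => 1 + g y) univ x = ∑ S : Finset ι, corr g S x := by
  simp only [corr, Finset.prod_one_add, Finset.expect_sum_comm, Finset.powerset_univ]

lemma corr_of_card_zero {ι : Type*} (g : G → ℝ) {S : Finset ι} (hS : #S = 0) (x : ι → G) :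
    corr g S x = 1 := by
  simp [corr, Finset.card_eq_zero.1 hS]

lemma corr_of_card_one {ι : Type*} {g : G → ℝ} (hg : 𝔼 z, g z = 0) {S : Finset ι} (hS : #S = 1)
    (x : ι → G) : corr g S x = 0 := by
  obtain ⟨i, rfl⟩ := Finset.card_eq_one.1 hS
  simp only [corr, Finset.prod_singleton]
  rw [← hg]
  exact Fintype.expect_equiv (Equiv.addRight (x i)) _ _ fun z => rfl

lemma corr_one_add_two {g : G → ℝ} (hg : 𝔼 z, g z = 0) (x : Fin 2 → G) :
    corr (fun y => 1 + g y) univ x = 1 + corr g univ x := by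
  rw [corr_one_add, ← Finset.add_sum_erase _ _ (mem_univ (∅ : Finset (Fin 2))),
    ← Finset.add_sum_erase _ _ (a := (univ : Finset (Fin 2))) (by decide),
    Finset.sum_eq_zero, corr_of_card_zero g rfl, add_zero]
  intro S hS
  simp only [mem_erase, mem_univ, and_true, ne_eq] at hS
  have h1 : #S ≠ 0 := fun h => hS.2 (Finset.card_eq_zero.1 h)
  have h2 : #S ≠ 2 := fun h => hS.1 (Finset.card_eq_iff_eq_univ S |>.1 (by simpa using h))
  have h3 : #S ≤ 2 := by simpa using Finset.card_le_univ S
  exact corr_of_card_one hg (by omega) x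

end Correlation

/-! ### Large moments of correlations of a nonnegative function -/

section Unbalancing

variable {G : Type*} [AddCommGroup G] [Fintype G]

lemma two_le_or_moment (g : G → ℝ) {m q : ℕ} {T : ℝ} (hT : 1 ≤ T) (hm : Even m) (hm2 : 2 ≤ m)
    (hq : 0 < q) (hqe : Even q) (h2 : moment g q 2 ≤ (1 / T ^ (m - 1)) ^ q) {S : Finset (Fin m)}
    (hS2 : 2 ≤ #S) (hSm : #S < m) :
    nrm q (fun x => corr g S x) ≤ (1 + nrm q (fun x : Fin m → G => corr g univ x)) / T := by
  have hT0 : 0 < T := by linarith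
  set a := nrm q (fun x : Fin m → G => corr g univ x) with ha
  have ha0 : 0 ≤ a := nrm_nonneg _ _
  have ham : moment g q m = a ^ q := by
    rw [ha, nrm_pow_of_even hq hqe, expect_corr_pow, Finset.card_univ, Fintype.card_fin]
  refine nrm_le hq (by positivity) ?_
  simp only [hqe.pow_abs]
  rw [expect_corr_pow]
  refine (moment_le_add (t := T ^ q) (by positivity) hm hS2 hSm.le).trans ?_
  rw [ham]
  have e1 : (T ^ q) ^ (#S - 2) * moment g q 2 ≤ (1 / T) ^ q := by
    calc (T ^ q) ^ (#S - 2) * moment g q 2 ≤ (T ^ q) ^ (m - 2) * (1 / T ^ (m - 1)) ^ q := by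
          gcongr
          · exact moment_nonneg even_two
          · exact one_le_pow₀ hT
      _ = (1 / T) ^ q := by
          rw [← pow_mul, mul_comm q, pow_mul, ← mul_pow]
          congr 1
          rw [show m - 1 = m - 2 + 1 by omega, pow_succ]
          field_simp
  have e2 : a ^ q / (T ^ q) ^ (m - #S) ≤ (a / T) ^ q := by
    rw [div_pow]
    gcongr
    exact le_self_pow₀ (one_le_pow₀ hT) (by omega)
  calc _ ≤ (1 / T) ^ q + (a / T) ^ q := add_le_add e1 e2
    _ ≤ (1 / T + a / T) ^ q := pow_add_pow_le (by positivity) (by positivity) hq.ne'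
    _ = ((1 + a) / T) ^ q := by rw [add_div]

lemma corr_sub_sum {g : G → ℝ} (hg : 𝔼 z, g z = 0) {m : ℕ} (hm : 2 ≤ m) (x : Fin m → G) :
    1 + corr g univ x = corr (fun y => 1 + g y) univ x +
      -∑ S ∈ univ.filter (fun S : Finset (Fin m) => 2 ≤ #S ∧ #S < m), corr g S x := by
  have h : ∀ S : Finset (Fin m), corr g S x = (if #S = 0 then 1 else 0) +
      (if #S = m then corr g univ x else 0) +
        if 2 ≤ #S ∧ #S < m then corr g S x else 0 := by
    intro S
    have hSm : #S ≤ m := by simpa using Finset.card_le_univ S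
    rcases Nat.lt_or_ge #S 2 with h1 | h1
    · interval_cases hc : #S
      · rw [corr_of_card_zero g hc]
        simp [show ¬ (0 = m) by omega]
      · rw [corr_of_card_one hg hc]
        simp [show ¬ (1 = m) by omega]
    · rcases Nat.lt_or_ge #S m with h2 | h2
      · simp [h1, h2, h2.ne, show #S ≠ 0 by omega]
      · have : #S = m := le_antisymm hSm h2
        have hS : S = univ := (Finset.card_eq_iff_eq_univ S).1 (by simpa using this)
        subst hS
        simp [show ¬ (m = 0) by omega]
  have hs0 : ∑ S : Finset (Fin m), (if #S = 0 then (1 : ℝ) else 0) = 1 := by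
    simp only [Finset.card_eq_zero]
    simp
  have hsm : ∑ S : Finset (Fin m), (if #S = m then corr g univ x else 0) = corr g univ x := by
    have : ∀ S : Finset (Fin m), (#S = m) = (S = univ) := fun S => by
      rw [← Finset.card_eq_iff_eq_univ, Fintype.card_fin]
    simp only [this]
    simp
  rw [corr_one_add, Finset.sum_congr rfl fun S _ => h S, Finset.sum_add_distrib,
    Finset.sum_add_distrib, hs0, hsm, Finset.sum_filter]
  ring

/-- A large moment of the correlations of order `m` of a mean-zero function `g` yields large
moments of the correlations of `1 + g` of order `2` or `m`. -/
lemma exists_large_moment {g : G → ℝ} (hg : 𝔼 z, g z = 0) (hg1 : ∀ z, 0 ≤ 1 + g z) {m K Y q r : ℕ}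
    (hm : Even m) (hm2 : 2 ≤ m) (hK : Even K) (hK0 : 0 < K) (hY : 1 ≤ Y)
    (hmom : (1 / (Y : ℝ)) ^ K ≤ moment g K m) (hq : Even q) (hqK : 3 * (K + 3) * Y ≤ q)
    (hr : 3 * (q + 3) * (2 ^ (m + 4) * Y) ^ (m - 1) ≤ q * r) :
    ∃ m', (m' = 2 ∨ m' = m) ∧
      (1 + 1 / (2 * ((2 : ℝ) ^ (m + 4) * Y) ^ (m - 1))) ^ (q * r) ≤
        𝔼 x : Fin m' → G, corr (fun y => 1 + g y) univ x ^ (q * r) := by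
  have hY0 : (1 : ℝ) ≤ Y := by exact_mod_cast hY
  have hq0 : 0 < q := lt_of_lt_of_le (by positivity) hqK
  set T : ℝ := (2 : ℝ) ^ (m + 4) * Y with hT
  have h2m : (1 : ℝ) ≤ 2 ^ m := one_le_pow₀ (by norm_num)
  have hTe : T = 16 * 2 ^ m * Y := by rw [hT, pow_add]; ring
  have hTY : 16 * Y ≤ T := by
    rw [hTe]; nlinarith
  have hT1 : 1 ≤ T := by linarith
  have hmoments : ∀ {j : ℕ}, Even j → ∀ i : ℕ, 0 ≤ 𝔼 x : Fin j → G, corr g univ x ^ i := by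
    intro j hj i
    rw [expect_corr_pow, Finset.card_univ, Fintype.card_fin]
    exact moment_nonneg hj
  rcases lt_or_ge ((1 / T ^ (m - 1)) ^ q) (moment g q 2) with h2 | h2
  · refine ⟨2, Or.inl rfl, ?_⟩
    have h := one_add_pow_le_expect (fun x : Fin 2 → G => corr g univ x) (hmoments even_two)
      (q := q * r) hq hq0 (η := 1 / T ^ (m - 1)) (by positivity)
      (by rw [div_le_one (by positivity)]; exact one_le_pow₀ hT1)
      (by rw [expect_corr_pow, Finset.card_univ, Fintype.card_fin]; exact h2.le)
      (by
        rw [mul_one_div, le_div_iff₀ (by positivity), hT]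
        exact_mod_cast hr)
    simp only [corr_one_add_two hg]
    refine le_trans (le_of_eq ?_) h
    congr 2
    field_simp
  · refine ⟨m, Or.inr rfl, ?_⟩
    set η : ℝ := 1 / Y with hη
    have hη0 : 0 < η := by positivity
    have hη1 : η ≤ 1 := by rw [hη, div_le_one (by positivity)]; exact hY0
    set b := nrm q (fun x : Fin m → G => 1 + corr g univ x) with hb
    set a := nrm q (fun x : Fin m → G => corr g univ x) with ha
    set u := nrm q (fun x : Fin m → G => corr (fun y => 1 + g y) univ x) with hu
    have hb1 : 1 + η / 2 ≤ b := by
      refine le_nrm hq0 ?_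
      simp only [hq.pow_abs]
      refine one_add_pow_le_expect (fun x : Fin m → G => corr g univ x) (hmoments hm) hK hK0
        hη0 hη1 ?_ ?_
      · rw [expect_corr_pow, Finset.card_univ, Fintype.card_fin]; exact hmom
      · rw [hη, mul_one_div, le_div_iff₀ (by positivity)]
        exact_mod_cast hqK
    have hab : a ≤ b + 1 := by
      have h := nrm_add_le hq0 (fun x : Fin m → G => 1 + corr g univ x) (fun _ => -1)
      rw [nrm_neg, nrm_one] at h
      simpa [ha, hb] using h
    have hbu : b ≤ u + η / 16 * (1 + a) := by
      simp only [hb, corr_sub_sum hg hm2]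
      refine (nrm_add_le hq0 _ _).trans ?_
      rw [nrm_neg]
      gcongr
      refine (nrm_sum_le hq0 _ _).trans ?_
      refine (Finset.sum_le_card_nsmul _ _ ((1 + a) / T) fun S hS => ?_).trans ?_
      · rw [mem_filter] at hS
        exact two_le_or_moment g hT1 hm hm2 hq0 hq h2 hS.2.1 hS.2.2
      · rw [nsmul_eq_mul]
        have hc : (#(univ.filter fun S : Finset (Fin m) => 2 ≤ #S ∧ #S < m) : ℝ) ≤ 2 ^ m := by
          have := Finset.card_le_univ (univ.filter fun S : Finset (Fin m) => 2 ≤ #S ∧ #S < m)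
          rw [Fintype.card_finset, Fintype.card_fin] at this
          exact_mod_cast this
        have ha0 : 0 ≤ a := nrm_nonneg _ _
        calc _ ≤ (2 : ℝ) ^ m * ((1 + a) / T) := by gcongr
          _ = η / 16 * (1 + a) := by
            rw [hTe, hη]; field_simp
    have hu1 : 1 + η / 4 ≤ u := by nlinarith
    have hnn : ∀ x : Fin m → G, 0 ≤ corr (fun y => 1 + g y) univ x := fun x =>
      Finset.expect_nonneg fun z _ => Finset.prod_nonneg fun i _ => hg1 _
    have hpow : (1 + η / 4) ^ q ≤ 𝔼 x : Fin m → G, corr (fun y => 1 + g y) univ x ^ q := by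
      rw [← nrm_pow_of_even hq0 hq]
      gcongr
    calc (1 + 1 / (2 * T ^ (m - 1))) ^ (q * r) ≤ (1 + η / 4) ^ (q * r) := by
          have h1 : T ≤ T ^ (m - 1) := le_self_pow₀ hT1 (by omega)
          have h3 : 1 / (2 * T ^ (m - 1)) ≤ η / 4 := by
            rw [hη, div_div]
            exact one_div_le_one_div_of_le (by positivity) (by linarith)
          exact pow_le_pow_left₀ (by positivity) (by linarith) _
      _ = ((1 + η / 4) ^ q) ^ r := pow_mul _ _ _
      _ ≤ (𝔼 x : Fin m → G, corr (fun y => 1 + g y) univ x ^ q) ^ r := by gcongr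
      _ ≤ 𝔼 x : Fin m → G, (corr (fun y => 1 + g y) univ x ^ q) ^ r :=
          pow_expect_le _ (fun x => pow_nonneg (hnn x) _) r
      _ = _ := by simp only [← pow_mul]

end Unbalancing

/-! ### Non-uniformity and sifting -/

section Sifting

variable {G : Type*} [AddCommGroup G] [Fintype G]

/-- The density of a subset of a finite type. -/
def dens {Ω : Type*} [Fintype Ω] (A : Finset Ω) : ℝ := (#A : ℝ) / Fintype.card Ω

lemma expect_ind {Ω : Type*} [Fintype Ω] (A : Finset Ω) : 𝔼 z, ind A z = dens A := by
  simp [Fintype.expect_eq_sum_div_card, ind, dens]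

lemma ind_nonneg {Ω : Type*} (A : Finset Ω) (x : Ω) : 0 ≤ ind A x := by
  unfold ind; split_ifs <;> norm_num

lemma ind_le_one {Ω : Type*} (A : Finset Ω) (x : Ω) : ind A x ≤ 1 := by
  unfold ind; split_ifs <;> norm_num

lemma dens_pos {Ω : Type*} [Fintype Ω] {A : Finset Ω} (hA : A.Nonempty) : 0 < dens A := by
  have : 0 < Fintype.card Ω := Fintype.card_pos_iff.2 ⟨hA.choose⟩
  have := hA.card_pos
  unfold dens
  positivity

/-- The indicator function of a set, normalised to have mean one. -/
def mu {Ω : Type*} [Fintype Ω] (A : Finset Ω) (x : Ω) : ℝ := ind A x / dens A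

lemma mu_nonneg {Ω : Type*} [Fintype Ω] (A : Finset Ω) (x : Ω) : 0 ≤ mu A x :=
  div_nonneg (ind_nonneg _ _) (by unfold dens; positivity)

lemma expect_mu {Ω : Type*} [Fintype Ω] {A : Finset Ω} (hA : A.Nonempty) : 𝔼 z, mu A z = 1 := by
  simp only [mu, ← Finset.expect_div, expect_ind]
  exact div_self (dens_pos hA).ne'

lemma moment_const_mul (c : ℝ) (f : G → ℝ) (q j : ℕ) :
    moment (fun x => c * f x) q j = c ^ (q * j) * moment f q j := by
  simp only [moment, corr, Finset.prod_mul_distrib, Finset.prod_const, Finset.card_univ,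
    Fintype.card_fin, ← Finset.mul_expect, mul_pow, ← pow_mul]

lemma energy_eq_moment (f : G → ℝ) (k l : ℕ) :
    energy G k l f = (Fintype.card G : ℝ) ^ (k + l) * moment f k l := by
  have hN : (Fintype.card G : ℝ) ≠ 0 := by exact_mod_cast Fintype.card_ne_zero
  have h := expect_corr_pow f (univ : Finset (Fin l)) k
  rw [Finset.card_univ, Fintype.card_fin] at h
  rw [← h, Fintype.expect_eq_sum_div_card]
  have hc : ∀ x : Fin l → G, corr f univ x = conv G l f x / Fintype.card G := fun x => by
    rw [corr, Fintype.expect_eq_sum_div_card, conv]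
  simp only [hc, div_pow, ← Finset.sum_div, Fintype.card_pi, Finset.prod_const, Finset.card_univ,
    Fintype.card_fin, Nat.cast_pow, energy]
  field_simp
  ring

lemma le_moment_of_not_unif {A : Finset G} (hA : A.Nonempty) {ε : ℝ} {k l : ℕ} (hε : 0 < ε)
    (h : ¬ unif G ε k l A) :
    (ε ^ (2 * l)) ^ (2 * k) ≤ moment (fun x => mu A x - 1) (2 * k) (2 * l) := by
  have hδ := dens_pos hA
  have hN : (0 : ℝ) < Fintype.card G := by exact_mod_cast Fintype.card_pos
  have hbal : bal A = fun x => dens A * (mu A x - 1) := by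
    funext x
    rw [bal, mu, mul_sub, mul_div_cancel₀ _ hδ.ne', mul_one, dens]
  set g : G → ℝ := fun x => mu A x - 1 with hg
  have h1 : ε ^ (k * l) ≤ moment g k l := by
    rw [unif, not_le, energy_eq_moment, hbal, moment_const_mul, ← dens] at h
    have h' : (dens A ^ (k * l) * (Fintype.card G : ℝ) ^ (k + l)) * ε ^ (k * l) <
        (dens A ^ (k * l) * (Fintype.card G : ℝ) ^ (k + l)) * moment g k l := by linarith
    exact (lt_of_mul_lt_mul_left h' (by positivity)).le
  calc (ε ^ (2 * l)) ^ (2 * k) = ((ε ^ (k * l)) ^ 2) ^ 2 := by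
        simp only [← pow_mul]; congr 1; ring
    _ ≤ (moment g k l ^ 2) ^ 2 := by gcongr
    _ ≤ moment g k (2 * l) ^ 2 := by gcongr; exact moment_sq_le _ _ _
    _ = moment g (2 * l) k ^ 2 := by rw [moment_comm]
    _ ≤ moment g (2 * l) (2 * k) := moment_sq_le _ _ _
    _ = _ := moment_comm _ _ _

/-- The set of common translates `{y | ∀ j, z_j + y ∈ A}`. -/
def sift {q : ℕ} (A : Finset G) (z : Fin q → G) : Finset G := univ.filter fun y => ∀ j, z j + y ∈ A

lemma ind_sift {q : ℕ} (A : Finset G) (z : Fin q → G) (y : G) :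
    ind (sift A z) y = ∏ j, ind A (z j + y) := by
  by_cases h : ∀ j, z j + y ∈ A
  · simp [ind, sift, h]
  · have h' : ∃ j, ¬ z j + y ∈ A := not_forall.1 h
    obtain ⟨j, hj⟩ := h'
    rw [Finset.prod_eq_zero (mem_univ j) (by simp [ind, hj])]
    simp [ind, sift, h]

lemma expect_dens_sift {q : ℕ} (A : Finset G) : 𝔼 z : Fin q → G, dens (sift A z) = dens A ^ q := by
  simp only [← expect_ind, ind_sift]
  rw [Finset.expect_comm]
  rw [← Fintype.expect_const (ι := G) ((𝔼 z, ind A z) ^ q)]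
  refine Finset.expect_congr rfl fun y _ => ?_
  rw [expect_pi_prod (fun (_ : Fin q) t => ind A (t + y))]
  simp only [Finset.prod_const, Finset.card_univ, Fintype.card_fin]
  congr 1
  exact Fintype.expect_equiv (Equiv.addRight y) _ _ fun z => rfl

lemma expect_corr_mu_pow_mul {m q : ℕ} {A : Finset G} (hA : A.Nonempty) (F : (Fin m → G) → ℝ) :
    dens A ^ (q * m) * 𝔼 x, corr (mu A) univ x ^ q * F x =
      𝔼 z : Fin q → G, 𝔼 x, (∏ i, ind (sift A z) (x i)) * F x := by
  have hδ := dens_pos hA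
  simp only [corr_pow, ind_sift, Finset.expect_mul]
  rw [Finset.expect_comm, Finset.mul_expect]
  refine Finset.expect_congr rfl fun z _ => ?_
  rw [Finset.mul_expect]
  refine Finset.expect_congr rfl fun x _ => ?_
  simp only [mu, Finset.prod_div_distrib, Finset.prod_const, Finset.card_univ, Fintype.card_fin]
  rw [← pow_mul]
  field_simp

lemma expect_prod_ind {Ω : Type*} [Fintype Ω] {m : ℕ} (B : Finset Ω) :
    𝔼 x : Fin m → Ω, ∏ i, ind B (x i) = dens B ^ m := by
  rw [expect_pi_prod (fun (_ : Fin m) t => ind B t)]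
  simp [expect_ind]

/-- Dependent random choice: if the correlations of order `m` of `A` have a large moment, there is
a fairly dense set `B` such that almost all `m`-tuples from `B` have large correlation. -/
lemma exists_sifted_set {m s Z : ℕ} {A : Finset G} (hA : A.Nonempty) (hm : 2 ≤ m) (hZ : 1 ≤ Z)
    (hs : 0 < s)
    (h : (1 + 1 / (Z : ℝ)) ^ (3 * Z * s) ≤ 𝔼 x : Fin m → G, corr (mu A) univ x ^ (3 * Z * s)) :
    ∃ B : Finset G, dens A ^ (3 * Z * s) / 2 ≤ dens B ∧
      𝔼 x : Fin m → G, (∏ i, ind B (x i)) * (if 1 + 1 / (2 * (Z : ℝ)) ≤ corr (mu A) univ x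
        then 0 else 1) ≤ 2 / 2 ^ s * dens B ^ m := by
  have hδ := dens_pos hA
  have hZ0 : (0 : ℝ) < Z := by exact_mod_cast hZ
  set q := 3 * Z * s with hq
  have hq0 : 0 < q := by positivity
  set δ := dens A with hδ'
  set F : (Fin m → G) → ℝ := fun x => if 1 + 1 / (2 * (Z : ℝ)) ≤ corr (mu A) univ x
        then 0 else 1 with hF
  by_contra! hcon
  have hnn : ∀ x : Fin m → G, 0 ≤ corr (mu A) univ x := fun x =>
    Finset.expect_nonneg fun z _ => Finset.prod_nonneg fun i _ => mu_nonneg _ _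
  set E := 𝔼 x : Fin m → G, corr (mu A) univ x ^ q with hE
  have hE1 : 1 < E := lt_of_lt_of_le
    (one_lt_pow₀ (by simp [hZ0]) hq0.ne') h
  have hEF : 2 ^ s * 𝔼 x, corr (mu A) univ x ^ q * F x ≤ E := by
    have h1 : 𝔼 x, corr (mu A) univ x ^ q * F x ≤ (1 + 1 / (2 * (Z : ℝ))) ^ q := by
      refine Finset.expect_le Finset.univ_nonempty fun x _ => ?_
      simp only [hF]
      split_ifs with hx
      · simp only [mul_zero]; positivity
      · rw [mul_one]
        exact pow_le_pow_left₀ (hnn x) (not_le.1 hx).le _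
    have h2 : (2 : ℝ) ≤ (1 + 1 / (3 * (Z : ℝ))) ^ (3 * Z) := by
      refine le_trans (le_of_eq ?_) (one_add_mul_le_pow (le_trans (by norm_num)
        (show (0 : ℝ) ≤ 1 / (3 * (Z : ℝ)) by positivity)) (3 * Z))
      push_cast
      field_simp
      norm_num
    have h3 : (1 + 1 / (3 * (Z : ℝ))) * (1 + 1 / (2 * (Z : ℝ))) ≤ 1 + 1 / Z := by
      have h4 : (1 : ℝ) / Z ≤ 1 := by
        rw [div_le_one hZ0]; exact_mod_cast hZ
      have h5 : (1 : ℝ) / (3 * Z) = 1 / Z / 3 := by field_simp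
      have h6 : (1 : ℝ) / (2 * Z) = 1 / Z / 2 := by field_simp
      have h7 : (0 : ℝ) < 1 / Z := by positivity
      rw [h5, h6]
      nlinarith
    calc 2 ^ s * 𝔼 x, corr (mu A) univ x ^ q * F x
        ≤ ((1 + 1 / (3 * (Z : ℝ))) ^ (3 * Z)) ^ s * (1 + 1 / (2 * (Z : ℝ))) ^ q := by
          refine mul_le_mul (pow_le_pow_left₀ (by norm_num) h2 s) h1 ?_ (by positivity)
          exact Finset.expect_nonneg fun x _ => mul_nonneg (pow_nonneg (hnn x) _)
            (by simp only [hF]; split_ifs <;> norm_num)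
      _ = ((1 + 1 / (3 * (Z : ℝ))) * (1 + 1 / (2 * (Z : ℝ)))) ^ q := by
          rw [← pow_mul, ← hq, mul_pow]
      _ ≤ (1 + 1 / (Z : ℝ)) ^ q := by gcongr
      _ ≤ E := h
  have key : ∀ z : Fin q → G, dens (sift A z) ^ m ≤ (δ ^ q / 2) ^ (m - 1) * dens (sift A z) +
      2 ^ s / 2 * 𝔼 x : Fin m → G, (∏ i, ind (sift A z) (x i)) * F x := by
    intro z
    have hd0 : 0 ≤ dens (sift A z) := by unfold dens; positivity
    have hU0 : 0 ≤ 𝔼 x : Fin m → G, (∏ i, ind (sift A z) (x i)) * F x :=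
      Finset.expect_nonneg fun x _ => mul_nonneg (Finset.prod_nonneg fun i _ => ind_nonneg _ _)
        (by simp only [hF]; split_ifs <;> norm_num)
    rcases le_or_gt (δ ^ q / 2) (dens (sift A z)) with hz | hz
    · have h1 := hcon _ hz
      have h2 : dens (sift A z) ^ m ≤
          2 ^ s / 2 * 𝔼 x : Fin m → G, (∏ i, ind (sift A z) (x i)) * F x := by
        calc dens (sift A z) ^ m = 2 ^ s / 2 * (2 / 2 ^ s * dens (sift A z) ^ m) := by field_simp
          _ ≤ _ := by gcongr
      have h3 : 0 ≤ (δ ^ q / 2) ^ (m - 1) * dens (sift A z) := by positivity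
      linarith
    · have h1 : dens (sift A z) ^ m ≤ (δ ^ q / 2) ^ (m - 1) * dens (sift A z) := by
        calc dens (sift A z) ^ m = dens (sift A z) ^ (m - 1) * dens (sift A z) := by
              rw [← pow_succ]; congr 1; omega
          _ ≤ _ := by gcongr
      have h3 : 0 ≤ 2 ^ s / 2 * 𝔼 x : Fin m → G, (∏ i, ind (sift A z) (x i)) * F x := by
        positivity
      linarith
  have hsum := Finset.expect_le_expect (s := univ) fun z _ => key z
  rw [Finset.expect_add_distrib, ← Finset.mul_expect, ← Finset.mul_expect, expect_dens_sift,
    ← expect_corr_mu_pow_mul hA F] at hsum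
  have hleft : 𝔼 z : Fin q → G, dens (sift A z) ^ m = δ ^ (q * m) * E := by
    have h1 := expect_corr_mu_pow_mul (q := q) hA (fun _ : Fin m → G => (1 : ℝ))
    simp only [mul_one, expect_prod_ind] at h1
    exact h1.symm
  have hhalf : (δ ^ q / 2) ^ (m - 1) * δ ^ q ≤ δ ^ (q * m) / 2 := by
    rw [div_pow, div_mul_eq_mul_div, ← pow_succ, show m - 1 + 1 = m by omega, ← pow_mul]
    exact div_le_div_of_nonneg_left (by positivity) (by norm_num)
      (le_self_pow₀ (by norm_num : (1 : ℝ) ≤ 2) (by omega : m - 1 ≠ 0))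
  have hP : 0 < δ ^ (q * m) := by positivity
  rw [hleft] at hsum
  have : 2 ^ s / 2 * (δ ^ (q * m) * 𝔼 x, corr (mu A) univ x ^ q * F x) ≤ δ ^ (q * m) * E / 2 := by
    have := mul_le_mul_of_nonneg_left hEF hP.le
    linarith
  nlinarith

end Sifting

/-! ### Exponential moments -/

section Hoeffding

variable {Ω : Type*} [Fintype Ω] [Nonempty Ω]

/-- Hoeffding's lemma. -/
lemma expect_exp_le {z : Ω → ℝ} (hz : ∀ b, |z b| ≤ 1) (hz0 : 𝔼 b, z b = 0) (t : ℝ) :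
    𝔼 b, Real.exp (t * z b) ≤ Real.exp (t ^ 2 / 2) := by
  have h : ∀ b, Real.exp (t * z b) ≤ Real.cosh t + z b * Real.sinh t := fun b => by
    have hb := abs_le.1 (hz b)
    have := convexOn_exp.2 (Set.mem_univ t) (Set.mem_univ (-t))
      (show 0 ≤ (1 + z b) / 2 by linarith) (show 0 ≤ (1 - z b) / 2 by linarith) (by ring)
    simp only [smul_eq_mul] at this
    rw [Real.cosh_eq, Real.sinh_eq]
    rw [show (1 + z b) / 2 * t + (1 - z b) / 2 * -t = t * z b by ring] at this
    linarith
  calc 𝔼 b, Real.exp (t * z b) ≤ 𝔼 b, (Real.cosh t + z b * Real.sinh t) :=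
        Finset.expect_le_expect fun b _ => h b
    _ = Real.cosh t := by
        rw [Finset.expect_add_distrib, ← Finset.expect_mul, hz0, zero_mul, add_zero,
          Fintype.expect_const]
    _ ≤ _ := Real.cosh_le_exp_half_sq t

lemma expect_tail_le {z : Ω → ℝ} (hz : ∀ b, |z b| ≤ 1) (hz0 : 𝔼 b, z b = 0) {η : ℝ}
    (hη : 0 ≤ η) (M : ℕ) : 𝔼 a : Fin M → Ω, (if η * M < ∑ j, z (a j) then (1 : ℝ) else 0) ≤
      Real.exp (-(η ^ 2 * M / 2)) := by
  calc 𝔼 a : Fin M → Ω, (if η * M < ∑ j, z (a j) then (1 : ℝ) else 0)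
      ≤ 𝔼 a : Fin M → Ω, Real.exp (-(η ^ 2 * M)) * ∏ j, Real.exp (η * z (a j)) := by
        refine Finset.expect_le_expect fun a _ => ?_
        rw [← Real.exp_sum, ← Real.exp_add, ← Finset.mul_sum]
        split_ifs with h
        · rw [← Real.exp_zero]
          apply Real.exp_le_exp.2
          nlinarith
        · positivity
    _ = Real.exp (-(η ^ 2 * M)) * (𝔼 b, Real.exp (η * z b)) ^ M := by
        rw [← Finset.mul_expect, expect_pi_prod (fun (_ : Fin M) b => Real.exp (η * z b))]
        simp
    _ ≤ Real.exp (-(η ^ 2 * M)) * Real.exp (η ^ 2 / 2) ^ M := by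
        refine mul_le_mul_of_nonneg_left (pow_le_pow_left₀ ?_ (expect_exp_le hz hz0 η) M)
          (by positivity)
        exact Finset.expect_nonneg fun b _ => by positivity
    _ = _ := by
        rw [← Real.exp_nat_mul, ← Real.exp_add]
        congr 1
        ring

lemma expect_abs_tail_le {z : Ω → ℝ} (hz : ∀ b, |z b| ≤ 1) (hz0 : 𝔼 b, z b = 0) {η : ℝ}
    (hη : 0 ≤ η) (M : ℕ) : 𝔼 a : Fin M → Ω, (if η * M < |∑ j, z (a j)| then (1 : ℝ) else 0) ≤
      2 * Real.exp (-(η ^ 2 * M / 2)) := by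
  have h1 := expect_tail_le hz hz0 hη M
  have h2 := expect_tail_le (z := fun b => -z b) (fun b => by rw [abs_neg]; exact hz b)
    (by rw [Finset.expect_neg_distrib, hz0, neg_zero]) hη M
  have h3 : ∀ a : Fin M → Ω, (if η * M < |∑ j, z (a j)| then (1 : ℝ) else 0) ≤
      (if η * M < ∑ j, z (a j) then (1 : ℝ) else 0) +
      (if η * M < ∑ j, -z (a j) then (1 : ℝ) else 0) := fun a => by
    rw [Finset.sum_neg_distrib]
    rcases abs_cases (∑ j, z (a j)) with h | h <;> rw [h.1] <;> split_ifs <;> norm_num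
  have := Finset.expect_le_expect (s := univ) fun a _ => h3 a
  rw [Finset.expect_add_distrib] at this
  linarith

end Hoeffding

/-! ### Almost periodicity -/

section AlmostPeriodicity

variable {G : Type*} [AddCommGroup G] [Fintype G]

lemma update_sub_diag {G : Type*} [AddCommGroup G] {m : ℕ} {F : (Fin m → G) → ℝ}
    (hF : ∀ x u, F (fun i => x i + u) = F x) (i : Fin m) (x : Fin m → G) (b u : G) :
    F (Function.update x i (b - u)) = F (Function.update (fun j => x j + u) i b) := by
  rw [← hF (Function.update x i (b - u)) u]
  congr 1
  funext j
  by_cases h : j = i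
  · subst h; simp
  · simp [h]

lemma abs_expect_le_one {Ω : Type*} [Fintype Ω] [Nonempty Ω] {f : Ω → ℝ} (h0 : ∀ x, 0 ≤ f x)
    (h1 : ∀ x, f x ≤ 1) : 0 ≤ 𝔼 x, f x ∧ 𝔼 x, f x ≤ 1 :=
  ⟨Finset.expect_nonneg fun x _ => h0 x, Finset.expect_le univ_nonempty fun x _ => h1 x⟩

/-- The average of `F` when the `i`-th coordinate ranges over `B`. -/
def fiberAvg {m : ℕ} (F : (Fin m → G) → ℝ) (B : Finset G) (i : Fin m) (x : Fin m → G) : ℝ :=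
  𝔼 b : B, F (Function.update x i b)

/-- Most samples `a` from `B` approximate the averages of `F` over `B` at almost every point. -/
lemma exists_good_samples {m M : ℕ} {F : (Fin m → G) → ℝ} (hF0 : ∀ x, 0 ≤ F x)
    (hF1 : ∀ x, F x ≤ 1) {B : Finset G} (hB : B.Nonempty) {η : ℝ} (hη : 0 ≤ η) (hm : 0 < m) :
    ∃ T : Finset (Fin M → G), dens B ^ M / 2 ≤ dens T ∧ ∀ a ∈ T, ∀ i,
      𝔼 x, (if η * M < |∑ j, (F (Function.update x i (a j)) - fiberAvg F B i x)|
        then (1 : ℝ) else 0) ≤ 4 * m * Real.exp (-(η ^ 2 * M / 2)) := by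
  have hne : Nonempty B := hB.to_subtype
  set err : (Fin M → G) → Fin m → (Fin m → G) → ℝ := fun a i x =>
    if η * M < |∑ j, (F (Function.update x i (a j)) - fiberAvg F B i x)| then (1 : ℝ) else 0
    with herr
  set κ := 4 * m * Real.exp (-(η ^ 2 * M / 2)) with hκ
  have hκ0 : 0 < κ := by positivity
  set S : (Fin M → B) → ℝ := fun a => ∑ i, 𝔼 x, err (fun j => a j) i x with hS
  have herr0 : ∀ a i x, 0 ≤ err a i x := fun a i x => by simp only [herr]; split_ifs <;> norm_num
  have hS0 : ∀ a, 0 ≤ S a := fun a =>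
    Finset.sum_nonneg fun i _ => Finset.expect_nonneg fun x _ => herr0 _ _ _
  have hES : 𝔼 a, S a ≤ κ / 2 := by
    simp only [hS]
    rw [Finset.expect_sum_comm]
    calc ∑ i, 𝔼 a : Fin M → B, 𝔼 x, err (fun j => a j) i x
        ≤ ∑ i : Fin m, 2 * Real.exp (-(η ^ 2 * M / 2)) := by
          refine Finset.sum_le_sum fun i _ => ?_
          rw [Finset.expect_comm]
          refine Finset.expect_le univ_nonempty fun x _ => ?_
          refine expect_abs_tail_le (z := fun b : B => F (Function.update x i b) - fiberAvg F B i x)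
            (fun b => ?_) ?_ hη M
          · have h := abs_expect_le_one (f := fun b : B => F (Function.update x i b))
              (fun b => hF0 _) (fun b => hF1 _)
            have h0 := hF0 (Function.update x i b)
            have h1 := hF1 (Function.update x i b)
            rw [fiberAvg, abs_le]
            constructor <;> linarith [h.1, h.2]
          · rw [Finset.expect_sub_distrib, Fintype.expect_const, fiberAvg, sub_self]
      _ = κ / 2 := by
          simp only [Finset.sum_const, Finset.card_univ, Fintype.card_fin, nsmul_eq_mul, hκ]
          ring
  set T0 : Finset (Fin M → B) := univ.filter fun a => S a ≤ κ with hT0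
  have hT0d : (1 : ℝ) / 2 ≤ dens T0 := by
    have h1 : ∀ a, 1 - ind T0 a ≤ S a / κ := fun a => by
      by_cases ha : S a ≤ κ
      · simp only [ind, hT0, mem_filter, mem_univ, true_and, ha, if_true, sub_self]
        exact div_nonneg (hS0 a) hκ0.le
      · simp only [ind, hT0, mem_filter, mem_univ, true_and, ha, if_false, sub_zero]
        rw [le_div_iff₀ hκ0, one_mul]
        exact (not_le.1 ha).le
    have h2 := Finset.expect_le_expect (s := univ) fun a _ => h1 a
    rw [Finset.expect_sub_distrib, Fintype.expect_const, expect_ind, ← Finset.expect_div] at h2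
    have h3 : (𝔼 a, S a) / κ ≤ 1 / 2 := by
      rw [div_le_iff₀ hκ0]; linarith
    linarith
  have hinj : Function.Injective fun (a : Fin M → B) (j : Fin M) => (a j : G) := fun a b h => by
    funext j
    exact Subtype.ext (congrFun h j)
  refine ⟨T0.image fun a j => (a j : G), ?_, fun a ha i => ?_⟩
  · simp only [dens, Finset.card_image_of_injective _ hinj, Fintype.card_pi, Finset.prod_const,
      Finset.card_univ, Fintype.card_fin, Nat.cast_pow, Fintype.card_coe] at hT0d ⊢
    have hB0 : (0 : ℝ) < #B := by exact_mod_cast hB.card_pos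
    have hG0 : (0 : ℝ) < Fintype.card G := by exact_mod_cast Fintype.card_pos
    rw [le_div_iff₀ (by positivity)] at hT0d
    rw [div_pow, div_right_comm]
    gcongr
    linarith
  · obtain ⟨a, hat, rfl⟩ := Finset.mem_image.1 ha
    have ha' : S a ≤ κ := (Finset.mem_filter.1 hat).2
    exact (Finset.single_le_sum (f := fun i => 𝔼 x, err (fun j => (a j : G)) i x)
      (fun i _ => Finset.expect_nonneg fun x _ => herr0 _ _ _) (mem_univ i)).trans ha'

lemma exists_dens_le_translates {M : ℕ} (T : Finset (Fin M → G)) :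
    ∃ c : Fin M → G, dens T ≤ dens (univ.filter fun s : G => (fun j => c j - s) ∈ T) := by
  by_contra! h
  have h1 := Finset.expect_lt (s := univ) (fun c _ => (h c).le) ⟨0, mem_univ _, h 0⟩
  refine h1.ne ?_
  simp only [← expect_ind]
  rw [Finset.expect_comm, ← Fintype.expect_const (ι := G) (𝔼 z, ind T z)]
  refine Finset.expect_congr rfl fun s _ => ?_
  refine Fintype.expect_equiv (Equiv.subRight fun _ => s) _ _ fun c => ?_
  simp only [ind, mem_filter, mem_univ, true_and, Equiv.subRight_apply]
  rfl

/-- Croot–Sisask almost periodicity: there is a large set of almost periods for all smoothings over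
`B` of a diagonally invariant function `F`, in each of the coordinates. -/
lemma exists_almost_periods {m M : ℕ} {F : (Fin m → G) → ℝ} (hF0 : ∀ x, 0 ≤ F x)
    (hF1 : ∀ x, F x ≤ 1) (hF : ∀ x u, F (fun i => x i + u) = F x) {B : Finset G}
    (hB : B.Nonempty) {η : ℝ} (hη : 0 ≤ η) (hm : 0 < m) (hM : 0 < M) :
    ∃ X : Finset G, dens B ^ M / 2 ≤ dens X ∧ ∀ x ∈ X, ∀ (i : Fin m) (D : ℝ)
      (ρ : (Fin m → G) → ℝ), (∀ ω, 0 ≤ ρ ω) → (∀ ω, ρ ω ≤ D) → 𝔼 ω, ρ ω = 1 → ∀ u,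
      |(𝔼 ω, ρ ω * 𝔼 b : B, F (Function.update ω i (b + (u + x)))) -
        𝔼 ω, ρ ω * 𝔼 b : B, F (Function.update ω i (b + u))| ≤
      2 * η + 2 * (4 * m * Real.exp (-(η ^ 2 * M / 2))) * D := by
  have hne : Nonempty B := hB.to_subtype
  have hM0 : (0 : ℝ) < M := by exact_mod_cast hM
  obtain ⟨T, hT, hTgood⟩ := exists_good_samples (M := M) hF0 hF1 hB hη hm
  obtain ⟨c, hc⟩ := exists_dens_le_translates T
  set X₀ : Finset G := univ.filter fun s : G => (fun j => c j - s) ∈ T with hX₀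
  have hX₀d : 0 < dens X₀ := lt_of_lt_of_le (by have := dens_pos hB; positivity) (hT.trans hc)
  obtain ⟨s₀, hs₀⟩ : X₀.Nonempty := by
    rw [Finset.nonempty_iff_ne_empty]
    rintro h
    rw [h] at hX₀d
    simp [dens] at hX₀d
  set κ := 4 * m * Real.exp (-(η ^ 2 * M / 2)) with hκ
  set H : Fin m → (Fin m → G) → ℝ := fiberAvg F B with hH
  have hHbound : ∀ i y, 0 ≤ H i y ∧ H i y ≤ 1 := fun i y =>
    abs_expect_le_one (f := fun b : B => F (Function.update y i b)) (fun b => hF0 _) fun b => hF1 _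
  set err : G → Fin m → (Fin m → G) → ℝ := fun s i x =>
    if η * M < |∑ j, (F (Function.update x i (c j - s)) - H i x)| then (1 : ℝ) else 0 with herr
  have herr0 : ∀ a i x, 0 ≤ err a i x := fun a i x => by simp only [herr]; split_ifs <;> norm_num
  set Hc : Fin m → (Fin m → G) → ℝ := fun i x => (∑ j, F (Function.update x i (c j))) / M with hHc
  have hHc01 : ∀ i x, 0 ≤ Hc i x ∧ Hc i x ≤ 1 := fun i x => by
    refine ⟨div_nonneg (Finset.sum_nonneg fun j _ => hF0 _) hM0.le, ?_⟩
    rw [div_le_one hM0]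
    refine (Finset.sum_le_sum fun j _ => hF1 _).trans ?_
    simp
  have hclose : ∀ s i x, |Hc i (fun j => x j + s) - H i x| ≤ η + err s i x := by
    intro s i x
    simp only [herr]
    split_ifs with h
    · have h1 := hHc01 i (fun j => x j + s)
      have h2 := hHbound i x
      rw [abs_le]
      constructor <;> linarith
    · rw [add_zero]
      have h1 : ∑ j, (F (Function.update x i (c j - s)) - H i x) =
          M * (Hc i (fun j => x j + s) - H i x) := by
        simp only [update_sub_diag hF, hHc, Finset.sum_sub_distrib, Finset.sum_const,
          Finset.card_univ, Fintype.card_fin, nsmul_eq_mul]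
        field_simp
      rw [h1, abs_mul, abs_of_pos hM0, not_lt, mul_comm] at h
      exact le_of_mul_le_mul_right h hM0
  have hgood : ∀ s ∈ X₀, ∀ i, 𝔼 x, err s i x ≤ κ := fun s hs i =>
    hTgood _ (Finset.mem_filter.1 hs).2 i
  refine ⟨X₀.image fun s => s - s₀, ?_, ?_⟩
  · have h : dens (X₀.image fun s => s - s₀) = dens X₀ := by
      rw [dens, dens, Finset.card_image_of_injective _ sub_left_injective]
    rw [h]
    exact hT.trans hc
  intro x hx i D ρ hρ0 hρD hρ1 u
  obtain ⟨s, hs, rfl⟩ := Finset.mem_image.1 hx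
  have hq : ∀ v, 𝔼 ω, ρ ω * 𝔼 b : B, F (Function.update ω i (b + v)) =
      𝔼 ω, ρ ω * H i (fun j => ω j - v) := fun v => by
    refine Finset.expect_congr rfl fun ω _ => ?_
    congr 1
    refine Finset.expect_congr rfl fun b _ => ?_
    rw [← sub_neg_eq_add, update_sub_diag hF]
    simp only [sub_eq_add_neg]
  rw [hq, hq, ← Finset.expect_sub_distrib]
  have hpt : ∀ ω, |ρ ω * H i (fun j => ω j - (u + (s - s₀))) - ρ ω * H i (fun j => ω j - u)| ≤
      2 * η * ρ ω + D * (err s i (fun j => ω j - (u + (s - s₀))) +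
        err s₀ i (fun j => ω j - u)) := by
    intro ω
    have h1 := hclose s i (fun j => ω j - (u + (s - s₀)))
    have h2 := hclose s₀ i (fun j => ω j - u)
    have h3 : (fun j => ω j - (u + (s - s₀)) + s) = fun j => ω j - u + s₀ := by
      funext j; abel
    simp only [h3] at h1
    set e1 := err s i (fun j => ω j - (u + (s - s₀)))
    set e2 := err s₀ i (fun j => ω j - u)
    have he1 : 0 ≤ e1 := herr0 _ _ _
    have he2 : 0 ≤ e2 := herr0 _ _ _
    rw [← mul_sub, abs_mul, abs_of_nonneg (hρ0 ω)]
    have h4 : |H i (fun j => ω j - (u + (s - s₀))) - H i (fun j => ω j - u)| ≤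
        2 * η + (e1 + e2) := by
      rw [abs_le] at h1 h2 ⊢
      constructor <;> linarith [h1.1, h1.2, h2.1, h2.2]
    calc ρ ω * |H i (fun j => ω j - (u + (s - s₀))) - H i (fun j => ω j - u)|
        ≤ ρ ω * (2 * η + (e1 + e2)) := mul_le_mul_of_nonneg_left h4 (hρ0 ω)
      _ = 2 * η * ρ ω + ρ ω * (e1 + e2) := by ring
      _ ≤ _ := by
          have := mul_le_mul_of_nonneg_right (hρD ω) (add_nonneg he1 he2)
          linarith
  have hshift : ∀ (f : (Fin m → G) → ℝ) v,
      𝔼 ω : Fin m → G, f (fun j => ω j - v) = 𝔼 ω, f ω := fun f v =>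
    Fintype.expect_equiv (Equiv.subRight fun _ => v) _ _ fun ω => rfl
  have hD : 0 ≤ D := (hρ0 0).trans (hρD 0)
  calc _ ≤ 𝔼 ω, |ρ ω * H i (fun j => ω j - (u + (s - s₀))) - ρ ω * H i (fun j => ω j - u)| :=
        Finset.abs_expect_le _ _
    _ ≤ 𝔼 ω, (2 * η * ρ ω + D * (err s i (fun j => ω j - (u + (s - s₀))) +
        err s₀ i (fun j => ω j - u))) := Finset.expect_le_expect fun ω _ => hpt ω
    _ = 2 * η + D * (𝔼 ω, err s i ω + 𝔼 ω, err s₀ i ω) := by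
        rw [Finset.expect_add_distrib, ← Finset.mul_expect, ← Finset.mul_expect, hρ1,
          Finset.expect_add_distrib, hshift, hshift, mul_one]
    _ ≤ 2 * η + D * (κ + κ) := by
        have := hgood s hs i
        have := hgood s₀ hs₀ i
        gcongr
    _ = _ := by ring

end AlmostPeriodicity

/-! ### Fourier analysis on vector spaces over prime fields -/

section Fourier

variable {p : ℕ} [Fact p.Prime] {W : Type*} [AddCommGroup W] [Module (ZMod p) W]

/-- The additive character of `W` attached to a linear functional. -/
def ch (φ : Module.Dual (ZMod p) W) (x : W) : ℂ := ZMod.stdAddChar (φ x)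

lemma ch_add (φ : Module.Dual (ZMod p) W) (x y : W) : ch φ (x + y) = ch φ x * ch φ y := by
  simp [ch, AddChar.map_add_eq_mul]

lemma norm_ch (φ : Module.Dual (ZMod p) W) (x : W) : ‖ch φ x‖ = 1 := by
  rw [ch, ZMod.stdAddChar_apply]
  exact Circle.norm_coe _

lemma conj_ch (φ : Module.Dual (ZMod p) W) (x : W) : (starRingEnd ℂ) (ch φ x) = ch φ (-x) := by
  have h : ch φ x * ch φ (-x) = 1 := by rw [← ch_add]; simp [ch]
  rw [← Complex.inv_eq_conj (norm_ch φ x)]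
  exact inv_eq_of_mul_eq_one_right h

lemma sum_ch [Fintype W] [Fintype (Module.Dual (ZMod p) W)] (a : W) :
    ∑ φ : Module.Dual (ZMod p) W, ch φ a = if a = 0 then (Fintype.card W : ℂ) else 0 := by
  split_ifs with ha
  · subst ha
    have h : Fintype.card (Module.Dual (ZMod p) W) = Fintype.card W := by
      rw [Module.card_eq_pow_finrank (K := ZMod p) (V := W),
        Module.card_eq_pow_finrank (K := ZMod p) (V := Module.Dual (ZMod p) W),
        Subspace.dual_finrank_eq]
    simp [ch, h]
  · obtain ⟨φ₀, hφ₀⟩ : ∃ φ₀ : Module.Dual (ZMod p) W, φ₀ a ≠ 0 := by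
      by_contra! h
      exact ha ((Module.forall_dual_apply_eq_zero_iff (ZMod p) a).1 h)
    have h1 : ch φ₀ a ≠ 1 := by
      rw [ch, ← AddChar.map_zero_eq_one (ZMod.stdAddChar (N := p))]
      exact fun h => hφ₀ (ZMod.injective_stdAddChar h)
    have h2 : ∑ φ : Module.Dual (ZMod p) W, ch φ a =
        ch φ₀ a * ∑ φ : Module.Dual (ZMod p) W, ch φ a := by
      rw [Finset.mul_sum]
      refine (Fintype.sum_equiv (Equiv.addLeft φ₀) _ _ fun φ => ?_).symm
      simp [ch, AddChar.map_add_eq_mul]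
    have h3 : (ch φ₀ a - 1) * ∑ φ : Module.Dual (ZMod p) W, ch φ a = 0 := by
      rw [sub_mul, ← h2, one_mul, sub_self]
    exact (mul_eq_zero.1 h3).resolve_left (sub_ne_zero.2 h1)

/-- The Fourier coefficient of a real-valued function. -/
def fc [Fintype W] (h : W → ℝ) (φ : Module.Dual (ZMod p) W) : ℂ := 𝔼 x, (h x : ℂ) * ch φ x

lemma conj_expect {ι : Type*} [Fintype ι] (f : ι → ℂ) :
    (starRingEnd ℂ) (𝔼 i, f i) = 𝔼 i, (starRingEnd ℂ) (f i) := by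
  simp [Fintype.expect_eq_sum_div_card]

lemma sum_norm_fc_sq [Fintype W] [Fintype (Module.Dual (ZMod p) W)] (h : W → ℝ) :
    ∑ φ : Module.Dual (ZMod p) W, ‖fc h φ‖ ^ 2 = 𝔼 x, h x ^ 2 := by
  have h1 : ∀ φ : Module.Dual (ZMod p) W, ((‖fc h φ‖ ^ 2 : ℝ) : ℂ) =
      𝔼 x, 𝔼 y, ((h x * h y : ℝ) : ℂ) * ch φ (x - y) := fun φ => by
    push_cast
    rw [← Complex.mul_conj', fc, conj_expect, Fintype.expect_mul_expect]
    refine Finset.expect_congr rfl fun x _ => Finset.expect_congr rfl fun y _ => ?_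
    rw [map_mul, Complex.conj_ofReal, conj_ch, sub_eq_add_neg, ch_add]
    ring
  have h2 : ((∑ φ : Module.Dual (ZMod p) W, ‖fc h φ‖ ^ 2 : ℝ) : ℂ) =
      ((𝔼 x, h x ^ 2 : ℝ) : ℂ) := by
    rw [Complex.ofReal_sum]
    simp only [h1]
    rw [← Finset.expect_sum_comm, Complex.ofReal_expect]
    refine Finset.expect_congr rfl fun x _ => ?_
    rw [← Finset.expect_sum_comm]
    simp only [← Finset.mul_sum, sum_ch, sub_eq_zero]
    rw [Fintype.expect_eq_sum_div_card]
    have hN : (Fintype.card W : ℂ) ≠ 0 := by exact_mod_cast Fintype.card_ne_zero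
    simp [hN, sq]
  exact_mod_cast h2

/-- Averaging over translates. -/
def trAvg {W ι : Type*} [AddCommGroup W] [Fintype ι] (c : ι → W) (h : W → ℝ) (u : W) : ℝ :=
  𝔼 i, h (u + c i)

lemma trAvg_comm {W ι κ : Type*} [AddCommGroup W] [Fintype ι] [Fintype κ] (c : ι → W) (d : κ → W)
    (h : W → ℝ) : trAvg c (trAvg d h) = trAvg d (trAvg c h) := by
  funext u
  simp only [trAvg]
  rw [Finset.expect_comm]
  simp only [add_right_comm]

lemma fc_trAvg [Fintype W] {ι : Type*} [Fintype ι] (c : ι → W) (h : W → ℝ)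
    (φ : Module.Dual (ZMod p) W) :
    fc (trAvg c h) φ = (starRingEnd ℂ) (𝔼 i, ch φ (c i)) * fc h φ := by
  rw [conj_expect, fc, fc, Finset.expect_mul]
  simp only [trAvg, Complex.ofReal_expect, Finset.expect_mul]
  rw [Finset.expect_comm]
  refine Finset.expect_congr rfl fun i _ => ?_
  rw [Finset.mul_expect]
  refine Fintype.expect_equiv (Equiv.addRight (c i)) _ _ fun x => ?_
  rw [Equiv.coe_addRight, conj_ch, mul_left_comm, ← ch_add]
  simp

lemma fc_sub [Fintype W] (f g : W → ℝ) (φ : Module.Dual (ZMod p) W) :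
    fc (f - g) φ = fc f φ - fc g φ := by
  simp [fc, sub_mul, Finset.expect_sub_distrib]

lemma expect_trAvg_sq_le [Fintype W] [Fintype (Module.Dual (ZMod p) W)] {ι : Type*} [Fintype ι]
    (c : ι → W) (h : W → ℝ) {r : ℝ}
    (hr : ∀ φ : Module.Dual (ZMod p) W, fc h φ ≠ 0 → ‖𝔼 i, ch φ (c i)‖ ≤ r) :
    𝔼 u, trAvg c h u ^ 2 ≤ r ^ 2 * 𝔼 u, h u ^ 2 := by
  rw [← sum_norm_fc_sq (p := p), ← sum_norm_fc_sq (p := p), Finset.mul_sum]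
  refine Finset.sum_le_sum fun φ _ => ?_
  rw [fc_trAvg, norm_mul, mul_pow, RCLike.norm_conj]
  by_cases h0 : fc h φ = 0
  · simp [h0]
  · have := hr φ h0
    gcongr

lemma abs_iterate_trAvg_sub_le {W ι : Type*} [AddCommGroup W] [Fintype ι] [Nonempty ι] {c : ι → W}
    {f : W → ℝ} {τ : ℝ} (h : ∀ i u, |f (u + c i) - f u| ≤ τ) (t : ℕ) (u : W) :
    |(trAvg c)^[t] f u - f u| ≤ t * τ := by
  induction t generalizing u with
  | zero => simp
  | succ t ih =>
    rw [Function.iterate_succ_apply', trAvg, ← Fintype.expect_const (ι := ι) (f u),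
      ← Finset.expect_sub_distrib]
    refine (Finset.abs_expect_le _ _).trans (Finset.expect_le univ_nonempty fun i _ => ?_)
    have h1 := abs_le.1 (ih (u + c i))
    have h2 := abs_le.1 (h i u)
    push_cast
    rw [abs_le]
    constructor <;> linarith [h1.1, h1.2, h2.1, h2.2]

/-- If `q` is a smoothing of a bounded function over a dense set `B` and all elements of `X` are
almost periods of `q`, then so are the elements of the annihilator of the large spectrum of `X`, on
average. -/
lemma abs_trAvg_sub_le [Fintype W] {B X : Finset W} (hB : B.Nonempty) (hX : X.Nonempty) {R : ℕ}
    (hBR : (1 : ℝ) ≤ 2 ^ R * dens B) {V : Submodule (ZMod p) W}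
    (hV : ∀ φ : Module.Dual (ZMod p) W, 1 / 2 < ‖𝔼 x : X, ch φ (x : W)‖ → ∀ v ∈ V, φ v = 0)
    {g : W → ℝ} (hg0 : ∀ x, 0 ≤ g x) (hg1 : ∀ x, g x ≤ 1) {τ : ℝ}
    (hτ : ∀ x ∈ X, ∀ u, |(𝔼 b : B, g (b + (u + x))) - 𝔼 b : B, g (b + u)| ≤ τ) (t : ℕ) :
    |(𝔼 b : B, g b) - 𝔼 v : V, 𝔼 b : B, g (b + v)| ≤ t * (2 * τ) + 2 ^ R * (1 / 2) ^ t := by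
  have := hB.to_subtype
  have := hX.to_subtype
  let _ : Fintype (Module.Dual (ZMod p) W) :=
    @Fintype.ofFinite _ (Module.finite_of_finite (ZMod p))
  set T : (W → ℝ) → W → ℝ := trAvg fun x : X => (x : W) with hT
  set A : (W → ℝ) → W → ℝ := trAvg fun b : B => (b : W) with hA
  set P : (W → ℝ) → W → ℝ := trAvg fun v : V => (v : W) with hP
  set f₀ : W → ℝ := g - P g with hf₀
  have hP1 : ∀ u, 0 ≤ P g u ∧ P g u ≤ 1 := fun u =>
    abs_expect_le_one (fun _ => hg0 _) fun _ => hg1 _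
  have hzero : ∀ t (φ : Module.Dual (ZMod p) W), (∀ v ∈ V, φ v = 0) → fc (T^[t] f₀) φ = 0 := by
    intro t φ hφ
    induction t with
    | zero =>
      have h1 : ∀ v : V, ch φ (v : W) = 1 := fun v => by simp [ch, hφ v v.2]
      rw [Function.iterate_zero_apply, hf₀, fc_sub, hP, fc_trAvg]
      simp [h1]
    | succ t ih => rw [Function.iterate_succ_apply', hT, fc_trAvg, ih, mul_zero]
  have hL2 : 𝔼 u, T^[t] f₀ u ^ 2 ≤ ((1 / 2 : ℝ) ^ 2) ^ t := by
    induction t with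
    | zero =>
      refine Finset.expect_le univ_nonempty fun u _ => ?_
      have h1 := hP1 u
      have h2 := hg0 u
      have h3 := hg1 u
      simp only [Function.iterate_zero_apply, hf₀, Pi.sub_apply, pow_zero]
      rw [sq_le_one_iff_abs_le_one, abs_le]
      constructor <;> linarith [h1.1, h1.2]
    | succ t ih =>
      rw [pow_succ' _ t]
      simp only [Function.iterate_succ_apply']
      refine (expect_trAvg_sq_le (p := p) _ _ fun φ hφ => ?_).trans
        (mul_le_mul_of_nonneg_left ih (by positivity))
      by_contra! h
      exact hφ (hzero t φ (hV φ h))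
  have hAf : A f₀ = A g - P (A g) := by
    rw [hP, hA, trAvg_comm, ← hA, ← hP]
    funext u
    simp [hA, hf₀, trAvg, Finset.expect_sub_distrib]
  have hAτ : ∀ (x : X) u, |A g (u + x) - A g u| ≤ τ := fun x u => by
    have := hτ x x.2 u
    simp only [hA, trAvg]
    simpa only [add_comm _ (u + (x : W)), add_comm _ u] using this
  have hfτ : ∀ (x : X) u, |A f₀ (u + x) - A f₀ u| ≤ 2 * τ := fun x u => by
    have h1 := hAτ x u
    have h2 : |P (A g) (u + x) - P (A g) u| ≤ τ := by
      rw [hP, trAvg, trAvg, ← Finset.expect_sub_distrib]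
      refine (Finset.abs_expect_le _ _).trans (Finset.expect_le univ_nonempty fun v _ => ?_)
      rw [add_right_comm]
      exact hAτ x _
    rw [hAf, Pi.sub_apply, Pi.sub_apply]
    rw [abs_le] at h1 h2 ⊢
    constructor <;> linarith [h1.1, h1.2, h2.1, h2.2]
  have h1 : |T^[t] (A f₀) 0 - A f₀ 0| ≤ t * (2 * τ) := abs_iterate_trAvg_sub_le hfτ t 0
  have hcomm : T^[t] (A f₀) = A (T^[t] f₀) :=
    ((show Function.Commute T A from fun h => trAvg_comm _ _ h).iterate_left t) f₀
  have h2 : |A (T^[t] f₀) 0| ≤ 2 ^ R * (1 / 2) ^ t := by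
    set h := T^[t] f₀ with hh
    have hd := dens_pos hB
    have h3 : (A h 0) ^ 2 ≤ 𝔼 b : B, h b ^ 2 := by
      rw [← sq_abs]
      refine (pow_le_pow_left₀ (abs_nonneg (A h 0)) (Finset.abs_expect_le _ _) 2).trans ?_
      refine (pow_expect_le _ (fun _ => abs_nonneg _) 2).trans (le_of_eq ?_)
      simp only [sq_abs, zero_add]
    have h4 : dens B * 𝔼 b : B, h b ^ 2 ≤ 𝔼 u, h u ^ 2 := by
      have hB0 : (#B : ℝ) ≠ 0 := by exact_mod_cast hB.card_pos.ne'
      rw [Fintype.expect_eq_sum_div_card, Fintype.expect_eq_sum_div_card, dens,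
        Finset.sum_coe_sort B (fun b => h b ^ 2), Fintype.card_coe, div_mul_div_comm,
        mul_comm (Fintype.card W : ℝ), mul_div_mul_left _ _ hB0]
      gcongr
      exact Finset.subset_univ B
    have h5 : 0 ≤ 𝔼 b : B, h b ^ 2 := Finset.expect_nonneg fun _ _ => sq_nonneg _
    have h6 : 𝔼 b : B, h b ^ 2 ≤ 2 ^ R * ((1 / 2 : ℝ) ^ 2) ^ t := by
      calc 𝔼 b : B, h b ^ 2 ≤ (2 ^ R * dens B) * 𝔼 b : B, h b ^ 2 :=
            le_mul_of_one_le_left h5 hBR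
        _ = 2 ^ R * (dens B * 𝔼 b : B, h b ^ 2) := by ring
        _ ≤ _ := by gcongr; exact h4.trans hL2
    refine abs_le_of_sq_le_sq ?_ (by positivity)
    refine (h3.trans h6).trans ?_
    rw [mul_pow, pow_right_comm]
    gcongr
    exact le_self_pow₀ (one_le_pow₀ (by norm_num)) (by norm_num)
  rw [hcomm] at h1
  have h7 : (𝔼 b : B, g b) - 𝔼 v : V, 𝔼 b : B, g (b + v) = A f₀ 0 := by
    rw [hAf, Pi.sub_apply]
    simp only [hA, hP, trAvg, zero_add]
    simp only [add_comm]
  rw [h7]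
  rw [abs_le] at h1 h2 ⊢
  constructor <;> linarith [h1.1, h1.2, h2.1, h2.2]

lemma expect_comp_linearMap_of_surjective {K U W : Type*} [Field K] [AddCommGroup U] [Module K U]
    [Fintype U] [AddCommGroup W] [Module K W] [Fintype W] {f : W →ₗ[K] U}
    (hf : Function.Surjective f) (H : U → ℝ) : 𝔼 x, H (f x) = 𝔼 y, H y := by
  have h1 : ∀ y : U, 𝔼 x, H (f x + y) = 𝔼 x, H (f x) := fun y => by
    obtain ⟨w, rfl⟩ := hf y
    exact Fintype.expect_equiv (Equiv.addRight w) _ _ fun x => by simp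
  have h2 : ∀ x : W, 𝔼 y, H (f x + y) = 𝔼 y, H y := fun x =>
    Fintype.expect_equiv (Equiv.addLeft (f x)) _ _ fun y => rfl
  calc 𝔼 x, H (f x) = 𝔼 y : U, 𝔼 x, H (f x + y) := by simp only [h1, Fintype.expect_const]
    _ = 𝔼 y, H y := by rw [Finset.expect_comm]; simp only [h2, Fintype.expect_const]

lemma surjective_pi_of_linearIndependent {K W ι : Type*} [Field K] [AddCommGroup W] [Module K W]
    [Fintype ι] [DecidableEq ι] {φ : ι → Module.Dual K W} (hφ : LinearIndependent K φ) :
    Function.Surjective (LinearMap.pi φ) := by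
  rw [← LinearMap.dualMap_injective_iff, injective_iff_map_eq_zero]
  intro g hg
  have h1 : ∑ i, g (Pi.single i 1) • φ i = 0 := by
    ext x
    have h2 := LinearMap.congr_fun hg x
    rw [LinearMap.dualMap_apply, LinearMap.pi_apply_eq_sum_univ] at h2
    have h3 : ∀ i : ι, (fun j => if i = j then (1 : K) else 0) = Pi.single i 1 := fun i => by
      funext j
      simp [Pi.single_apply, eq_comm]
    simpa [h3, mul_comm] using h2
  have h4 := Fintype.linearIndependent_iff.1 hφ _ h1
  refine LinearMap.pi_ext' fun i => ?_
  ext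
  simpa using h4 i

lemma exp_expect_le {ι : Type*} [Fintype ι] [Nonempty ι] (f : ι → ℝ) :
    Real.exp (𝔼 i, f i) ≤ 𝔼 i, Real.exp (f i) := by
  have h : ∀ i, Real.exp (𝔼 i, f i) * (1 + (f i - 𝔼 i, f i)) ≤ Real.exp (f i) := fun i => by
    calc _ ≤ Real.exp (𝔼 i, f i) * Real.exp (f i - 𝔼 i, f i) := by
          gcongr
          linarith [Real.add_one_le_exp (f i - 𝔼 i, f i)]
      _ = _ := by rw [← Real.exp_add]; congr 1; ring
  have := Finset.expect_le_expect (s := univ) fun i _ => h i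
  rw [← Finset.mul_expect, Finset.expect_add_distrib, Finset.expect_sub_distrib,
    Fintype.expect_const, Fintype.expect_const, sub_self, add_zero, mul_one] at this
  exact this

/-- The large spectrum of a set of density `α` contains at most `8 log (1 / α)` linearly independent
functionals. -/
lemma card_le_of_linearIndependent [Fintype W] {X : Finset W} (hX : X.Nonempty) {ι : Type*}
    [Fintype ι] [DecidableEq ι] {φ : ι → Module.Dual (ZMod p) W} (hφ : LinearIndependent (ZMod p) φ)
    (hφX : ∀ i, 1 / 2 < ‖𝔼 x : X, ch (φ i) (x : W)‖) :
    (Fintype.card ι : ℝ) ≤ 8 * Real.log (1 / dens X) := by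
  have hne := hX.to_subtype
  have hd := dens_pos hX
  set d := Fintype.card ι with hd'
  have hu : ∀ i, ∃ u : ℂ, ‖u‖ = 1 ∧ (u * 𝔼 x : X, ch (φ i) (x : W)).re =
      ‖𝔼 x : X, ch (φ i) (x : W)‖ := fun i => by
    set z := 𝔼 x : X, ch (φ i) (x : W) with hz
    have hz0 : ‖z‖ ≠ 0 := fun h => by have := hφX i; rw [← hz, h] at this; norm_num at this
    refine ⟨(starRingEnd ℂ) z / ‖z‖, ?_, ?_⟩
    · rw [norm_div, RCLike.norm_conj, Complex.norm_real, norm_norm, div_self hz0]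
    · rw [div_mul_eq_mul_div, Complex.conj_mul', sq, mul_div_assoc, ← Complex.ofReal_div,
        div_self hz0]
      simp
  choose u hu1 hu2 using hu
  set z : ι → ZMod p → ℝ := fun i t => (u i * ZMod.stdAddChar t).re with hz
  have hz1 : ∀ i t, |z i t| ≤ 1 := fun i t => by
    refine (Complex.abs_re_le_norm _).trans ?_
    rw [norm_mul, hu1, one_mul, ZMod.stdAddChar_apply, Circle.norm_coe]
  have hz0 : ∀ i, 𝔼 t, z i t = 0 := fun i => by
    have h1 : (ZMod.stdAddChar (N := p)) ≠ 0 := by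
      intro h
      have h2 : (ZMod.stdAddChar (N := p)) 1 = (ZMod.stdAddChar (N := p)) 0 := by rw [h]; simp
      exact one_ne_zero (ZMod.injective_stdAddChar h2)
    have h2 := AddChar.sum_eq_zero_iff_ne_zero.2 h1
    rw [Fintype.expect_eq_sum_div_card, hz]
    simp only
    rw [← Complex.re_sum, ← Finset.mul_sum, h2]
    simp
  have hlow : (d : ℝ) / 2 ≤ 𝔼 x : X, ∑ i, z i (φ i (x : W)) := by
    rw [Finset.expect_sum_comm]
    have h1 : ∀ i, (1 : ℝ) / 2 ≤ 𝔼 x : X, z i (φ i (x : W)) := fun i => by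
      refine (hφX i).le.trans (le_of_eq ?_)
      rw [← hu2, Finset.mul_expect, Fintype.expect_eq_sum_div_card, Fintype.expect_eq_sum_div_card,
        Complex.div_natCast_re, Complex.re_sum]
      rfl
    have h2 := Finset.sum_le_sum (s := univ) fun i _ => h1 i
    simp only [Finset.sum_const, Finset.card_univ, nsmul_eq_mul] at h2
    linarith
  have hup : dens X * 𝔼 x : X, Real.exp (1 / 2 * ∑ i, z i (φ i (x : W))) ≤ Real.exp (d / 8) := by
    have hX0 : (#X : ℝ) ≠ 0 := by exact_mod_cast hX.card_pos.ne'
    calc dens X * 𝔼 x : X, Real.exp (1 / 2 * ∑ i, z i (φ i (x : W)))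
        ≤ 𝔼 x, Real.exp (1 / 2 * ∑ i, z i (φ i x)) := by
          rw [Fintype.expect_eq_sum_div_card, Fintype.expect_eq_sum_div_card, dens,
            Finset.sum_coe_sort X (fun x => Real.exp (1 / 2 * ∑ i, z i (φ i x))), Fintype.card_coe,
            div_mul_div_comm, mul_comm (Fintype.card W : ℝ), mul_div_mul_left _ _ hX0]
          gcongr
          exact Finset.subset_univ X
      _ = 𝔼 y : ι → ZMod p, ∏ i, Real.exp (1 / 2 * z i (y i)) := by
          rw [← expect_comp_linearMap_of_surjective (surjective_pi_of_linearIndependent hφ)]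
          refine Finset.expect_congr rfl fun x _ => ?_
          rw [Finset.mul_sum, Real.exp_sum]
          rfl
      _ = ∏ i, 𝔼 t, Real.exp (1 / 2 * z i t) :=
          expect_pi_prod fun i t => Real.exp (1 / 2 * z i t)
      _ ≤ ∏ _i : ι, Real.exp ((1 / 2) ^ 2 / 2) :=
          Finset.prod_le_prod (fun i _ => Finset.expect_nonneg fun t _ => (Real.exp_pos _).le)
            fun i _ => expect_exp_le (hz1 i) (hz0 i) _
      _ = Real.exp (d / 8) := by
          rw [Finset.prod_const, Finset.card_univ, ← Real.exp_nat_mul]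
          congr 1
          ring
  have h1 := exp_expect_le fun x : X => 1 / 2 * ∑ i, z i (φ i (x : W))
  rw [← Finset.mul_expect] at h1
  have h2 : dens X * Real.exp (d / 4) ≤ Real.exp (d / 8) := by
    refine le_trans ?_ hup
    refine mul_le_mul_of_nonneg_left (le_trans ?_ h1) hd.le
    apply Real.exp_le_exp.2
    linarith
  have h3 : Real.exp (d / 8) ≤ 1 / dens X := by
    rw [le_div_iff₀ hd]
    have h4 : Real.exp (d / 4) = Real.exp (d / 8) * Real.exp (d / 8) := by
      rw [← Real.exp_add]; congr 1; ring
    rw [h4] at h2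
    have := Real.exp_pos ((d : ℝ) / 8)
    refine le_of_mul_le_mul_right ?_ this
    linarith
  have h4 := (Real.le_log_iff_exp_le (by positivity)).2 h3
  linarith

/-- The annihilator of the large spectrum of a set of density `α` has codimension at most
`8 log (1 / α)`. -/
lemma exists_annihilator [Fintype W] {X : Finset W} (hX : X.Nonempty) :
    ∃ V : Submodule (ZMod p) W, (∀ φ : Module.Dual (ZMod p) W,
      1 / 2 < ‖𝔼 x : X, ch φ (x : W)‖ → ∀ v ∈ V, φ v = 0) ∧
      (Module.finrank (ZMod p) W : ℝ) ≤
        Module.finrank (ZMod p) V + 8 * Real.log (1 / dens X) := by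
  set S : Set (Module.Dual (ZMod p) W) := {φ | 1 / 2 < ‖𝔼 x : X, ch φ (x : W)‖} with hS
  obtain ⟨b, hbS, hspan, hli⟩ := exists_linearIndependent (ZMod p) S
  have hfin : Finite (Module.Dual (ZMod p) W) := Module.finite_of_finite (ZMod p)
  let _ : Fintype b := Fintype.ofFinite _
  refine ⟨(Submodule.span (ZMod p) S).dualCoannihilator, fun φ hφ v hv => ?_, ?_⟩
  · exact (Submodule.mem_dualCoannihilator _).1 hv φ (Submodule.subset_span hφ)
  · have h1 := Subspace.finrank_add_finrank_dualCoannihilator_eq (Submodule.span (ZMod p) S)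
    have h2 := card_le_of_linearIndependent hX hli fun i => hbS i.2
    rw [← h1, ← hspan, finrank_span_set_eq_card hli]
    push_cast
    rw [Set.toFinset_card]
    linarith

end Fourier

/-! ### Replacing a dense set by a subspace -/

section Smoothing

lemma expect_update {W : Type*} [AddCommGroup W] [Fintype W] {m : ℕ} (k : Fin m)
    (Φ : (Fin m → W) → ℝ) : 𝔼 x, 𝔼 y, Φ (Function.update x k y) = 𝔼 x, Φ x := by
  have h1 : ∀ x, 𝔼 y, Φ (Function.update x k y) = 𝔼 t, Φ (x + Pi.single k t) := fun x => by
    refine (Fintype.expect_equiv (Equiv.addLeft (x k)) _ _ fun t => ?_).symm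
    congr 1
    funext j
    by_cases hj : j = k
    · subst hj; simp
    · simp [hj]
  simp only [h1]
  rw [Finset.expect_comm, ← Fintype.expect_const (ι := W) (𝔼 x, Φ x)]
  exact Finset.expect_congr rfl fun t _ =>
    Fintype.expect_equiv (Equiv.addRight (Pi.single k t)) _ _ fun x => rfl

/-- Replacing the weight `w₀` by `w₁` one coordinate at a time. -/
lemma abs_expect_prod_sub_le {W : Type*} [AddCommGroup W] [Fintype W] {m : ℕ} {w : Bool → W → ℝ}
    {L e : ℝ} (hw0 : ∀ a y, 0 ≤ w a y) (hwL : ∀ a y, w a y ≤ L) (hL : 1 ≤ L)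
    (hw1 : ∀ a, 𝔼 y, w a y = 1) (F : (Fin m → W) → ℝ)
    (h : ∀ k (ρ : (Fin m → W) → ℝ), (∀ ω, 0 ≤ ρ ω) → (∀ ω, ρ ω ≤ L ^ m) → 𝔼 ω, ρ ω = 1 →
      |(𝔼 ω, ρ ω * 𝔼 y, w false y * F (Function.update ω k y)) -
        𝔼 ω, ρ ω * 𝔼 y, w true y * F (Function.update ω k y)| ≤ e) :
    |(𝔼 x, (∏ i, w false (x i)) * F x) - 𝔼 x, (∏ i, w true (x i)) * F x| ≤ m * e := by
  have key : ∀ S : Finset (Fin m), |(𝔼 x, (∏ i, w false (x i)) * F x) -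
      𝔼 x, (∏ i, w (decide (i ∈ S)) (x i)) * F x| ≤ #S * e := by
    intro S
    induction S using Finset.induction_on with
    | empty => simp
    | insert k S hk ih =>
      set ρ : (Fin m → W) → ℝ := fun ω => ∏ i ∈ univ.erase k, w (decide (i ∈ S)) (ω i) with hρ
      have h0 : ∀ ω, 0 ≤ ρ ω := fun ω => Finset.prod_nonneg fun i _ => hw0 _ _
      have hsplit : ∀ a (c : Fin m → Bool), c k = a → (∀ i, i ≠ k → c i = decide (i ∈ S)) →
          𝔼 x, (∏ i, w (c i) (x i)) * F x =
          𝔼 ω, ρ ω * 𝔼 y, w a y * F (Function.update ω k y) := by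
        intro a c hca hcS
        rw [← expect_update k]
        refine Finset.expect_congr rfl fun ω _ => ?_
        rw [Finset.mul_expect]
        refine Finset.expect_congr rfl fun y _ => ?_
        rw [← Finset.mul_prod_erase _ _ (mem_univ k), Function.update_self, hca, hρ]
        have h3 : ∏ i ∈ univ.erase k, w (c i) (Function.update ω k y i) =
            ∏ i ∈ univ.erase k, w (decide (i ∈ S)) (ω i) := by
          refine Finset.prod_congr rfl fun i hi => ?_
          have hik := Finset.ne_of_mem_erase hi
          rw [hcS i hik, Function.update_of_ne hik]
        rw [h3]
        ring
      have h1 := h k ρ h0 (fun ω => ?_) ?_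
      · rw [← hsplit false (fun i => decide (i ∈ S)) (by simp [hk]) (fun i _ => rfl),
          ← hsplit true (fun i => decide (i ∈ insert k S)) (by simp)
            (fun i hi => by simp [hi])] at h1
        rw [Finset.card_insert_of_notMem hk]
        push_cast
        rw [add_mul, one_mul]
        exact (abs_sub_le _ _ _).trans (add_le_add ih h1)
      · calc ρ ω ≤ ∏ _i ∈ univ.erase k, L := Finset.prod_le_prod (fun i _ => hw0 _ _)
              fun i _ => hwL _ _
          _ ≤ L ^ m := by
            rw [Finset.prod_const]
            refine pow_le_pow_right₀ hL ((Finset.card_le_univ _).trans ?_)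
            rw [Fintype.card_fin]
      · rw [hρ, expect_pi_prod_mem (univ.erase k) fun i y => w (decide (i ∈ S)) y]
        simp [hw1]
  simpa using key univ

variable {p : ℕ} [Fact p.Prime] {W : Type*} [AddCommGroup W] [Module (ZMod p) W] [Fintype W]

lemma expect_mu_mul {Ω : Type*} [Fintype Ω] {B : Finset Ω} (hB : B.Nonempty) (g : Ω → ℝ) :
    𝔼 y, mu B y * g y = 𝔼 b : B, g b := by
  have hB0 : (#B : ℝ) ≠ 0 := by exact_mod_cast hB.card_pos.ne'
  have : Nonempty Ω := ⟨hB.choose⟩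
  have hN : (Fintype.card Ω : ℝ) ≠ 0 := by exact_mod_cast Fintype.card_ne_zero
  rw [Fintype.expect_eq_sum_div_card, Fintype.expect_eq_sum_div_card, Fintype.card_coe,
    Finset.sum_coe_sort B g]
  simp only [mu, ind, dens, div_mul_eq_mul_div, ite_mul, one_mul, zero_mul, ← Finset.sum_div]
  rw [Finset.sum_ite_mem, Finset.univ_inter]
  field_simp

/-- The normalised indicator function of `B`, averaged over `V`. -/
def muAvg (B : Finset W) (V : Submodule (ZMod p) W) (y : W) : ℝ := 𝔼 v : V, mu B (y - v)

lemma expect_muAvg_mul {B : Finset W} (hB : B.Nonempty) (V : Submodule (ZMod p) W) (g : W → ℝ) :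
    𝔼 y, muAvg B V y * g y = 𝔼 v : V, 𝔼 b : B, g (b + v) := by
  simp only [muAvg, Finset.expect_mul]
  rw [Finset.expect_comm]
  refine Finset.expect_congr rfl fun v _ => ?_
  rw [← expect_mu_mul hB fun y => g (y + v)]
  exact Fintype.expect_equiv (Equiv.subRight (v : W)) _ _ fun y => by simp

/-- For a diagonally invariant function `F` with values in `[0, 1]`, the average of `F` over
tuples from a dense set `B` is close to the average over tuples from `B + V`, for some subspace `V`
of small codimension. -/
lemma exists_subspace {m M R : ℕ} (t : ℕ) {F : (Fin m → W) → ℝ} (hF0 : ∀ x, 0 ≤ F x)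
    (hF1 : ∀ x, F x ≤ 1) (hF : ∀ x u, F (fun i => x i + u) = F x) {B : Finset W}
    (hB : B.Nonempty) (hBR : (1 : ℝ) ≤ 2 ^ R * dens B) {η : ℝ} (hη : 0 ≤ η) (hm : 0 < m)
    (hM : 0 < M) :
    ∃ V : Submodule (ZMod p) W, (Module.finrank (ZMod p) W : ℝ) ≤
        Module.finrank (ZMod p) V + 8 * Real.log (2 / dens B ^ M) ∧
      |(𝔼 x, (∏ i, mu B (x i)) * F x) - 𝔼 x, (∏ i, muAvg B V (x i)) * F x| ≤
        m * (t * (2 * (2 * η + 2 * (4 * m * Real.exp (-(η ^ 2 * M / 2))) * (2 ^ R) ^ m)) +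
          2 ^ R * (1 / 2) ^ t) := by
  have hne := hB.to_subtype
  have hd := dens_pos hB
  obtain ⟨X, hXd, hX⟩ := exists_almost_periods hF0 hF1 hF hB hη hm hM
  have hXpos : 0 < dens X := lt_of_lt_of_le (by positivity) hXd
  have hXne : X.Nonempty := by
    rw [Finset.nonempty_iff_ne_empty]
    rintro rfl
    simp [dens] at hXpos
  obtain ⟨V, hV, hVdim⟩ := exists_annihilator (p := p) hXne
  refine ⟨V, hVdim.trans ?_, ?_⟩
  · have h1 : 1 / dens X ≤ 2 / dens B ^ M := by
      rw [div_le_div_iff₀ hXpos (by positivity)]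
      linarith
    have := Real.log_le_log (by positivity) h1
    linarith
  have hmuL : ∀ y, mu B y ≤ 2 ^ R := fun y => by
    rw [mu, div_le_iff₀ hd]
    exact (ind_le_one _ _).trans hBR
  refine abs_expect_prod_sub_le (w := fun a => bif a then muAvg B V else mu B) (L := 2 ^ R)
    (fun a y => ?_) (fun a y => ?_) (one_le_pow₀ (by norm_num)) (fun a => ?_) F
    fun k ρ hρ0 hρL hρ1 => ?_
  · cases a
    · exact mu_nonneg _ _
    · exact Finset.expect_nonneg fun v _ => mu_nonneg _ _
  · cases a
    · exact hmuL y
    · exact Finset.expect_le univ_nonempty fun v _ => hmuL _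
  · cases a
    · exact expect_mu hB
    · have := expect_muAvg_mul hB V fun _ => 1
      simpa only [mul_one, Fintype.expect_const, cond_true] using this
  · set g : W → ℝ := fun y => 𝔼 ω, ρ ω * F (Function.update ω k y) with hg
    have hcomm : ∀ c : W → ℝ, 𝔼 ω, ρ ω * 𝔼 y, c y * F (Function.update ω k y) =
        𝔼 y, c y * g y := fun c => by
      simp only [hg, Finset.mul_expect]
      rw [Finset.expect_comm]
      simp only [mul_left_comm]
    have hcomm' : ∀ u, 𝔼 ω, ρ ω * 𝔼 b : B, F (Function.update ω k (b + u)) =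
        𝔼 b : B, g (b + u) := fun u => by
      simp only [hg, Finset.mul_expect]
      rw [Finset.expect_comm]
    simp only [cond_false, cond_true, hcomm]
    rw [expect_mu_mul hB, expect_muAvg_mul hB]
    refine abs_trAvg_sub_le hB hXne hBR hV (fun y => ?_) (fun y => ?_) (fun x hx u => ?_) t
    · exact Finset.expect_nonneg fun ω _ => mul_nonneg (hρ0 ω) (hF0 _)
    · rw [← hρ1]
      exact Finset.expect_le_expect fun ω _ => mul_le_of_le_one_right (hρ0 ω) (hF1 _)
    · rw [← hcomm', ← hcomm']
      exact hX x hx k _ ρ hρ0 hρL hρ1 u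

end Smoothing

/-! ### Density increment -/

section Increment

variable {p : ℕ} [Fact p.Prime] {W : Type*} [AddCommGroup W] [Module (ZMod p) W] [Fintype W]

/-- The part of `A - x` inside the subspace `V`. -/
def slice (A : Finset W) (V : Submodule (ZMod p) W) (x : W) : Finset V :=
  univ.filter fun v : V => (v : W) + x ∈ A

lemma expect_mu_add (A : Finset W) (V : Submodule (ZMod p) W) (x : W) :
    𝔼 v : V, mu A (v + x) = dens (slice A V x) / dens A := by
  rw [← expect_ind, Finset.expect_div]
  refine Finset.expect_congr rfl fun v _ => ?_
  simp [mu, ind, slice]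

lemma corr_add_diag {f : W → ℝ} {m : ℕ} (x : Fin m → W) (u : W) :
    corr f univ (fun i => x i + u) = corr f univ x := by
  refine Fintype.expect_equiv (Equiv.addRight u) _ _ fun z => ?_
  simp only [Equiv.coe_addRight, add_assoc, add_comm u]

lemma expect_prod_mul_corr {m : ℕ} (w f : W → ℝ) :
    𝔼 x : Fin m → W, (∏ i, w (x i)) * corr f univ x = 𝔼 z, (𝔼 y, w y * f (z + y)) ^ m := by
  simp only [corr, Finset.mul_expect, ← Finset.prod_mul_distrib]
  rw [Finset.expect_comm]
  refine Finset.expect_congr rfl fun z _ => ?_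
  rw [expect_pi_prod fun (_ : Fin m) y => w y * f (z + y)]
  simp

lemma smoothing_error_le {m Z R : ℕ} (hm : 2 ≤ m) (hZ : 1 ≤ Z) (hR : 1 ≤ R)
    (hR' : (64 * m * Z : ℝ) ≤ 2 ^ R) {η : ℝ} (hη : η = 1 / (512 * m * Z * R)) {M : ℕ}
    (hM : M = 2 * (512 * m * Z * R) ^ 2 * (8 * R * m)) :
    m * ((2 * R : ℕ) * (2 * (2 * η + 2 * (4 * m * Real.exp (-(η ^ 2 * M / 2))) *
      (2 ^ R) ^ m)) + 2 ^ R * (1 / 2) ^ (2 * R)) ≤ 1 / (16 * Z : ℝ) := by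
  have hZ0 : (0 : ℝ) < Z := by exact_mod_cast hZ
  have hZ1 : (1 : ℝ) ≤ Z := by exact_mod_cast hZ
  have hm0 : (0 : ℝ) < m := by exact_mod_cast (by omega : 0 < m)
  have hR0 : (0 : ℝ) < R := by exact_mod_cast hR
  have h1 : η ^ 2 * M / 2 = (8 * R * m : ℕ) := by
    rw [hη, hM]
    push_cast
    field_simp
  have h2 : (2 : ℝ) ^ 11 * m ^ 2 * Z * R * (2 ^ R) ^ m ≤ Real.exp (8 * R * m : ℕ) := by
    have h3 : (2 : ℝ) ^ (8 * R * m) ≤ Real.exp (8 * R * m : ℕ) := by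
      rw [← Real.exp_one_pow]
      exact pow_le_pow_left₀ (by norm_num) (by linarith [Real.add_one_le_exp 1]) _
    refine le_trans ?_ h3
    have h4 : (R : ℝ) ≤ 2 ^ R := by exact_mod_cast Nat.lt_two_pow_self.le
    have h5 : (2 : ℝ) ^ 11 * m ^ 2 * Z * R ≤ 2 ^ (7 * R * m) := by
      have h6 : (2 : ℝ) ^ (7 * R * 2) ≤ 2 ^ (7 * R * m) :=
        pow_le_pow_right₀ (by norm_num) (by gcongr)
      refine le_trans ?_ h6
      have h7 : (1 : ℝ) ≤ 2 ^ R := one_le_pow₀ (by norm_num)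
      have h8 : (64 : ℝ) * m ≤ 2 ^ R := by nlinarith
      have h9 : (2 : ℝ) ^ 11 * m ^ 2 * Z * R = (64 * m * Z) * (32 * m) * R := by ring
      rw [h9]
      calc (64 * m * Z) * (32 * m) * (R : ℝ) ≤ 2 ^ R * 2 ^ R * 2 ^ R := by
            gcongr
            linarith
        _ = (2 ^ R) ^ 3 := by ring
        _ ≤ (2 ^ R) ^ 14 := pow_le_pow_right₀ h7 (by norm_num)
        _ = _ := by rw [← pow_mul]; congr 1; ring
    calc _ ≤ (2 : ℝ) ^ (7 * R * m) * (2 ^ R) ^ m := by gcongr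
      _ = _ := by rw [← pow_mul, ← pow_add]; congr 1; ring
  rw [h1, Real.exp_neg]
  have h3 : (Real.exp (8 * R * m : ℕ))⁻¹ * (2 ^ R) ^ m ≤ 1 / (2 ^ 11 * m ^ 2 * Z * R) := by
    rw [inv_mul_le_iff₀ (Real.exp_pos _), mul_one_div, le_div_iff₀ (by positivity)]
    linarith
  have h4 : (2 : ℝ) ^ R * (1 / 2) ^ (2 * R) ≤ 1 / (64 * m * Z) := by
    have : (2 : ℝ) ^ R * (1 / 2) ^ (2 * R) = 1 / 2 ^ R := by
      rw [two_mul, pow_add, ← mul_assoc, ← mul_pow]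
      norm_num [one_div_pow]
    rw [this]
    exact one_div_le_one_div_of_le (by positivity) hR'
  calc _ = 8 * m * R * η + 32 * m ^ 2 * R * ((Real.exp (8 * R * m : ℕ))⁻¹ * (2 ^ R) ^ m) +
        m * (2 ^ R * (1 / 2) ^ (2 * R)) := by push_cast; ring
    _ ≤ 8 * m * R * (1 / (512 * m * Z * R)) + 32 * m ^ 2 * R * (1 / (2 ^ 11 * m ^ 2 * Z * R)) +
        m * (1 / (64 * m * Z)) := by gcongr; exact hη.le
    _ = 3 / (64 * Z) := by field_simp; norm_num
    _ ≤ _ := by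
        rw [div_le_div_iff₀ (by positivity) (by positivity)]
        nlinarith

lemma exists_slice_of_sifted {m Z s R : ℕ} {A B : Finset W} (hA : A.Nonempty)
    (hB : B.Nonempty) (hm : 2 ≤ m) (hZ : 1 ≤ Z) (hs : 64 * m * Z ≤ 2 ^ s) (hsR : s ≤ R)
    (hBR : (1 : ℝ) ≤ 2 ^ R * dens B)
    (h : 𝔼 x : Fin m → W, (∏ i, ind B (x i)) * (if 1 + 1 / (2 * (Z : ℝ)) ≤ corr (mu A) univ x
        then 0 else 1) ≤ 2 / 2 ^ s * dens B ^ m) :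
    ∃ (V : Submodule (ZMod p) W) (x : W),
      Module.finrank (ZMod p) W ≤ Module.finrank (ZMod p) V + 2 ^ 26 * m ^ 3 * Z ^ 2 * R ^ 4 ∧
      (1 + 1 / (8 * m * Z : ℝ)) * dens A ≤ dens (slice A V x) := by
  have hdA := dens_pos hA
  have hdB := dens_pos hB
  have hZ0 : (0 : ℝ) < Z := by exact_mod_cast hZ
  have hZ1 : (1 : ℝ) ≤ Z := by exact_mod_cast hZ
  have hm0 : (0 : ℝ) < m := by exact_mod_cast (by omega : 0 < m)
  have hm2 : (2 : ℝ) ≤ m := by exact_mod_cast hm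
  have hs' : (64 * m * Z : ℝ) ≤ 2 ^ s := by exact_mod_cast hs
  have hR' : (64 * m * Z : ℝ) ≤ 2 ^ R := hs'.trans (pow_le_pow_right₀ (by norm_num) hsR)
  have hR1 : 1 ≤ R := by
    by_contra! hR0
    have h0 : R = 0 := by omega
    subst h0
    have : (1 : ℝ) ≤ m * Z := by nlinarith
    norm_num at hR'
    linarith
  have hR0 : (0 : ℝ) < R := by exact_mod_cast hR1
  set F : (Fin m → W) → ℝ := fun x => if 1 + 1 / (2 * (Z : ℝ)) ≤ corr (mu A) univ x
        then 1 else 0 with hF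
  set η : ℝ := 1 / (512 * m * Z * R) with hη
  set M : ℕ := 2 * (512 * m * Z * R) ^ 2 * (8 * R * m) with hM
  obtain ⟨V, hVdim, hV⟩ := exists_subspace (p := p) (M := M) (2 * R) (F := F)
    (fun x => by simp only [hF]; split_ifs <;> norm_num)
    (fun x => by simp only [hF]; split_ifs <;> norm_num)
    (fun x u => by simp only [hF, corr_add_diag]) hB hBR (η := η) (by positivity) (by omega)
    (by positivity)
  refine ⟨V, ?_⟩
  have hdim : Module.finrank (ZMod p) W ≤
      Module.finrank (ZMod p) V + 2 ^ 26 * m ^ 3 * Z ^ 2 * R ^ 4 := by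
    have h1 : Real.log (2 / dens B ^ M) ≤ R * M + 1 := by
      have h2 : 2 / dens B ^ M ≤ 2 ^ (R * M + 1) := by
        rw [div_le_iff₀ (by positivity), pow_succ, pow_mul, mul_right_comm, ← mul_pow]
        have := one_le_pow₀ hBR (n := M)
        linarith
      calc Real.log (2 / dens B ^ M) ≤ Real.log (2 ^ (R * M + 1)) :=
            Real.log_le_log (by positivity) h2
        _ = (R * M + 1 : ℕ) * Real.log 2 := Real.log_pow _ _
        _ ≤ (R * M + 1 : ℕ) * 1 := by
            gcongr
            linarith [Real.log_two_lt_d9]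
        _ = _ := by push_cast; ring
    have h3 : (1 : ℝ) ≤ R * M := by
      have : 1 ≤ R * M := Nat.one_le_iff_ne_zero.2 (by positivity)
      exact_mod_cast this
    have h4 : (Module.finrank (ZMod p) W : ℝ) ≤ Module.finrank (ZMod p) V + 16 * (R * M) := by
      linarith
    have h5 : Module.finrank (ZMod p) W ≤ Module.finrank (ZMod p) V + 16 * (R * M) := by
      exact_mod_cast h4
    refine h5.trans (le_of_eq ?_)
    rw [hM]
    ring
  have hloss := smoothing_error_le hm hZ hR1 hR' hη hM
  have hmuB : 1 - 1 / (16 * Z : ℝ) ≤ 𝔼 x, (∏ i, mu B (x i)) * F x := by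
    have h1 : ∀ x : Fin m → W, (∏ i, mu B (x i)) * F x = ((∏ i, ind B (x i)) -
        (∏ i, ind B (x i)) * (if 1 + 1 / (2 * (Z : ℝ)) ≤ corr (mu A) univ x then 0 else 1)) /
        dens B ^ m := fun x => by
      simp only [mu, Finset.prod_div_distrib, Finset.prod_const, Finset.card_univ,
        Fintype.card_fin, hF]
      split_ifs <;> simp
    simp only [h1]
    rw [← Finset.expect_div, Finset.expect_sub_distrib, expect_prod_ind,
      le_div_iff₀ (by positivity)]
    have h2 : (2 : ℝ) / 2 ^ s ≤ 1 / (16 * Z) := by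
      rw [div_le_div_iff₀ (by positivity) (by positivity)]
      nlinarith
    have h3 := mul_le_mul_of_nonneg_right h2 (pow_nonneg hdB.le m)
    linarith
  have hF' : 1 - 1 / (8 * Z : ℝ) ≤ 𝔼 x, (∏ i, muAvg B V (x i)) * F x := by
    have h1 := (abs_le.1 (hV.trans hloss)).2
    have h2 : 1 / (8 * Z : ℝ) = 1 / (16 * Z) + 1 / (16 * Z) := by field_simp; norm_num
    linarith
  have hcorr : 1 + 1 / (4 * Z : ℝ) < 𝔼 x : Fin m → W,
      (∏ i, muAvg B V (x i)) * corr (mu A) univ x := by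
    have hw : ∀ x : Fin m → W, 0 ≤ ∏ i, muAvg B V (x i) := fun x =>
      Finset.prod_nonneg fun i _ => Finset.expect_nonneg fun v _ => mu_nonneg _ _
    have hc : ∀ x : Fin m → W, 0 ≤ corr (mu A) univ x := fun x =>
      Finset.expect_nonneg fun z _ => Finset.prod_nonneg fun i _ => mu_nonneg _ _
    calc 1 + 1 / (4 * Z : ℝ) < (1 + 1 / (2 * Z)) * (1 - 1 / (8 * Z)) := by
          have h1 : 1 / (4 * Z : ℝ) = 1 / Z / 4 := by field_simp
          have h2 : 1 / (2 * Z : ℝ) = 1 / Z / 2 := by field_simp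
          have h3 : 1 / (8 * Z : ℝ) = 1 / Z / 8 := by field_simp
          have h4 : 0 < 1 / (Z : ℝ) := by positivity
          have h5 : 1 / (Z : ℝ) ≤ 1 := by rw [div_le_one hZ0]; exact hZ1
          rw [h1, h2, h3]
          nlinarith
      _ ≤ (1 + 1 / (2 * Z)) * (𝔼 x, (∏ i, muAvg B V (x i)) * F x) := by gcongr
      _ ≤ _ := by
          rw [Finset.mul_expect]
          refine Finset.expect_le_expect fun x _ => ?_
          rw [mul_left_comm]
          refine mul_le_mul_of_nonneg_left ?_ (hw x)
          simp only [hF]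
          split_ifs with hx
          · rwa [mul_one]
          · rw [mul_zero]; exact hc x
  by_contra! hcon
  have hcon' := fun x => hcon x hdim
  set σ : ℝ := 1 + 1 / (8 * m * Z) with hσ
  have hslice : ∀ x, 𝔼 v : V, mu A (v + x) ≤ σ := fun x => by
    rw [expect_mu_add, div_le_iff₀ hdA]
    exact (hcon' x).le
  rw [expect_prod_mul_corr] at hcorr
  have hup : 𝔼 z, (𝔼 y, muAvg B V y * mu A (z + y)) ^ m ≤ σ ^ m := by
    refine Finset.expect_le univ_nonempty fun z _ => pow_le_pow_left₀ ?_ ?_ m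
    · exact Finset.expect_nonneg fun y _ => mul_nonneg
        (Finset.expect_nonneg fun v _ => mu_nonneg _ _) (mu_nonneg _ _)
    · have := hB.to_subtype
      rw [expect_muAvg_mul hB, Finset.expect_comm]
      refine Finset.expect_le univ_nonempty fun b _ => ?_
      refine le_trans (le_of_eq ?_) (hslice (z + b))
      refine Finset.expect_congr rfl fun v _ => ?_
      congr 1
      abel
  have hσm : σ ^ m ≤ 1 + 1 / (4 * Z) := by
    calc σ ^ m ≤ Real.exp (1 / (8 * m * Z)) ^ m := by
          gcongr
          rw [hσ, add_comm]
          exact Real.add_one_le_exp _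
      _ = Real.exp (1 / (8 * Z)) := by
          rw [← Real.exp_nat_mul]; congr 1; field_simp
      _ ≤ 1 + 2 * (1 / (8 * Z)) := by
          have h1 : |1 / (8 * Z : ℝ)| ≤ 1 := by
            rw [abs_of_pos (by positivity), div_le_one (by positivity)]; linarith
          have h2 := (abs_le.1 (Real.abs_exp_sub_one_le h1)).2
          rw [abs_of_pos (by positivity)] at h2
          linarith
      _ = _ := by
          rw [mul_one_div, add_right_inj, div_eq_div_iff (by positivity) (by positivity)]
          ring
  linarith

lemma exists_slice_of_not_unif {ε : ℝ} {k l Y Z s Λ : ℕ} {A : Finset W} (hA : A.Nonempty)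
    (hε : 0 < ε) (hk : 1 ≤ k) (hl : 1 ≤ l) (hY : 1 ≤ Y) (hYε : 1 / (Y : ℝ) ≤ ε ^ (2 * l))
    (hZ : Z = 2 * (2 ^ (2 * l + 4) * Y) ^ (2 * l - 1)) (hs : s = 4 * k * (2 * l + 4) ^ 2 * Y)
    (hΛ : 1 ≤ Λ) (hAΛ : (1 : ℝ) ≤ 2 ^ Λ * dens A) (h : ¬ unif W ε k l A) :
    ∃ (V : Submodule (ZMod p) W) (x : W),
      Module.finrank (ZMod p) W ≤ Module.finrank (ZMod p) V +
        2 ^ 26 * (2 * l) ^ 3 * Z ^ 2 * (3 * Z * s * Λ + 1) ^ 4 ∧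
      (1 + 1 / (16 * l * Z : ℝ)) * dens A ≤ dens (slice A V x) := by
  have hZ1 : 1 ≤ Z := by
    rw [hZ]
    exact Nat.one_le_iff_ne_zero.2 (by positivity)
  have hs1 : 1 ≤ s := by
    rw [hs]
    exact Nat.one_le_iff_ne_zero.2 (by positivity)
  set q := 2 * k * (2 * l + 4) ^ 2 * Y with hq
  have hsq : s = 2 * q := by rw [hs, hq]; ring
  have hq1 : 1 ≤ q := by omega
  have hqr : q * (6 * Z) = 3 * Z * s := by rw [hsq]; ring
  have hZs : 64 * (2 * l) * Z ≤ 2 ^ s := by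
    have h1 : 2 * l < 2 ^ (2 * l) := Nat.lt_two_pow_self
    have h2 : Y ^ (2 * l - 1) ≤ 2 ^ (Y * (2 * l - 1)) := by
      rw [pow_mul]
      exact Nat.pow_le_pow_left Nat.lt_two_pow_self.le _
    calc 64 * (2 * l) * Z
        ≤ 2 ^ 6 * 2 ^ (2 * l) *
            (2 * (2 ^ ((2 * l + 4) * (2 * l - 1)) * 2 ^ (Y * (2 * l - 1)))) := by
          rw [hZ, mul_pow, ← pow_mul]
          gcongr
          norm_num
      _ = 2 ^ (6 + 2 * l + 1 + (2 * l + 4) * (2 * l - 1) + Y * (2 * l - 1)) := by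
          simp only [pow_add]; ring
      _ ≤ 2 ^ s := by
          refine Nat.pow_le_pow_right (by norm_num) ?_
          obtain ⟨j, rfl⟩ := Nat.exists_eq_add_of_le' hl
          obtain ⟨y, rfl⟩ := Nat.exists_eq_add_of_le' hY
          obtain ⟨i, rfl⟩ := Nat.exists_eq_add_of_le' hk
          have : 2 * (j + 1) - 1 = 2 * j + 1 := by omega
          rw [this, hs]
          ring_nf
          nlinarith [Nat.zero_le (i * y), Nat.zero_le (i * j), Nat.zero_le (i * j * y),
            Nat.zero_le (i * j ^ 2), Nat.zero_le (i * j ^ 2 * y), Nat.zero_le (j ^ 2 * y)]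
  obtain ⟨m, hm, hlarge⟩ := exists_large_moment (g := fun x => mu A x - 1)
    (by rw [Finset.expect_sub_distrib, expect_mu hA]; simp)
    (fun z => by linarith [mu_nonneg A z]) (m := 2 * l) (K := 2 * k) (q := q) (r := 6 * Z)
    (even_two_mul l) (by omega) (even_two_mul k) (by omega) hY
    ((pow_le_pow_left₀ (by positivity) hYε _).trans (le_moment_of_not_unif hA hε h))
    ⟨k * (2 * l + 4) ^ 2 * Y, by rw [hq]; ring⟩
    (by
      rw [hq]
      refine Nat.mul_le_mul_right _ ?_
      nlinarith [Nat.zero_le (k * l ^ 2), Nat.zero_le (k * l)])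
    (by
      have : q * (6 * Z) = (12 * q) * (2 ^ (2 * l + 4) * Y) ^ (2 * l - 1) := by rw [hZ]; ring
      rw [this]
      exact Nat.mul_le_mul_right _ (by omega))
  have hm2 : 2 ≤ m := by omega
  have hml : m ≤ 2 * l := by omega
  obtain ⟨B, hAB, hB⟩ := exists_sifted_set (m := m) (s := s) (Z := Z) hA hm2 hZ1 hs1 (by
    rw [← hqr]
    simp only [add_sub_cancel] at hlarge
    convert hlarge using 4
    rw [hZ]
    push_cast
    rfl)
  have hdA := dens_pos hA
  have hdB : 0 < dens B := lt_of_lt_of_le (by positivity) hAB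
  have hBne : B.Nonempty := by
    rw [Finset.nonempty_iff_ne_empty]
    rintro rfl
    simp [dens] at hdB
  obtain ⟨V, x, hV, hx⟩ := exists_slice_of_sifted (p := p) (R := 3 * Z * s * Λ + 1) hA hBne hm2 hZ1
    ((by gcongr : 64 * m * Z ≤ 64 * (2 * l) * Z).trans hZs)
    (by nlinarith [Nat.mul_le_mul hZ1 hΛ])
    (by
      have h1 := one_le_pow₀ hAΛ (n := 3 * Z * s)
      rw [mul_pow, ← pow_mul, mul_comm Λ] at h1
      rw [pow_succ]
      have h2 := mul_le_mul_of_nonneg_left hAB (by positivity : (0 : ℝ) ≤ 2 ^ (3 * Z * s * Λ) * 2)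
      linarith) hB
  refine ⟨V, x, hV.trans (add_le_add_right (by gcongr) _), le_trans ?_ hx⟩
  have hm0 : (0 : ℝ) < m := by exact_mod_cast (by omega : 0 < m)
  have hZ0 : (0 : ℝ) < Z := by exact_mod_cast hZ1
  have hml' : (m : ℝ) ≤ 2 * l := by exact_mod_cast hml
  gcongr (1 + 1 / ?_) * _
  nlinarith

lemma dens_le_one (A : Finset W) : dens A ≤ 1 :=
  div_le_one_of_le₀ (by exact_mod_cast Finset.card_le_univ A) (by positivity)

lemma dens_slice_top (A : Finset W) : dens (slice A (⊤ : Submodule (ZMod p) W) 0) = dens A := by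
  rw [← expect_ind, ← expect_ind]
  refine Fintype.expect_equiv (Submodule.topEquiv (R := ZMod p)).toEquiv _ _ fun v => ?_
  simp [ind, slice]

lemma dens_slice_slice (A : Finset W) (V : Submodule (ZMod p) W) (V' : Submodule (ZMod p) V)
    (x : W) (x' : V) :
    dens (slice (slice A V x) V' x') = dens (slice A (V'.map V.subtype) (x' + x)) := by
  rw [← expect_ind, ← expect_ind]
  refine Fintype.expect_equiv (V.equivSubtypeMap V').toEquiv _ _ fun v => ?_
  simp [ind, slice, add_assoc]

lemma exists_unif_slice {ε c : ℝ} {k l D J : ℕ} {A : Finset W} (hc : 0 < c)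
    (hstep : ∀ (V : Submodule (ZMod p) W) (x : W), dens A ≤ dens (slice A V x) →
      ¬ unif V ε k l (slice A V x) → ∃ (V' : Submodule (ZMod p) V) (x' : V),
        Module.finrank (ZMod p) V ≤ Module.finrank (ZMod p) V' + D ∧
        (1 + c) * dens (slice A V x) ≤ dens (slice (slice A V x) V' x'))
    (hJ : 1 < (1 + c) ^ J * dens A) :
    ∃ (V : Submodule (ZMod p) W) (x : W), unif V ε k l (slice A V x) ∧
      dens A ≤ dens (slice A V x) ∧
      Module.finrank (ZMod p) W ≤ Module.finrank (ZMod p) V + J * D := by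
  by_contra! hcon
  have hdens : 0 ≤ dens A := by unfold dens; positivity
  have key : ∀ j ≤ J, ∃ (V : Submodule (ZMod p) W) (x : W),
      (1 + c) ^ j * dens A ≤ dens (slice A V x) ∧
      Module.finrank (ZMod p) W ≤ Module.finrank (ZMod p) V + j * D := by
    intro j
    induction j with
    | zero => exact fun _ => ⟨⊤, 0, by rw [dens_slice_top]; simp, by simp⟩
    | succ j ih =>
      intro hj
      obtain ⟨V, x, hVx, hV⟩ := ih (by omega)
      have hle : dens A ≤ dens (slice A V x) :=
        (le_mul_of_one_le_left hdens (one_le_pow₀ (by linarith))).trans hVx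
      have hnot : ¬ unif V ε k l (slice A V x) := fun hu => by
        have h1 := hcon V x hu hle
        have h2 : j * D ≤ J * D := Nat.mul_le_mul_right _ (by omega)
        omega
      obtain ⟨V', x', hV', hx'⟩ := hstep V x hle hnot
      refine ⟨V'.map V.subtype, x' + x, ?_, ?_⟩
      · rw [← dens_slice_slice, pow_succ', mul_assoc]
        exact (mul_le_mul_of_nonneg_left hVx (by linarith)).trans hx'
      · rw [← (V.equivSubtypeMap V').finrank_eq, add_mul]
        omega
  obtain ⟨V, x, hVx, -⟩ := key J le_rfl
  linarith [dens_le_one (slice A V x)]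

end Increment

/-! ### Final bounds -/

section Bounds

lemma iterated_codim_le {k l Y Z s Λ : ℕ} (hk : 1 ≤ k) (hl : 2 ≤ l) (hY : 1 ≤ Y) (hΛ : 1 ≤ Λ)
    (hZ : Z = 2 * (2 ^ (2 * l + 4) * Y) ^ (2 * l - 1)) (hs : s = 4 * k * (2 * l + 4) ^ 2 * Y) :
    16 * l * Z * Λ * (2 ^ 26 * (2 * l) ^ 3 * Z ^ 2 * (3 * Z * s * Λ + 1) ^ 4) ≤
      2 ^ 44 * 2 ^ (28 * l ^ 2 + 42 * l) * l ^ 12 * k ^ 4 * Y ^ (14 * l) * Λ ^ 5 := by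
  have hs1 : s ≤ 64 * k * l ^ 2 * Y := by
    calc s ≤ 4 * k * (4 * l) ^ 2 * Y := by rw [hs]; gcongr; omega
      _ = _ := by ring
  have hone : 1 ≤ Z * s * Λ := by
    rw [hZ, hs]
    exact Nat.one_le_iff_ne_zero.2 (by positivity)
  have hZY : 2 ^ 21 * Z ^ 7 * Y ^ 4 ≤ 2 ^ (28 * l ^ 2 + 42 * l) * Y ^ (14 * l) := by
    obtain ⟨j, rfl⟩ := Nat.exists_eq_add_of_le' (by omega : 1 ≤ l)
    have hj : 2 * (j + 1) - 1 = 2 * j + 1 := by omega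
    calc 2 ^ 21 * Z ^ 7 * Y ^ 4
        = 2 ^ (28 * (j + 1) ^ 2 + 42 * (j + 1)) * Y ^ (14 * j + 11) := by
          rw [hZ, hj, mul_pow, mul_pow, mul_pow, ← pow_mul, ← pow_mul, ← pow_mul]
          ring
      _ ≤ _ := by gcongr; omega
  calc 16 * l * Z * Λ * (2 ^ 26 * (2 * l) ^ 3 * Z ^ 2 * (3 * Z * s * Λ + 1) ^ 4)
      ≤ 16 * l * Z * Λ * (2 ^ 26 * (2 * l) ^ 3 * Z ^ 2 * (4 * (Z * s * Λ)) ^ 4) := by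
        gcongr
        linarith
    _ = 2 ^ 41 * l ^ 4 * Z ^ 7 * s ^ 4 * Λ ^ 5 := by ring
    _ ≤ 2 ^ 41 * l ^ 4 * Z ^ 7 * (64 * k * l ^ 2 * Y) ^ 4 * Λ ^ 5 := by gcongr
    _ = 2 ^ 44 * (2 ^ 21 * Z ^ 7 * Y ^ 4) * l ^ 12 * k ^ 4 * Λ ^ 5 := by ring
    _ ≤ 2 ^ 44 * (2 ^ (28 * l ^ 2 + 42 * l) * Y ^ (14 * l)) * l ^ 12 * k ^ 4 * Λ ^ 5 := by gcongr
    _ = _ := by ring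

lemma one_le_Lg {t : ℝ} (ht : 0 < t) (ht1 : t ≤ 1) : 1 ≤ Lg t := by
  rw [Lg, Real.le_logb_iff_rpow_le (by norm_num) (by positivity), Real.rpow_one,
    le_div_iff₀ ht]
  linarith

lemma codim_bound_le {k l Y Λ : ℕ} {ε δ : ℝ} (hl : 2 ≤ l) (hε : 0 < ε) (hε1 : ε ≤ 1)
    (hδ : 0 < δ) (hδ1 : δ ≤ 1) (hY : (Y : ℝ) ≤ 2 * (ε ^ (2 * l))⁻¹) (hΛ : (Λ : ℝ) ≤ 2 * Lg δ) :
    2 ^ 44 * 2 ^ (28 * l ^ 2 + 42 * l) * (l : ℝ) ^ 12 * k ^ 4 * Y ^ (14 * l) * Λ ^ 5 ≤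
      2 ^ 49 * ε ^ (-(28 * (l : ℤ) ^ l)) * (8 * (l : ℝ)) ^ (28 * l ^ l) * (k : ℝ) ^ 4 *
        Lg ε ^ (4 * l) * Lg δ ^ (5 * l) := by
  have hLε := one_le_Lg hε hε1
  have hLδ := one_le_Lg hδ hδ1
  have hl1 : (1 : ℝ) ≤ l := by exact_mod_cast (by omega : 1 ≤ l)
  have hll : l ^ 2 ≤ l ^ l := Nat.pow_le_pow_right (by omega) hl
  have h1 : ((ε ^ (2 * l))⁻¹) ^ (14 * l) ≤ ε ^ (-(28 * (l : ℤ) ^ l)) := by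
    have h2 : ε ^ (-(28 * (l : ℤ) ^ l)) = (ε ^ (28 * l ^ l))⁻¹ := by
      rw [zpow_neg]
      congr 1
    rw [h2, inv_pow, ← pow_mul]
    refine inv_anti₀ (by positivity) (pow_le_pow_of_le_one hε.le hε1 ?_)
    nlinarith
  have h2 : (2 : ℝ) ^ (28 * l ^ 2 + 56 * l) * l ^ 12 ≤ (8 * (l : ℝ)) ^ (28 * l ^ l) := by
    calc (2 : ℝ) ^ (28 * l ^ 2 + 56 * l) * l ^ 12 ≤ 2 ^ (3 * (28 * l ^ l)) * l ^ (28 * l ^ l) := by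
          gcongr
          · norm_num
          · nlinarith
          · nlinarith
      _ = _ := by rw [mul_pow, pow_mul]; norm_num
  have h3 : 1 ≤ Lg ε ^ (4 * l) := one_le_pow₀ hLε
  have h4 : Lg δ ^ 5 ≤ Lg δ ^ (5 * l) := pow_le_pow_right₀ hLδ (by omega)
  calc 2 ^ 44 * 2 ^ (28 * l ^ 2 + 42 * l) * (l : ℝ) ^ 12 * k ^ 4 * Y ^ (14 * l) * Λ ^ 5
      ≤ 2 ^ 44 * 2 ^ (28 * l ^ 2 + 42 * l) * (l : ℝ) ^ 12 * k ^ 4 *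
          (2 * (ε ^ (2 * l))⁻¹) ^ (14 * l) * (2 * Lg δ) ^ 5 := by gcongr
    _ = 2 ^ 49 * ((ε ^ (2 * l))⁻¹) ^ (14 * l) * (2 ^ (28 * l ^ 2 + 56 * l) * l ^ 12) * k ^ 4 *
          1 * Lg δ ^ 5 := by
        rw [show 28 * l ^ 2 + 56 * l = 28 * l ^ 2 + 42 * l + 14 * l by ring, mul_pow, mul_pow,
          pow_add 2 _ (14 * l)]
        ring
    _ ≤ _ := by gcongr

end Bounds

lemma exists_unif_slice_codim_le {p : ℕ} [Fact p.Prime] {W : Type*} [AddCommGroup W]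
    [Module (ZMod p) W] [Fintype W] {A : Finset W} {ε : ℝ} {k l : ℕ} (hA : 0 < dens A)
    (hε : 0 < ε) (hε1 : ε ≤ 1) (hk : 1 ≤ k) (hl : 2 ≤ l) :
    ∃ (V : Submodule (ZMod p) W) (x : W), unif V ε k l (slice A V x) ∧
      dens A ≤ dens (slice A V x) ∧
      ((Module.finrank (ZMod p) W - Module.finrank (ZMod p) V : ℕ) : ℝ) ≤
        2 ^ 49 * ε ^ (-(28 * (l : ℤ) ^ l)) * (8 * (l : ℝ)) ^ (28 * l ^ l) * (k : ℝ) ^ 4 *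
          Lg ε ^ (4 * l) * Lg (dens A) ^ (5 * l) := by
  have hA1 := dens_le_one A
  have hε2 : 1 ≤ (ε ^ (2 * l))⁻¹ := (one_le_inv₀ (by positivity)).2 (pow_le_one₀ hε.le hε1)
  have hLA := one_le_Lg hA hA1
  set Y : ℕ := ⌈(ε ^ (2 * l))⁻¹⌉₊ with hYdef
  set Λ : ℕ := ⌈Lg (dens A)⌉₊ with hΛdef
  have hY : 1 ≤ Y := Nat.one_le_ceil_iff.2 (by linarith)
  have hΛ : 1 ≤ Λ := Nat.one_le_ceil_iff.2 (by linarith)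
  have hY2 : (Y : ℝ) ≤ 2 * (ε ^ (2 * l))⁻¹ := by
    linarith [Nat.ceil_lt_add_one (by linarith : 0 ≤ (ε ^ (2 * l))⁻¹)]
  have hΛ2 : (Λ : ℝ) ≤ 2 * Lg (dens A) := by
    linarith [Nat.ceil_lt_add_one (by linarith : 0 ≤ Lg (dens A))]
  have hYε : 1 / (Y : ℝ) ≤ ε ^ (2 * l) := by
    rw [one_div]
    exact inv_le_of_inv_le₀ (by positivity) (Nat.le_ceil _)
  have hΛA : 2 ≤ 2 ^ Λ * dens A := by
    rw [← div_le_iff₀ hA, ← Real.rpow_natCast,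
      ← Real.logb_le_iff_le_rpow (by norm_num) (by positivity)]
    exact Nat.le_ceil _
  set Z : ℕ := 2 * (2 ^ (2 * l + 4) * Y) ^ (2 * l - 1) with hZ
  set s : ℕ := 4 * k * (2 * l + 4) ^ 2 * Y with hs
  have hlZ : (0 : ℝ) < 16 * l * Z := by
    have : 0 < 16 * l * Z := by rw [hZ]; positivity
    exact_mod_cast this
  have hgain : 2 ≤ (1 + 1 / (16 * l * Z : ℝ)) ^ (16 * l * Z) := by
    have h1 := one_add_mul_le_pow (a := 1 / (16 * l * Z : ℝ))
      (by linarith [one_div_pos.2 hlZ]) (16 * l * Z)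
    push_cast at h1
    rw [mul_one_div_cancel hlZ.ne'] at h1
    linarith
  obtain ⟨V, x, hunif, hVx, hV⟩ := exists_unif_slice (p := p) (A := A) (ε := ε) (k := k) (l := l)
    (c := 1 / (16 * l * Z : ℝ)) (J := 16 * l * Z * Λ) (by positivity)
    (fun V x hle hnot => exists_slice_of_not_unif (Λ := Λ) (p := p) (W := V)
      (by
        rw [Finset.nonempty_iff_ne_empty]
        intro h0
        rw [h0] at hle
        simp only [dens, Finset.card_empty, Nat.cast_zero, zero_div] at hle hA
        linarith)
      hε hk (by omega) hY hYε hZ hs hΛ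
      (by nlinarith [pow_pos (two_pos (α := ℝ)) Λ]) hnot)
    (by
      rw [pow_mul]
      have := mul_le_mul_of_nonneg_right (pow_le_pow_left₀ (by norm_num) hgain Λ) hA.le
      linarith)
  refine ⟨V, x, hunif, hVx, ?_⟩
  refine le_trans ?_ (codim_bound_le (k := k) hl hε hε1 hA hA1 hY2 hΛ2)
  exact_mod_cast (Nat.sub_le_iff_le_add'.2 hV).trans (iterated_codim_le hk hl hY hΛ hZ hs)

end HigherEnergy

theorem statement1 :
    ∃ C : ℝ, 0 < C ∧
      ∀ (p : ℕ) [Fact p.Prime] (n : ℕ), 1 ≤ n →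
        ∀ (A : Finset (Fin n → ZMod p)) (δ ε : ℝ) (k l : ℕ),
          0 < δ →
          (A.card : ℝ) = δ * (Fintype.card (Fin n → ZMod p) : ℝ) →
          0 < ε → ε ≤ 1 → 2 ≤ k → 2 ≤ l →
          ∃ (V : Submodule (ZMod p) (Fin n → ZMod p)) (x : Fin n → ZMod p),
            unif V ε k l
              (Finset.univ.filter fun v : V => (v : Fin n → ZMod p) + x ∈ A) ∧
            δ ≤ ((Finset.univ.filter fun v : V =>
                    (v : Fin n → ZMod p) + x ∈ A).card : ℝ) / (Fintype.card V : ℝ) ∧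
            ((n - Module.finrank (ZMod p) V : ℕ) : ℝ) ≤
              C * ε ^ (-(28 * (l : ℤ) ^ l)) * (8 * (l : ℝ)) ^ (28 * l ^ l) * (k : ℝ) ^ 4 *
                Lg ε ^ (4 * l) * Lg δ ^ (5 * l) := by
  refine ⟨2 ^ 49, by positivity, ?_⟩
  intro p _ n _ A δ ε k l hδ hA hε hε1 hk hl
  have hdens : HigherEnergy.dens A = δ := by
    rw [HigherEnergy.dens, hA]
    field_simp
  obtain ⟨V, x, hunif, hVx, hV⟩ := HigherEnergy.exists_unif_slice_codim_le (p := p) (A := A)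
    (hdens ▸ hδ) hε hε1 (by omega : 1 ≤ k) hl
  rw [hdens] at hVx hV
  have hslice : (Finset.univ.filter fun v : V => (v : Fin n → ZMod p) + x ∈ A) =
      HigherEnergy.slice A V x := by
    ext v
    simp [HigherEnergy.slice]
  rw [Module.finrank_fin_fun] at hV
  rw [← hslice] at hunif hVx
  rw [HigherEnergy.dens] at hVx
  exact ⟨V, x, by convert hunif, by convert hVx, hV⟩
end
end

section
/- Let l, k ≥ 2 be even integers, A_1,…,A_l ⊆ G be sets, and g : G → ℝ be any function. Then Σ_{x∈G} ∏_{j=1}^l (f_{A_j} ∘ g)(x) ≤ ‖g‖_1^{l(1−1/k)} · ‖C_l(g)‖_∞^{1/k} · ∏_{j=1}^l ‖f_{A_j}‖_{Ē^k_l}, where ‖g‖_1 = Σ_{x∈G} |g(x)| and ‖C_l(g)‖_∞ = max_{x∈G^l} |C_l(g)(x)|. -/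
open scoped BigOperators

attribute [local instance] Classical.propDecidable

noncomputable section

/-- Hölder's inequality for a product of several nonnegative functions with equal exponents. -/
theorem sum_prod_le_prod_sum_pow_rpow {κ : Type*} [Fintype κ] {n : ℕ} (hn : n ≠ 0)
    (a : Fin n → κ → ℝ) (ha : ∀ j z, 0 ≤ a j z) :
    ∑ z, ∏ j, a j z ≤ ∏ j, (∑ z, a j z ^ n) ^ ((n : ℝ)⁻¹) := by
  have hS : ∀ j, 0 ≤ ∑ z, a j z ^ n :=
    fun j => Finset.sum_nonneg fun z _ => pow_nonneg (ha j z) n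
  have hn' : (n : ℝ) ≠ 0 := Nat.cast_ne_zero.mpr hn
  by_cases h0 : ∃ j, ∑ z, a j z ^ n = 0
  · obtain ⟨j, hj⟩ := h0
    have hz : ∀ z, a j z = 0 := fun z => eq_zero_of_pow_eq_zero
      ((Finset.sum_eq_zero_iff_of_nonneg fun z _ => pow_nonneg (ha j z) n).mp hj z
        (Finset.mem_univ z))
    have hL : ∑ z, ∏ j, a j z = 0 :=
      Finset.sum_eq_zero fun z _ => Finset.prod_eq_zero (Finset.mem_univ j) (hz z)
    rw [hL]
    exact Finset.prod_nonneg fun j _ => Real.rpow_nonneg (hS j) _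
  push Not at h0
  have hpos : ∀ j, 0 < ∑ z, a j z ^ n := fun j => lt_of_le_of_ne (hS j) (h0 j).symm
  have hP : 0 < ∏ j, (∑ z, a j z ^ n) ^ ((n : ℝ)⁻¹) :=
    Finset.prod_pos fun j _ => Real.rpow_pos_of_pos (hpos j) _
  rw [← div_le_one hP, Finset.sum_div]
  calc ∑ z, (∏ j, a j z) / ∏ j, (∑ z, a j z ^ n) ^ ((n : ℝ)⁻¹)
      = ∑ z, ∏ j, (a j z ^ n / ∑ z, a j z ^ n) ^ ((n : ℝ)⁻¹) := by
        refine Finset.sum_congr rfl fun z _ => ?_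
        rw [← Finset.prod_div_distrib]
        refine Finset.prod_congr rfl fun j _ => ?_
        rw [Real.div_rpow (pow_nonneg (ha j z) n) (hS j), Real.pow_rpow_inv_natCast (ha j z) hn]
    _ ≤ ∑ z, ∑ j, (n : ℝ)⁻¹ * (a j z ^ n / ∑ z, a j z ^ n) := by
        refine Finset.sum_le_sum fun z _ => ?_
        refine Real.geom_mean_le_arith_mean_weighted _ _ _ (fun j _ => by positivity) ?_
          (fun j _ => div_nonneg (pow_nonneg (ha j z) n) (hS j))
        simp [hn']
    _ = 1 := by
        rw [Finset.sum_comm]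
        simp_rw [← Finset.mul_sum, ← Finset.sum_div, div_self (h0 _)]
        simp [hn']

section MixedConvolution

variable {G : Type*} [AddCommGroup G] [Fintype G]

/-- The convolution `Σ_z f_1(z+x_1)⋯f_l(z+x_l)` of possibly different functions. -/
def mixedConv {l : ℕ} (f : Fin l → G → ℝ) (x : Fin l → G) : ℝ :=
  ∑ z : G, ∏ i : Fin l, f i (z + x i)

theorem sum_mixedConv_pow (k : ℕ) {l : ℕ} (f : Fin l → G → ℝ) :
    ∑ x, mixedConv f x ^ k = ∑ z : Fin k → G, ∏ j, conv G k (f j) z := by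
  simp only [mixedConv, conv, Fintype.sum_pow, Fintype.prod_sum]
  rw [Finset.sum_comm]
  refine Finset.sum_congr rfl fun z _ => Finset.sum_congr rfl fun x _ => ?_
  rw [Finset.prod_comm]
  simp only [add_comm]

theorem energy_comm (k l : ℕ) (f : G → ℝ) : energy G k l f = energy G l k f := by
  simpa [energy, mixedConv, conv] using sum_mixedConv_pow k fun _ : Fin l => f

theorem energy_nonneg {k : ℕ} (hk : Even k) (l : ℕ) (f : G → ℝ) : 0 ≤ energy G k l f :=
  Finset.sum_nonneg fun _ _ => hk.pow_nonneg _

theorem sum_mixedConv_pow_le (k : ℕ) {l : ℕ} (hl : l ≠ 0) (hle : Even l)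
    (f : Fin l → G → ℝ) :
    ∑ x, mixedConv f x ^ k ≤ ∏ j, energy G k l (f j) ^ ((l : ℝ)⁻¹) := by
  rw [sum_mixedConv_pow]
  calc ∑ z : Fin k → G, ∏ j, conv G k (f j) z
      ≤ ∑ z : Fin k → G, ∏ j, |conv G k (f j) z| :=
        Finset.sum_le_sum fun z _ => (le_abs_self _).trans_eq (Finset.abs_prod _ _)
    _ ≤ ∏ j, (∑ z : Fin k → G, |conv G k (f j) z| ^ l) ^ ((l : ℝ)⁻¹) :=
        sum_prod_le_prod_sum_pow_rpow hl _ fun _ _ => abs_nonneg _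
    _ = ∏ j, energy G k l (f j) ^ ((l : ℝ)⁻¹) := by
        simp only [hle.pow_abs, energy_comm k l]
        rfl

theorem conv_add_const {l : ℕ} (g : G → ℝ) (w : G) (x : Fin l → G) :
    conv G l g (fun i => w + x i) = conv G l g x := by
  unfold conv
  simp only [← add_assoc]
  exact Equiv.sum_comp (Equiv.addRight w) fun z => ∏ i, g (z + x i)

theorem sum_prod_circ {l : ℕ} (f : Fin l → G → ℝ) (g : G → ℝ) :
    ∑ x, ∏ j, circ (f j) g x = ∑ y : Fin l → G, (∏ j, f j (y j)) * conv G l g y := by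
  simp only [circ, conv, Fintype.prod_sum, Finset.mul_sum]
  rw [Finset.sum_comm]
  simp only [Finset.prod_mul_distrib, add_comm]

theorem card_mul_sum_prod_circ {l : ℕ} (f : Fin l → G → ℝ) (g : G → ℝ) :
    (Fintype.card G : ℝ) * ∑ x, ∏ j, circ (f j) g x = ∑ y, conv G l g y * mixedConv f y := by
  have h : ∀ w : G, ∑ x, ∏ j, circ (f j) g x
      = ∑ y : Fin l → G, (∏ j, f j (w + y j)) * conv G l g y := fun w => by
    rw [sum_prod_circ, ← Equiv.sum_comp (Equiv.addLeft (fun _ : Fin l => w))]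
    refine Finset.sum_congr rfl fun y _ => ?_
    rw [← conv_add_const g w y]
    rfl
  calc (Fintype.card G : ℝ) * ∑ x, ∏ j, circ (f j) g x
      = ∑ _w : G, ∑ x, ∏ j, circ (f j) g x := by simp
    _ = ∑ w : G, ∑ y : Fin l → G, (∏ j, f j (w + y j)) * conv G l g y :=
        Finset.sum_congr rfl fun w _ => h w
    _ = ∑ y, conv G l g y * mixedConv f y := by
        rw [Finset.sum_comm]
        simp only [mixedConv, Finset.mul_sum, mul_comm]

theorem sum_abs_conv_le (l : ℕ) (g : G → ℝ) :
    ∑ x, |conv G l g x| ≤ Fintype.card G * (∑ x, |g x|) ^ l := by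
  calc ∑ x, |conv G l g x| ≤ ∑ x : Fin l → G, ∑ z, ∏ i, |g (z + x i)| :=
        Finset.sum_le_sum fun x _ => (Finset.abs_sum_le_sum_abs _ _).trans_eq <|
          Finset.sum_congr rfl fun z _ => Finset.abs_prod _ _
    _ = ∑ z : G, (∑ x, |g (z + x)|) ^ l := by
        rw [Finset.sum_comm]
        simp only [Fintype.sum_pow]
    _ = ∑ _z : G, (∑ x, |g x|) ^ l :=
        Finset.sum_congr rfl fun z _ => by
          rw [← Equiv.sum_comp (Equiv.addLeft z) fun x => |g x|]
          rfl
    _ = Fintype.card G * (∑ x, |g x|) ^ l := by simp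

theorem sum_prod_circ_le {k l : ℕ} (hk : k ≠ 0) (hl : l ≠ 0) (hke : Even k) (hle : Even l)
    (f : Fin l → G → ℝ) (g : G → ℝ) :
    ∑ x : G, ∏ j : Fin l, circ (f j) g x ≤
      (∑ x : G, |g x|) ^ ((l : ℝ) * (1 - 1 / (k : ℝ))) *
        (⨆ x : Fin l → G, |conv G l g x|) ^ ((k : ℝ)⁻¹) *
        ∏ j : Fin l,
          ((Fintype.card G : ℝ)⁻¹ * energy G k l (f j)) ^ (((k : ℝ) * (l : ℝ))⁻¹) := by
  set N : ℝ := (Fintype.card G : ℝ) with hN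
  set S : ℝ := ∑ x : G, |g x| with hS
  set M : ℝ := ⨆ x : Fin l → G, |conv G l g x| with hM
  have hNpos : 0 < N := Nat.cast_pos.mpr Fintype.card_pos
  have hSnn : 0 ≤ S := Finset.sum_nonneg fun _ _ => abs_nonneg _
  have hMnn : 0 ≤ M := Real.iSup_nonneg fun _ => abs_nonneg _
  have hk1 : (1 : ℝ) ≤ k := Nat.one_le_cast.mpr (Nat.one_le_iff_ne_zero.mpr hk)
  have hl0 : (l : ℝ) ≠ 0 := Nat.cast_ne_zero.mpr hl
  have hle' : ∀ x, |conv G l g x| ≤ M :=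
    fun x => le_ciSup (f := fun x => |conv G l g x|) (Set.finite_range _).bddAbove x
  have hE : ∀ j, 0 ≤ energy G k l (f j) := fun j => energy_nonneg hke l _
  have hexp : (0 : ℝ) ≤ 1 - (k : ℝ)⁻¹ := sub_nonneg.mpr (inv_le_one_of_one_le₀ hk1)
  have hC : ∑ x, |conv G l g x| * |mixedConv f x| ^ (k : ℝ)
      ≤ M * ∏ j, energy G k l (f j) ^ ((l : ℝ)⁻¹) := by
    calc ∑ x, |conv G l g x| * |mixedConv f x| ^ (k : ℝ)
        ≤ ∑ x, M * mixedConv f x ^ k := by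
          refine Finset.sum_le_sum fun x _ => ?_
          rw [Real.rpow_natCast, hke.pow_abs]
          exact mul_le_mul_of_nonneg_right (hle' x) (hke.pow_nonneg _)
      _ = M * ∑ x, mixedConv f x ^ k := by rw [Finset.mul_sum]
      _ ≤ _ := mul_le_mul_of_nonneg_left (sum_mixedConv_pow_le k hl hle f) hMnn
  have hmain : N * ∑ x, ∏ j, circ (f j) g x ≤
      (N * S ^ l) ^ (1 - (k : ℝ)⁻¹) *
        (M * ∏ j, energy G k l (f j) ^ ((l : ℝ)⁻¹)) ^ ((k : ℝ)⁻¹) := by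
    rw [card_mul_sum_prod_circ]
    calc ∑ y, conv G l g y * mixedConv f y ≤ ∑ y, |conv G l g y| * |mixedConv f y| :=
          Finset.sum_le_sum fun y _ => (le_abs_self _).trans_eq (abs_mul _ _)
      _ ≤ (∑ y, |conv G l g y|) ^ (1 - (k : ℝ)⁻¹) *
            (∑ y, |conv G l g y| * |mixedConv f y| ^ (k : ℝ)) ^ ((k : ℝ)⁻¹) :=
          Real.inner_le_weight_mul_Lp_of_nonneg _ hk1 _ _ (fun _ => abs_nonneg _)
            fun _ => abs_nonneg _
      _ ≤ _ := by
          have := sum_abs_conv_le l g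
          gcongr
  refine le_of_mul_le_mul_left (hmain.trans_eq ?_) hNpos
  have hQ : 0 ≤ ∏ j, energy G k l (f j) ^ ((l : ℝ)⁻¹) :=
    Finset.prod_nonneg fun j _ => Real.rpow_nonneg (hE j) _
  have hprod : ∏ j, (N⁻¹ * energy G k l (f j)) ^ (((k : ℝ) * (l : ℝ))⁻¹)
      = N ^ (-(k : ℝ)⁻¹) * (∏ j, energy G k l (f j) ^ ((l : ℝ)⁻¹)) ^ ((k : ℝ)⁻¹) := by
    rw [← Real.finsetProd_rpow _ _ fun j _ => Real.rpow_nonneg (hE j) _]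
    simp only [Real.mul_rpow (inv_nonneg.mpr hNpos.le) (hE _), Finset.prod_mul_distrib,
      Finset.prod_const, Finset.card_univ, Fintype.card_fin]
    congr 1
    · rw [← Real.rpow_natCast, ← Real.rpow_mul (inv_nonneg.mpr hNpos.le),
        Real.inv_rpow hNpos.le, ← Real.rpow_neg hNpos.le]
      congr 1
      field_simp
    · refine Finset.prod_congr rfl fun j _ => ?_
      rw [← Real.rpow_mul (hE j), mul_inv, mul_comm]
  rw [hprod, Real.mul_rpow hNpos.le (pow_nonneg hSnn l), Real.mul_rpow hMnn hQ,
    ← Real.rpow_natCast, ← Real.rpow_mul hSnn, one_div, sub_eq_add_neg,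
    Real.rpow_add hNpos, Real.rpow_one]
  ring

end MixedConvolution

theorem statement2 {G : Type*} [AddCommGroup G] [Fintype G]
    (k l : ℕ) (hk : 2 ≤ k) (hl : 2 ≤ l) (hke : Even k) (hle : Even l)
    (A : Fin l → Finset G) (g : G → ℝ) :
    ∑ x : G, ∏ j : Fin l, circ (bal (A j)) g x ≤
      (∑ x : G, |g x|) ^ ((l : ℝ) * (1 - 1 / (k : ℝ))) *
        (⨆ x : Fin l → G, |conv G l g x|) ^ ((k : ℝ)⁻¹) *
        ∏ j : Fin l,
          ((Fintype.card G : ℝ)⁻¹ * energy G k l (bal (A j))) ^ (((k : ℝ) * (l : ℝ))⁻¹) :=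
  sum_prod_circ_le (by omega) (by omega) hke hle (fun j => bal (A j)) g
end
end

section
/- Let k, l ≥ 2 be even integers and A_1,…,A_l ⊆ G be sets with |A_j| = δ_j N for j = 1,…,l. Suppose every A_j is ε-uniform relatively to E^k_l and that 2lε^k ≤ 1. Then Σ_{(x_1,…,x_l)∈G^l} ( C_l(A_1,…,A_l)(x_1,…,x_l) − N·∏_{j=1}^l δ_j )^k ≤ ε^k · l · 2^{kl+1} · N^{l+k} · (∏_{j=1}^l δ_j)^k, where C_l(A_1,…,A_l)(x_1,…,x_l) = Σ_{z∈G} 1_{A_1}(z+x_1)⋯1_{A_l}(z+x_l). -/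
open scoped BigOperators

attribute [local instance] Classical.propDecidable

noncomputable section

/-- `C_l(f_1,…,f_l)(x) = Σ_z f_1(z+x_1)⋯f_l(z+x_l)`. -/
def convs (G : Type*) [AddCommGroup G] [Fintype G] (l : ℕ) (f : Fin l → G → ℝ)
    (x : Fin l → G) : ℝ :=
  ∑ z : G, ∏ i : Fin l, f i (z + x i)

theorem sum_convs_pow {G : Type*} [AddCommGroup G] [Fintype G] (k l : ℕ)
    (h : Fin l → G → ℝ) :
    ∑ x : Fin l → G, convs G l h x ^ k = ∑ z : Fin k → G, ∏ j, conv G k (h j) z := by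
  have hconv (z : Fin k → G) :
      ∏ j, conv G k (h j) z = ∑ x : Fin l → G, ∏ j, ∏ i, h j (x j + z i) := by
    simp only [conv, Finset.prod_univ_sum, Fintype.piFinset_univ]
  simp only [hconv, convs, Fintype.sum_pow]
  rw [Finset.sum_comm]
  refine Finset.sum_congr rfl fun z _ => Finset.sum_congr rfl fun x _ => ?_
  rw [Finset.prod_comm]
  simp only [add_comm]

theorem energy_eq_sum_conv_pow {G : Type*} [AddCommGroup G] [Fintype G] (k l : ℕ) (f : G → ℝ) :
    energy G k l f = ∑ z : Fin k → G, conv G k f z ^ l := by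
  have h := sum_convs_pow k l (fun _ : Fin l => f)
  simpa [convs, conv, energy] using h

theorem energy_const {G : Type*} [AddCommGroup G] [Fintype G] (k l : ℕ) (c : ℝ) :
    energy G k l (fun _ => c) = (c ^ k) ^ l * (Fintype.card G : ℝ) ^ (k + l) := by
  simp only [energy_eq_sum_conv_pow, conv, Finset.prod_const, Finset.sum_const, Finset.card_univ,
    Fintype.card_fin, Fintype.card_fun, nsmul_eq_mul]
  push_cast
  ring

theorem prod_le_sum_pow_div {l : ℕ} (hl : 0 < l) (hle : Even l) (u : Fin l → ℝ) :
    ∏ j, u j ≤ (∑ j, u j ^ l) / l := by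
  have hl' : (l : ℝ) ≠ 0 := by positivity
  have h := Real.geom_mean_le_arith_mean_weighted Finset.univ (fun _ : Fin l => (l : ℝ)⁻¹)
    (fun j => |u j| ^ l) (fun _ _ => by positivity) (by simp [hl']) (fun _ _ => by positivity)
  simp only [Real.pow_rpow_inv_natCast (abs_nonneg _) hl.ne'] at h
  simp only [hle.pow_abs, ← Finset.mul_sum, ← Finset.abs_prod] at h
  rw [div_eq_inv_mul]
  exact (le_abs_self _).trans h

/-- A form of Hölder's inequality for `l` functions. -/
theorem sum_prod_le_of_sum_pow_le {ι : Type*} [Fintype ι] {l : ℕ} (hl : 0 < l) (hle : Even l)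
    (g : Fin l → ι → ℝ) (b : Fin l → ℝ) (hb : ∀ j, 0 ≤ b j) (M : ℝ) (hM : 0 ≤ M)
    (hg : ∀ j, ∑ z, g j z ^ l ≤ b j ^ l * M) :
    ∑ z, ∏ j, g j z ≤ (∏ j, b j) * M := by
  have hfac (j : Fin l) (z : ι) : g j z = b j * (g j z / b j) := by
    rcases eq_or_ne (b j) 0 with h0 | h0
    · have h1 := hg j
      rw [h0, zero_pow hl.ne', zero_mul] at h1
      have h2 : g j z ^ l ≤ 0 :=
        (Finset.single_le_sum (f := fun z => g j z ^ l) (fun z _ => hle.pow_nonneg _)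
          (Finset.mem_univ z)).trans h1
      have h3 := pow_eq_zero_iff hl.ne' |>.1 (le_antisymm h2 (hle.pow_nonneg _))
      simp [h3]
    · field_simp
  have hu (j : Fin l) : ∑ z, (g j z / b j) ^ l ≤ M := by
    simp only [div_pow, ← Finset.sum_div]
    exact div_le_of_le_mul₀ (pow_nonneg (hb j) _) hM (by rw [mul_comm]; exact hg j)
  have hl' : (0 : ℝ) < l := by exact_mod_cast hl
  calc ∑ z, ∏ j, g j z = (∏ j, b j) * ∑ z, ∏ j, g j z / b j := by
        rw [Finset.mul_sum]
        refine Finset.sum_congr rfl fun z _ => ?_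
        rw [← Finset.prod_mul_distrib]
        exact Finset.prod_congr rfl fun j _ => hfac j z
    _ ≤ (∏ j, b j) * M := by
        refine mul_le_mul_of_nonneg_left ?_ (Finset.prod_nonneg fun j _ => hb j)
        calc ∑ z, ∏ j, g j z / b j ≤ ∑ z, (∑ j, (g j z / b j) ^ l) / l :=
              Finset.sum_le_sum fun z _ => prod_le_sum_pow_div hl hle _
          _ = (∑ j, ∑ z, (g j z / b j) ^ l) / l := by
              rw [← Finset.sum_div, Finset.sum_comm]
          _ ≤ (∑ _j : Fin l, M) / l := by
              gcongr with j
              exact hu j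
          _ = M := by
              simp
              field_simp

theorem sum_convs_pow_le {G : Type*} [AddCommGroup G] [Fintype G] {k l : ℕ} (hl : 0 < l)
    (hle : Even l) (h : Fin l → G → ℝ) (b : Fin l → ℝ) (hb : ∀ j, 0 ≤ b j)
    (hh : ∀ j, energy G k l (h j) ≤ b j ^ l * (Fintype.card G : ℝ) ^ (k + l)) :
    ∑ x : Fin l → G, convs G l h x ^ k ≤ (∏ j, b j) * (Fintype.card G : ℝ) ^ (k + l) := by
  rw [sum_convs_pow]
  refine sum_prod_le_of_sum_pow_le hl hle _ b hb _ (by positivity) fun j => ?_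
  rw [← energy_eq_sum_conv_pow]
  exact hh j

theorem convs_add {G : Type*} [AddCommGroup G] [Fintype G] (l : ℕ) (f g : Fin l → G → ℝ)
    (x : Fin l → G) :
    convs G l (fun j y => f j y + g j y) x =
      ∑ p : Fin l → Bool, convs G l (fun j => if p j then f j else g j) x := by
  simp only [convs]
  rw [Finset.sum_comm]
  refine Finset.sum_congr rfl fun z _ => ?_
  have h (j : Fin l) : f j (z + x j) + g j (z + x j) =
      ∑ c : Bool, (if c then f j else g j) (z + x j) := by
    simp
  simp only [h, Finset.prod_univ_sum, Fintype.piFinset_univ]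

theorem sum_pow_le_card_pow_mul_sum_pow {ι : Type*} (s : Finset ι) (f : ι → ℝ) {k : ℕ}
    (hk : 0 < k) (hke : Even k) (M : ℝ) (hM : (s.card : ℝ) ≤ M) :
    (∑ i ∈ s, f i) ^ k ≤ M ^ (k - 1) * ∑ i ∈ s, f i ^ k := by
  obtain ⟨n, rfl⟩ : ∃ n, k = n + 1 := ⟨k - 1, by omega⟩
  have h := pow_sum_div_card_le_sum_pow (s := s) (f := fun i => |f i|)
    (fun _ _ => abs_nonneg _) n
  simp only [hke.pow_abs] at h
  rcases s.eq_empty_or_nonempty with rfl | hs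
  · simp
  have hc : (0 : ℝ) < s.card := by exact_mod_cast hs.card_pos
  have h0 : 0 ≤ ∑ i ∈ s, f i ^ (n + 1) := Finset.sum_nonneg fun _ _ => hke.pow_nonneg _
  rw [div_le_iff₀ (by positivity), mul_comm] at h
  calc (∑ i ∈ s, f i) ^ (n + 1) = |∑ i ∈ s, f i| ^ (n + 1) := (hke.pow_abs _).symm
    _ ≤ (∑ i ∈ s, |f i|) ^ (n + 1) := by
        gcongr
        exact Finset.abs_sum_le_sum_abs _ _
    _ ≤ _ := h
    _ ≤ _ := by
        rw [Nat.add_sub_cancel]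
        gcongr

theorem statement4 {G : Type*} [AddCommGroup G] [Fintype G]
    (k l : ℕ) (hk : 2 ≤ k) (hl : 2 ≤ l) (hke : Even k) (hle : Even l)
    (A : Fin l → Finset G) (δ : Fin l → ℝ) (ε : ℝ)
    (hcard : ∀ j, ((A j).card : ℝ) = δ j * (Fintype.card G : ℝ))
    (hu : ∀ j, unif G ε k l (A j))
    (hε : 2 * (l : ℝ) * ε ^ k ≤ 1) :
    ∑ x : Fin l → G,
        (convs G l (fun j => ind (A j)) x - (Fintype.card G : ℝ) * ∏ j, δ j) ^ k ≤
      ε ^ k * (l : ℝ) * 2 ^ (k * l + 1) * (Fintype.card G : ℝ) ^ (l + k) * (∏ j, δ j) ^ k := by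
  have hN : (0 : ℝ) < Fintype.card G := by exact_mod_cast Fintype.card_pos
  have hδ (j : Fin l) : ((A j).card : ℝ) / (Fintype.card G : ℝ) = δ j := by
    rw [hcard j]
    field_simp
  have hδ0 (j : Fin l) : 0 ≤ δ j := by
    rw [← hδ j]
    positivity
  have hl2 : (2 : ℝ) ≤ l := by exact_mod_cast hl
  have hε0 : 0 ≤ ε ^ k := hke.pow_nonneg ε
  have hε1 : ε ^ k ≤ 1 := by nlinarith
  have hterm (p : Fin l → Bool) :
      ∑ x : Fin l → G, convs G l (fun j => if p j then bal (A j) else fun _ => δ j) x ^ k ≤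
        (∏ j, (if p j then ε ^ k else 1) * δ j ^ k) * (Fintype.card G : ℝ) ^ (k + l) := by
    refine sum_convs_pow_le (by omega) hle _ _ (fun j => ?_) fun j => ?_
    · have := pow_nonneg (hδ0 j) k
      split_ifs <;> positivity
    · cases p j
      · simp [energy_const]
      · have h := hu j
        rw [unif, hδ j] at h
        simpa [mul_pow, pow_mul] using h
  have hprod (p : Fin l → Bool) (hp : p ≠ fun _ => false) :
      ∏ j, (if p j then ε ^ k else 1) * δ j ^ k ≤ ε ^ k * (∏ j, δ j) ^ k := by
    rw [Finset.prod_mul_distrib, Finset.prod_pow]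
    refine mul_le_mul_of_nonneg_right ?_ (pow_nonneg (Finset.prod_nonneg fun j _ => hδ0 j) _)
    obtain ⟨i, hi⟩ := Function.ne_iff.1 hp
    rw [← Finset.mul_prod_erase _ _ (Finset.mem_univ i), if_pos (by simpa using hi)]
    refine mul_le_of_le_one_right hε0 (Finset.prod_le_one ?_ ?_) <;>
      intro j _ <;> split_ifs <;> first | exact zero_le_one | exact le_rfl | assumption
  set s : Finset (Fin l → Bool) := Finset.univ.erase fun _ => false with hs
  have hscard : (s.card : ℝ) ≤ 2 ^ l := by
    have h := Finset.card_le_univ s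
    simp only [Fintype.card_fun, Fintype.card_bool, Fintype.card_fin] at h
    exact_mod_cast h
  have hexp (x : Fin l → G) :
      convs G l (fun j => ind (A j)) x - (Fintype.card G : ℝ) * ∏ j, δ j =
        ∑ p ∈ s, convs G l (fun j => if p j then bal (A j) else fun _ => δ j) x := by
    have h := convs_add l (fun j => bal (A j)) (fun j _ => δ j) x
    have h1 : (fun j y => bal (A j) y + δ j) = fun j => ind (A j) := by
      funext j y
      simp [bal, hδ j]
    rw [h1, ← Finset.add_sum_erase _ _ (Finset.mem_univ fun _ => false)] at h
    rw [h, ← hs]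
    simp [convs]
  have hP : 0 ≤ (∏ j, δ j) ^ k := pow_nonneg (Finset.prod_nonneg fun j _ => hδ0 j) _
  set D : ℝ := ε ^ k * (∏ j, δ j) ^ k * (Fintype.card G : ℝ) ^ (k + l) with hD
  have hD0 : 0 ≤ D := by positivity
  have hpow : ((2 : ℝ) ^ l) ^ (k - 1) * 2 ^ l = 2 ^ (k * l) := by
    rw [← pow_succ, Nat.sub_add_cancel (by omega), ← pow_mul, mul_comm]
  calc _ ≤ ∑ x : Fin l → G, ((2 : ℝ) ^ l) ^ (k - 1) *
          ∑ p ∈ s, convs G l (fun j => if p j then bal (A j) else fun _ => δ j) x ^ k := by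
        refine Finset.sum_le_sum fun x _ => ?_
        rw [hexp x]
        exact sum_pow_le_card_pow_mul_sum_pow s _ (by omega) hke _ hscard
    _ = ((2 : ℝ) ^ l) ^ (k - 1) * ∑ p ∈ s, ∑ x : Fin l → G,
          convs G l (fun j => if p j then bal (A j) else fun _ => δ j) x ^ k := by
        rw [← Finset.mul_sum, Finset.sum_comm]
    _ ≤ ((2 : ℝ) ^ l) ^ (k - 1) * ∑ _p ∈ s, D := by
        gcongr with p hp
        exact (hterm p).trans (mul_le_mul_of_nonneg_right
          (hprod p (Finset.ne_of_mem_erase hp)) (by positivity))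
    _ ≤ ((2 : ℝ) ^ l) ^ (k - 1) * (2 ^ l * D) := by
        rw [Finset.sum_const, nsmul_eq_mul]
        gcongr
    _ = 2 ^ (k * l) * D := by rw [← mul_assoc, hpow]
    _ ≤ 2 ^ (k * l) * D * (2 * l) :=
        le_mul_of_one_le_right (by positivity) (by linarith)
    _ = _ := by
        rw [hD]
        ring
end
end

section
/- There is an absolute constant C > 0 with the following property. Let A ⊆ G with |A| = δN, δ > 0, let l ≥ 2 be an integer, ε > 0 a parameter, and ε_* = min{ε, 1}. Suppose k ≥ 5 is odd and E^k_l(f_A) = ε^{lk} δ^{lk} N^{l+k}, and suppose that A is (ε·ε_*^{l−1}/(8l))-uniform relatively to E^{k_*}_{l−1} for every even integer k_* ≤ C·k·l·ε_*^{-l}·L(ε_*). Then there exists an even integer k_1 ≤ C·k·l·ε_*^{-l}·L(ε_*) such that E^{k_1}_l(1_A) ≥ (1 + ε·ε_*^{l−1}/(8l))^{l·k_1} · δ^{l·k_1} · N^{l+k_1}. -/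
open scoped BigOperators

attribute [local instance] Classical.propDecidable

noncomputable section

lemma pow_add_tangent_le {m : ℕ} (hm : Even m) (z w : ℝ) :
    z ^ m + m * z ^ (m - 1) * (w - z) ≤ w ^ m := by
  rcases m with _ | p
  · simp
  rcases eq_or_ne z 0 with rfl | hz
  · have hp : p ≠ 0 := by rintro rfl; simp at hm
    simpa [hp] using hm.pow_nonneg w
  have hb : 1 + ((p + 1 : ℕ) : ℝ) * (w / z - 1) ≤ (w / z) ^ (p + 1) := by
    rcases le_or_gt (-2) (w / z - 1) with h | h
    · simpa using one_add_mul_le_pow h (p + 1)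
    · have h1 := hm.pow_nonneg (w / z)
      have h2 : (1 : ℝ) ≤ ((p + 1 : ℕ) : ℝ) := by push_cast; linarith [p.cast_nonneg (α := ℝ)]
      nlinarith
  have hzm : 0 < z ^ (p + 1) := hm.pow_pos hz
  calc z ^ (p + 1) + ((p + 1 : ℕ) : ℝ) * z ^ (p + 1 - 1) * (w - z)
      = z ^ (p + 1) * (1 + ((p + 1 : ℕ) : ℝ) * (w / z - 1)) := by
        rw [Nat.add_sub_cancel]; field_simp; ring
    _ ≤ z ^ (p + 1) * (w / z) ^ (p + 1) := by gcongr
    _ = w ^ (p + 1) := by rw [← mul_pow, mul_div_cancel₀ _ hz]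

lemma extreme_terms_le_add_pow_of_nonneg {a b : ℝ} (ha : 0 ≤ a) (hb : 0 ≤ b) (n : ℕ) :
    a ^ (n + 3) + (n + 3) * a ^ (n + 2) * b + (n + 3) * a * b ^ (n + 2) + b ^ (n + 3)
      ≤ (a + b) ^ (n + 3) := by
  induction n with
  | zero => norm_num; nlinarith
  | succ n ih =>
    have h := mul_le_mul_of_nonneg_right ih (add_nonneg ha hb)
    have h1 : 0 ≤ (n + 3 : ℝ) * a ^ (n + 2) * b ^ 2 := by positivity
    have h2 : 0 ≤ (n + 3 : ℝ) * a ^ 2 * b ^ (n + 2) := by positivity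
    rw [show n + 1 + 3 = (n + 3) + 1 by ring, pow_succ (a + b)]
    refine le_trans ?_ h
    push_cast
    linear_combination h1 + h2

lemma extreme_terms_le_add_pow {p : ℕ} (hp : Even p) (hp0 : p ≠ 0) (a b : ℝ) :
    a ^ (p + 2) + (p + 2) * a ^ (p + 1) * b + (p + 2) * a * b ^ (p + 1) + b ^ (p + 2)
      ≤ (a + b) ^ (p + 2) := by
  have hp2 : Even (p + 2) := hp.add even_two
  have key : ∀ a b : ℝ, a * b ≤ 0 → b ^ 2 ≤ a ^ 2 →
      a ^ (p + 2) + (p + 2) * a ^ (p + 1) * b + (p + 2) * a * b ^ (p + 1) + b ^ (p + 2)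
        ≤ (a + b) ^ (p + 2) := by
    intro a b hab hle
    have ht := pow_add_tangent_le hp2 a (a + b)
    have hbp : 0 ≤ b ^ p := hp.pow_nonneg b
    have hbb : b ^ 2 ≤ -(a * b) := by
      have : (b ^ 2) ^ 2 ≤ (-(a * b)) ^ 2 := by nlinarith [sq_nonneg b]
      exact le_of_sq_le_sq this (by linarith)
    have h3 : (p + 2) * a * b ^ (p + 1) + b ^ (p + 2) ≤ 0 := by
      have hpn : (0 : ℝ) ≤ p := p.cast_nonneg
      have : (p + 2) * (a * b) + b ^ 2 ≤ 0 := by nlinarith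
      calc _ = b ^ p * ((p + 2) * (a * b) + b ^ 2) := by ring
        _ ≤ 0 := mul_nonpos_of_nonneg_of_nonpos hbp this
    rw [show p + 2 - 1 = p + 1 by omega, add_sub_cancel_left] at ht
    push_cast at ht
    linarith
  rcases le_total (a * b) 0 with hab | hab
  · rcases le_total (b ^ 2) (a ^ 2) with h | h
    · exact key a b hab h
    · have := key b a (by linarith [mul_comm a b]) h
      rw [add_comm b a] at this
      linarith
  · obtain ⟨n, rfl⟩ : ∃ n, p = n + 1 := Nat.exists_eq_succ_of_ne_zero hp0
    have hodd : Odd (n + 1 + 1) := hp.add_one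
    rcases mul_nonneg_iff.1 hab with ⟨ha, hb⟩ | ⟨ha, hb⟩
    · have := extreme_terms_le_add_pow_of_nonneg ha hb n
      push_cast
      linear_combination this
    · have := extreme_terms_le_add_pow_of_nonneg (neg_nonneg.2 ha) (neg_nonneg.2 hb) n
      rw [← neg_add, hp2.neg_pow, hp2.neg_pow, hp2.neg_pow, hodd.neg_pow, hodd.neg_pow] at this
      push_cast
      linarith

lemma pow_le_convex_comb {s r : ℕ} (hsr : s ≤ r) (hr : r ≠ 0) {a : ℝ} (ha : 0 ≤ a) :
    a ^ s ≤ (s / r : ℝ) * a ^ r + (1 - s / r) := by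
  have hr' : (0 : ℝ) < r := by positivity
  have h1 : (s / r : ℝ) ≤ 1 := by rw [div_le_one hr']; exact_mod_cast hsr
  have h := Real.geom_mean_le_arith_mean2_weighted (w₁ := (s / r : ℝ)) (w₂ := 1 - s / r)
    (p₁ := a ^ r) (p₂ := 1) (by positivity) (by linarith) (by positivity) zero_le_one (by ring)
  rw [Real.one_rpow, mul_one, mul_one, ← Real.rpow_natCast a r, ← Real.rpow_mul ha,
    mul_div_cancel₀ _ hr'.ne', Real.rpow_natCast, Real.rpow_natCast] at h
  exact h

lemma expect_sum_pow_le {Ω ι : Type*} [Fintype Ω] {m : ℕ} (hm : Even m) (s : Finset ι)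
    {a : ι → ℝ} (ha : ∀ i ∈ s, 0 < a i) {h : ι → Ω → ℝ}
    (hh : ∀ i ∈ s, 𝔼 x, h i x ^ m ≤ a i ^ m) :
    𝔼 x, (∑ i ∈ s, h i x) ^ m ≤ (∑ i ∈ s, a i) ^ m := by
  rcases s.eq_empty_or_nonempty with rfl | hs
  · rcases isEmpty_or_nonempty Ω with _ | _
    · simp
    · simp
  set D := ∑ i ∈ s, a i with hD
  have hDpos : 0 < D := Finset.sum_pos ha hs
  have hpt : ∀ x, (∑ i ∈ s, h i x) ^ m ≤ ∑ i ∈ s, a i / D * (D / a i * h i x) ^ m := by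
    intro x
    have := (hm.convexOn_pow (𝕜 := ℝ)).map_sum_le (t := s) (w := fun i => a i / D)
      (p := fun i => D / a i * h i x) (fun i hi => (div_pos (ha i hi) hDpos).le)
      (by rw [← Finset.sum_div, ← hD, div_self hDpos.ne']) (fun i _ => Set.mem_univ _)
    have hsum : ∑ i ∈ s, a i / D * (D / a i * h i x) = ∑ i ∈ s, h i x := by
      refine Finset.sum_congr rfl fun i hi => ?_
      have := (ha i hi).ne'
      field_simp
    simpa only [smul_eq_mul, hsum] using this
  calc 𝔼 x, (∑ i ∈ s, h i x) ^ m
      ≤ 𝔼 x, ∑ i ∈ s, a i / D * (D / a i * h i x) ^ m := Finset.expect_le_expect fun x _ => hpt x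
    _ = ∑ i ∈ s, a i / D * ((D / a i) ^ m * 𝔼 x, h i x ^ m) := by
        rw [Finset.expect_sum_comm]
        simp_rw [mul_pow, Finset.mul_expect]
    _ ≤ ∑ i ∈ s, a i / D * D ^ m := by
        refine Finset.sum_le_sum fun i hi => ?_
        have hai := ha i hi
        gcongr
        calc (D / a i) ^ m * 𝔼 x, h i x ^ m ≤ (D / a i) ^ m * a i ^ m := by
              gcongr; exact hh i hi
          _ = D ^ m := by rw [← mul_pow, div_mul_cancel₀ _ hai.ne']
    _ = D ^ m := by rw [← Finset.sum_mul, ← Finset.sum_div, ← hD, div_self hDpos.ne', one_mul]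

lemma lt_expect_one_add_pow {Ω : Type*} [Fintype Ω] [Nonempty Ω] {Y : Ω → ℝ} {e : ℝ} {k n : ℕ}
    (he : 0 < e) (hk : Odd k) (hk5 : 5 ≤ k) (hn : Even n) (hne : 6 ≤ n * min e 1)
    (hY : e ^ k ≤ 𝔼 x, Y x ^ k) :
    (1 + 2 * e / 7) ^ (k * n) < 𝔼 x, (1 + Y x) ^ (k * n) := by
  have hm : Even (k * n) := hn.mul_left k
  have hpos : 0 < 1 + 2 * e / 7 := by positivity
  have hpt : ∀ y : ℝ, y ^ k ≤
      e ^ k / 4 + e ^ k / 2 * ((1 + 2 * e / 7) ^ (k * n))⁻¹ * (1 + y) ^ (k * n) := by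
    intro y
    rcases le_or_gt y (3 / 4 * e) with hy | hy
    · have h1 : y ^ k ≤ (3 / 4 * e) ^ k := hk.strictMono_pow.monotone hy
      have h2 : (3 / 4 : ℝ) ^ k ≤ 1 / 4 :=
        (pow_le_pow_of_le_one (by norm_num) (by norm_num) hk5).trans (by norm_num)
      have h3 : 0 ≤ e ^ k / 2 * ((1 + 2 * e / 7) ^ (k * n))⁻¹ * (1 + y) ^ (k * n) :=
        mul_nonneg (by positivity) (hm.pow_nonneg _)
      rw [mul_pow] at h1
      nlinarith [pow_pos he k]
    · have hy0 : 0 < y := lt_trans (by positivity) hy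
      set e' := min e 1 with he'
      have he'0 : 0 < e' := lt_min he one_pos
      have hq : 1 + y / e * (e' / 3) ≤ (1 + y) / (1 + 2 * e / 7) := by
        rw [le_div_iff₀ hpos]
        obtain ⟨t, rfl⟩ : ∃ t, y = t * e := ⟨y / e, by field_simp⟩
        have ht : 3 / 4 < t := lt_of_mul_lt_mul_right hy he.le
        rw [mul_div_cancel_right₀ _ he.ne']
        have h1 : e' ≤ e := min_le_left _ _
        have h2 : e' ≤ 1 := min_le_right _ _
        have h3 : e' * e ≤ e := by nlinarith
        nlinarith [mul_le_mul_of_nonneg_left h1 (by linarith : 0 ≤ t),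
          mul_le_mul_of_nonneg_left h3 (by linarith : 0 ≤ t)]
      have hb : 2 * (y / e) ≤ ((1 + y) / (1 + 2 * e / 7)) ^ n := by
        have h0 : 0 ≤ y / e * (e' / 3) := by positivity
        calc 2 * (y / e) ≤ 1 + n * (y / e * (e' / 3)) := by
              have : 0 < y / e := by positivity
              nlinarith
          _ ≤ (1 + y / e * (e' / 3)) ^ n := one_add_mul_le_pow (by linarith) n
          _ ≤ _ := by gcongr
      have hbk : 2 * (y / e) ^ k ≤ ((1 + y) / (1 + 2 * e / 7)) ^ (k * n) := by
        calc 2 * (y / e) ^ k ≤ 2 ^ k * (y / e) ^ k := by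
              gcongr
              exact le_self_pow₀ (by norm_num) (by omega)
          _ = (2 * (y / e)) ^ k := by rw [mul_pow]
          _ ≤ (((1 + y) / (1 + 2 * e / 7)) ^ n) ^ k := by gcongr
          _ = _ := by rw [← pow_mul, mul_comm n k]
      have h4 := mul_le_mul_of_nonneg_left hbk (by positivity : 0 ≤ e ^ k / 2)
      have h5 : e ^ k / 2 * (2 * (y / e) ^ k) = y ^ k := by
        rw [div_pow]; field_simp
      rw [h5, div_pow, div_eq_inv_mul _ ((1 + 2 * e / 7) ^ (k * n)), ← mul_assoc] at h4
      linarith [pow_pos he k]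
  have hE := hY.trans (Finset.expect_le_expect fun x (_ : x ∈ Finset.univ) => hpt (Y x))
  rw [Finset.expect_add_distrib, Fintype.expect_const, ← Finset.mul_expect] at hE
  by_contra! hcon
  have hle : ((1 + 2 * e / 7) ^ (k * n))⁻¹ * 𝔼 x, (1 + Y x) ^ (k * n) ≤ 1 := by
    rw [inv_mul_le_iff₀ (by positivity), mul_one]; exact hcon
  have := mul_le_mul_of_nonneg_left hle (by positivity : 0 ≤ e ^ k / 2)
  nlinarith [pow_pos he k]

/-- The average over translates `z` of `∏ i, φ i (z + x i)`. -/
def rowMean {G : Type*} [AddCommGroup G] [Fintype G] {l : ℕ} (φ : Fin l → G → ℝ)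
    (x : Fin l → G) : ℝ :=
  𝔼 z, ∏ i, φ i (z + x i)

/-- The row equal to `F` at the positions in `S` and to `1` elsewhere. -/
def restr {G : Type*} {l : ℕ} (F : G → ℝ) (S : Finset (Fin l)) (i : Fin l) : G → ℝ :=
  if i ∈ S then F else 1

lemma prod_expect_eq {ι α : Type*} [Fintype ι] [DecidableEq ι] [Fintype α] (f : ι → α → ℝ) :
    ∏ i, 𝔼 x, f i x = 𝔼 x : ι → α, ∏ i, f i (x i) := by
  simp only [Fintype.expect_eq_sum_div_card, Finset.prod_div_distrib, Finset.prod_univ_sum,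
    Fintype.piFinset_univ, Finset.prod_const, Finset.card_univ, Fintype.card_fun, Nat.cast_pow]

section

variable {G : Type*} [AddCommGroup G] [Fintype G] {l : ℕ}

lemma expect_prod_rowMean {ι : Type*} [Fintype ι] [DecidableEq ι] (φ : ι → Fin l → G → ℝ) :
    𝔼 x, ∏ j, rowMean (φ j) x = 𝔼 z : ι → G, ∏ i, 𝔼 y, ∏ j, φ j i (z j + y) := by
  simp only [rowMean, prod_expect_eq]
  rw [Finset.expect_comm]
  exact Finset.expect_congr rfl fun z _ => Finset.expect_congr rfl fun x _ => Finset.prod_comm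

lemma rowMean_restr_univ (F : G → ℝ) :
    rowMean (restr F (Finset.univ : Finset (Fin l))) = rowMean fun _ => F := by
  congr; funext i; simp [restr]

lemma rowMean_restr (F : G → ℝ) (S : Finset (Fin l)) (x : Fin l → G) :
    rowMean (restr F S) x = 𝔼 z, ∏ i ∈ S, F (z + x i) := by
  simp only [rowMean]
  refine Finset.expect_congr rfl fun z _ => ?_
  rw [← Finset.prod_subset (Finset.subset_univ S)]
  · exact Finset.prod_congr rfl fun i hi => by simp [restr, hi]
  · intro i _ hi
    simp [restr, hi]

lemma rowMean_one_add (F : G → ℝ) (x : Fin l → G) :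
    rowMean (fun _ => 1 + F) x = ∑ S : Finset (Fin l), rowMean (restr F S) x := by
  simp only [rowMean_restr, ← Finset.expect_sum_comm]
  simp only [rowMean, Pi.add_apply, Pi.one_apply, Finset.prod_one_add, Finset.powerset_univ]

lemma expect_rowMean_restr_pow (F : G → ℝ) (S : Finset (Fin l)) (m : ℕ) :
    𝔼 x, rowMean (restr F S) x ^ m =
      𝔼 z : Fin m → G, (𝔼 y, ∏ j, F (z j + y)) ^ S.card := by
  have h := expect_prod_rowMean (fun _ : Fin m => restr F S)
  simp only [Finset.prod_const, Finset.card_univ, Fintype.card_fin] at h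
  rw [h]
  refine Finset.expect_congr rfl fun z _ => ?_
  rw [← Finset.prod_const, ← Finset.prod_subset (Finset.subset_univ S)]
  · exact Finset.prod_congr rfl fun i hi => by simp [restr, hi]
  · intro i _ hi
    simp [restr, hi]

lemma expect_rowMean_mul_pow (φ : Fin l → G → ℝ) (F : G → ℝ) (n : ℕ) :
    𝔼 x, rowMean φ x * rowMean (fun _ => F) x ^ n =
      𝔼 z : Fin (n + 1) → G, ∏ i, 𝔼 y, φ i (z 0 + y) * ∏ j : Fin n, F (z j.succ + y) := by
  have h := expect_prod_rowMean (Fin.cons φ fun _ : Fin n => fun _ => F)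
  simpa [Fin.prod_univ_succ] using h

lemma expect_rowMean_restr_mul_pow (S : Finset (Fin l)) (F : G → ℝ) (n : ℕ) :
    𝔼 x, rowMean (restr F S) x * rowMean (fun _ => F) x ^ n =
      𝔼 z : Fin (n + 1) → G, (𝔼 y, F (z 0 + y) * ∏ j : Fin n, F (z j.succ + y)) ^ S.card *
        (𝔼 y, ∏ j : Fin n, F (z j.succ + y)) ^ (l - S.card) := by
  rw [expect_rowMean_mul_pow]
  refine Finset.expect_congr rfl fun z _ => ?_
  rw [← Finset.prod_mul_prod_compl S]
  congr 1
  · rw [← Finset.prod_const]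
    exact Finset.prod_congr rfl fun i hi => by simp [restr, hi]
  · have hc : Sᶜ.card = l - S.card := by rw [Finset.card_compl, Fintype.card_fin]
    rw [← hc, ← Finset.prod_const]
    exact Finset.prod_congr rfl fun i hi => by simp [restr, Finset.mem_compl.1 hi]

lemma expect_rowMean_one_add_mul_pow (F : G → ℝ) (n : ℕ) :
    𝔼 x : Fin l → G, rowMean (fun _ => 1 + F) x * rowMean (fun _ => F) x ^ n =
      𝔼 z : Fin (n + 1) → G, ((𝔼 y, ∏ j : Fin n, F (z j.succ + y)) +
        𝔼 y, F (z 0 + y) * ∏ j : Fin n, F (z j.succ + y)) ^ l := by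
  rw [expect_rowMean_mul_pow]
  simp [add_mul, Finset.expect_add_distrib]

lemma rowMean_restr_empty (F : G → ℝ) (x : Fin l → G) :
    rowMean (restr F (∅ : Finset (Fin l))) x = 1 := by
  rw [rowMean_restr]
  simp

lemma rowMean_restr_singleton (F : G → ℝ) (i : Fin l) (x : Fin l → G) :
    rowMean (restr F {i}) x = 𝔼 z, F z := by
  rw [rowMean_restr]
  simp only [Finset.prod_singleton]
  exact Fintype.expect_equiv (Equiv.addRight (x i)) _ _ fun _ => rfl

lemma expect_mul_pow_le_of_even {p : ℕ} (hp : Even p) (hp0 : p ≠ 0) {F : G → ℝ}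
    (hF : 𝔼 z, F z = 0) (n : ℕ) :
    𝔼 x : Fin (p + 2) → G, (1 + rowMean (fun _ => F) x) * rowMean (fun _ => F) x ^ n ≤
      𝔼 x : Fin (p + 2) → G, (rowMean (fun _ => 1 + F) x -
        ∑ S ∈ Finset.powersetCard (p + 1) Finset.univ, rowMean (restr F S) x) *
          rowMean (fun _ => F) x ^ n := by
  have hterm : ∀ S : Finset (Fin (p + 2)), _ := fun S => expect_rowMean_restr_mul_pow S F n
  have hone : ∀ i : Fin (p + 2), _ := fun i => hterm {i}
  have hempty := hterm ∅
  have huniv := hterm Finset.univ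
  simp only [rowMean_restr_singleton, hF, zero_mul, Finset.expect_const_zero,
    Finset.card_singleton, pow_one, show p + 2 - 1 = p + 1 by omega] at hone
  simp only [rowMean_restr_empty, one_mul, Finset.card_empty, pow_zero, Nat.sub_zero] at hempty
  simp only [rowMean_restr_univ, Finset.card_univ, Fintype.card_fin, Nat.sub_self, pow_zero,
    mul_one] at huniv
  have hco : 𝔼 x : Fin (p + 2) → G, (∑ S ∈ Finset.powersetCard (p + 1) Finset.univ,
      rowMean (restr F S) x) * rowMean (fun _ => F) x ^ n =
      (p + 2) * 𝔼 z : Fin (n + 1) → G,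
        (𝔼 y, F (z 0 + y) * ∏ j : Fin n, F (z j.succ + y)) ^ (p + 1) *
        (𝔼 y, ∏ j : Fin n, F (z j.succ + y)) := by
    simp only [Finset.sum_mul]
    rw [Finset.expect_sum_comm, Finset.sum_congr rfl (g := fun _ => 𝔼 z : Fin (n + 1) → G,
        (𝔼 y, F (z 0 + y) * ∏ j : Fin n, F (z j.succ + y)) ^ (p + 1) *
        (𝔼 y, ∏ j : Fin n, F (z j.succ + y))), Finset.sum_const, Finset.card_powersetCard]
    · have : (p + 2).choose (p + 1) = p + 2 := Nat.choose_succ_self_right (p + 1)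
      rw [Finset.card_univ, Fintype.card_fin, this, nsmul_eq_mul]
      push_cast
      rfl
    · intro S hS
      rw [hterm, (Finset.mem_powersetCard.1 hS).2, show p + 2 - (p + 1) = 1 by omega]
      simp only [pow_one]
  simp only [add_mul, sub_mul, one_mul, Finset.expect_add_distrib, Finset.expect_sub_distrib]
  rw [hempty, huniv, hco, expect_rowMean_one_add_mul_pow, le_sub_iff_add_le]
  have hi := hone 0
  have hzero : (0 : ℝ) = (p + 2) * 𝔼 z : Fin (n + 1) → G,
      (𝔼 y, F (z 0 + y) * ∏ j : Fin n, F (z j.succ + y)) *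
        (𝔼 y, ∏ j : Fin n, F (z j.succ + y)) ^ (p + 1) := by rw [← hi, mul_zero]
  rw [← add_zero (_ + _ + _), hzero, Finset.mul_expect, Finset.mul_expect,
    ← Finset.expect_add_distrib, ← Finset.expect_add_distrib, ← Finset.expect_add_distrib]
  refine Finset.expect_le_expect fun z _ => ?_
  refine le_trans (le_of_eq ?_) (extreme_terms_le_add_pow hp hp0 _ _)
  ring

lemma expect_one_add_pow_le_of_even {p m : ℕ} (hp : Even p) (hp0 : p ≠ 0) (hm : Even m)
    (hm0 : m ≠ 0) {F : G → ℝ} (hF : 𝔼 z, F z = 0) :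
    𝔼 x : Fin (p + 2) → G, (1 + rowMean (fun _ => F) x) ^ m ≤
      𝔼 x : Fin (p + 2) → G, (rowMean (fun _ => 1 + F) x -
        ∑ S ∈ Finset.powersetCard (p + 1) Finset.univ, rowMean (restr F S) x) ^ m := by
  set Y : (Fin (p + 2) → G) → ℝ := rowMean fun _ => F with hY
  set W : (Fin (p + 2) → G) → ℝ := fun x => rowMean (fun _ => 1 + F) x -
    ∑ S ∈ Finset.powersetCard (p + 1) Finset.univ, rowMean (restr F S) x with hW
  have hlin : 0 ≤ 𝔼 x, (1 + Y x) ^ (m - 1) * (W x - (1 + Y x)) := by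
    have hexp : ∀ x, (1 + Y x) ^ (m - 1) * (W x - (1 + Y x)) =
        ∑ n ∈ Finset.range (m - 1 + 1), ((m - 1).choose n : ℝ) *
          (W x * Y x ^ n - (1 + Y x) * Y x ^ n) := by
      intro x
      rw [add_comm 1 (Y x), add_pow, Finset.sum_mul]
      refine Finset.sum_congr rfl fun n _ => ?_
      ring
    simp only [hexp]
    rw [Finset.expect_sum_comm]
    refine Finset.sum_nonneg fun n _ => ?_
    rw [← Finset.mul_expect, Finset.expect_sub_distrib]
    exact mul_nonneg (Nat.cast_nonneg _)
      (sub_nonneg.2 (expect_mul_pow_le_of_even hp hp0 hF n))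
  calc 𝔼 x, (1 + Y x) ^ m
      ≤ 𝔼 x, (1 + Y x) ^ m + m * 𝔼 x, (1 + Y x) ^ (m - 1) * (W x - (1 + Y x)) :=
        le_add_of_nonneg_right (by positivity)
    _ = 𝔼 x, ((1 + Y x) ^ m + m * (1 + Y x) ^ (m - 1) * (W x - (1 + Y x))) := by
        rw [Finset.expect_add_distrib, Finset.mul_expect]
        simp only [mul_assoc]
    _ ≤ 𝔼 x, W x ^ m := Finset.expect_le_expect fun x _ => pow_add_tangent_le hm _ _

lemma expect_pow_le_of_expect_pow_le {Ω : Type*} [Fintype Ω] [Nonempty Ω] {D : Ω → ℝ} {c : ℝ}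
    (hc : 0 < c) {s r : ℕ} (hsr : s ≤ r) (hr : Even r) (h : 𝔼 z, D z ^ r ≤ c ^ r) :
    𝔼 z, D z ^ s ≤ c ^ s := by
  rcases eq_or_ne r 0 with rfl | hr0
  · obtain rfl : s = 0 := by omega
    exact h
  have hpt : ∀ z, D z ^ s ≤
      c ^ s * ((s / r : ℝ) * ((c ^ r)⁻¹ * D z ^ r) + (1 - s / r)) := by
    intro z
    have h1 := pow_le_convex_comb hsr hr0 (a := |D z| / c) (by positivity)
    rw [div_pow, div_le_iff₀ (by positivity), div_pow, hr.pow_abs] at h1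
    calc D z ^ s ≤ |D z| ^ s := by rw [← abs_pow]; exact le_abs_self _
      _ ≤ _ := h1
      _ = _ := by ring
  have h2 : (c ^ r)⁻¹ * 𝔼 z, D z ^ r ≤ 1 := by
    rwa [inv_mul_le_iff₀ (by positivity), mul_one]
  calc 𝔼 z, D z ^ s
      ≤ 𝔼 z, c ^ s * ((s / r : ℝ) * ((c ^ r)⁻¹ * D z ^ r) + (1 - s / r)) :=
        Finset.expect_le_expect fun z _ => hpt z
    _ = c ^ s * ((s / r : ℝ) * ((c ^ r)⁻¹ * 𝔼 z, D z ^ r) + (1 - s / r)) := by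
        rw [← Finset.mul_expect, Finset.expect_add_distrib, Fintype.expect_const,
          ← Finset.mul_expect, ← Finset.mul_expect]
    _ ≤ c ^ s * ((s / r : ℝ) * 1 + (1 - s / r)) := by gcongr
    _ = c ^ s := by ring

lemma le_expect_pow_of_expect_sub_pow {m : ℕ} (hm : Even m) {η : ℝ} (hη : 0 < η) {F : G → ℝ}
    {P : Finset (Finset (Fin l))} (hP : ∅ ∉ P)
    (hsmall : ∀ S ∈ P, 𝔼 x, rowMean (restr F S) x ^ m ≤ (η ^ S.card) ^ m)
    (hlarge : (2 * (1 + η) ^ l - 1) ^ m <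
      𝔼 x, (rowMean (fun _ => 1 + F) x - ∑ S ∈ P, rowMean (restr F S) x) ^ m) :
    (1 + η) ^ (l * m) ≤ 𝔼 x : Fin l → G, rowMean (fun _ => 1 + F) x ^ m := by
  by_contra! hcon
  rw [pow_mul] at hcon
  have hsum : ∑ S ∈ P, η ^ S.card ≤ (1 + η) ^ l - 1 := by
    have h1 : ∑ S : Finset (Fin l), η ^ S.card = (1 + η) ^ l := by
      have := Finset.prod_one_add (f := fun _ : Fin l => η) Finset.univ
      simpa using this.symm
    have h2 : ∑ S ∈ insert ∅ P, η ^ S.card ≤ (1 + η) ^ l := by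
      rw [← h1]
      exact Finset.sum_le_sum_of_subset_of_nonneg (Finset.subset_univ _)
        fun _ _ _ => by positivity
    rw [Finset.sum_insert hP, Finset.card_empty, pow_zero] at h2
    linarith
  have hmink := expect_sum_pow_le hm (Finset.insertNone P)
    (a := fun o => o.elim ((1 + η) ^ l) fun S => η ^ S.card)
    (h := fun o (x : Fin l → G) => o.elim (rowMean (fun _ => 1 + F) x)
      fun S => -rowMean (restr F S) x)
    (by rintro (_ | S) _ <;> simp only [Option.elim] <;> positivity)
    (by
      rintro (_ | S) hS
      · exact hcon.le
      · simpa [hm.neg_pow] using hsmall S (by simpa using hS))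
  simp only [Finset.sum_insertNone, Option.elim, Finset.sum_neg_distrib, ← sub_eq_add_neg]
    at hmink
  have : ((1 + η) ^ l + ∑ S ∈ P, η ^ S.card) ^ m ≤ (2 * (1 + η) ^ l - 1) ^ m := by
    gcongr
    linarith
  linarith

lemma le_expect_rowMean_one_add_pow {m : ℕ} (hl : 2 ≤ l) (hm : Even m) (hm0 : m ≠ 0) {η : ℝ}
    (hη : 0 < η) {F : G → ℝ} (hF : 𝔼 z, F z = 0)
    (hunif : 𝔼 z : Fin m → G, (𝔼 y, ∏ j, F (z j + y)) ^ (l - 1) ≤ (η ^ m) ^ (l - 1))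
    (hlarge : (2 * (1 + η) ^ l - 1) ^ m < 𝔼 x : Fin l → G, (1 + rowMean (fun _ => F) x) ^ m) :
    (1 + η) ^ (l * m) ≤ 𝔼 x : Fin l → G, rowMean (fun _ => 1 + F) x ^ m := by
  by_cases hl' : Even l ∧ l ≠ 2
  · obtain ⟨p, rfl⟩ : ∃ p, l = p + 2 := ⟨l - 2, by omega⟩
    have hp : Even p := by simpa [Nat.even_add] using hl'.1
    refine le_expect_pow_of_expect_sub_pow hm hη (P := Finset.powersetCard (p + 1) Finset.univ)
      (by simp [Finset.mem_powersetCard]) (fun S hS => ?_)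
      (hlarge.trans_le (expect_one_add_pow_le_of_even hp (by omega) hm hm0 hF))
    rw [expect_rowMean_restr_pow, (Finset.mem_powersetCard.1 hS).2, pow_right_comm]
    exact hunif
  · refine le_expect_pow_of_expect_sub_pow hm hη
      (P := (Finset.univ.erase ∅).erase Finset.univ) (by simp) (fun S hS => ?_) ?_
    · rw [expect_rowMean_restr_pow, pow_right_comm]
      have hS1 : S.card ≠ 0 := by
        rw [Ne, Finset.card_eq_zero]
        exact (Finset.mem_erase.1 (Finset.mem_erase.1 hS).2).1
      have hS2 : S.card < l := by
        have := (Finset.card_lt_iff_ne_univ S).2 (Finset.mem_erase.1 hS).1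
        simpa using this
      rcases eq_or_ne l 2 with rfl | h2
      · rw [show S.card = 2 - 1 by omega]
        exact hunif
      · have hodd : Odd l := Nat.not_even_iff_odd.1 fun h => hl' ⟨h, h2⟩
        exact expect_pow_le_of_expect_pow_le (by positivity) (by omega)
          (Nat.Odd.sub_odd hodd odd_one) hunif
    · refine hlarge.trans_eq (Finset.expect_congr rfl fun x _ => ?_)
      have hne : (Finset.univ : Finset (Fin l)) ≠ ∅ := by
        rw [Ne, ← Finset.card_eq_zero, Finset.card_univ, Fintype.card_fin]
        omega
      rw [rowMean_one_add, ← Finset.add_sum_erase _ _ (Finset.mem_univ ∅),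
        ← Finset.add_sum_erase (Finset.univ.erase ∅) _
          (Finset.mem_erase.2 ⟨hne, Finset.mem_univ _⟩), rowMean_restr_empty, rowMean_restr_univ]
      ring

end

lemma energy_const_mul {G : Type*} [AddCommGroup G] [Fintype G] (k l : ℕ) (δ : ℝ) (F : G → ℝ) :
    energy G k l (fun x => δ * F x) = δ ^ (l * k) * (Fintype.card G : ℝ) ^ (l + k) *
      𝔼 x : Fin l → G, rowMean (fun _ => F) x ^ k := by
  have hconv : ∀ x : Fin l → G, conv G l (fun x => δ * F x) x =
      δ ^ l * ((Fintype.card G : ℝ) * rowMean (fun _ => F) x) := by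
    intro x
    rw [rowMean, Fintype.card_mul_expect]
    simp [conv, Finset.prod_mul_distrib, Finset.mul_sum]
  have hcard : ((Fintype.card (Fin l → G) : ℕ) : ℝ) = (Fintype.card G : ℝ) ^ l := by simp
  simp only [energy, hconv, mul_pow, ← pow_mul, ← Finset.mul_sum]
  rw [← Fintype.card_mul_expect, hcard, pow_add]
  ring

lemma one_add_mul_pow_le {θ ε : ℝ} (hθ : 0 ≤ θ) (hε : 1 ≤ ε) (l : ℕ) :
    (1 + θ * ε) ^ l - 1 ≤ ε ^ l * ((1 + θ) ^ l - 1) := by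
  induction l with
  | zero => simp
  | succ l ih =>
    have h1 : (1 : ℝ) ≤ (1 + θ) ^ l := one_le_pow₀ (by linarith)
    have h2 : (1 : ℝ) ≤ ε ^ l := one_le_pow₀ hε
    calc (1 + θ * ε) ^ (l + 1) - 1 = (1 + θ * ε) * ((1 + θ * ε) ^ l - 1) + θ * ε := by ring
      _ ≤ (1 + θ * ε) * (ε ^ l * ((1 + θ) ^ l - 1)) + θ * ε := by gcongr
      _ ≤ (ε * (1 + θ)) * (ε ^ l * ((1 + θ) ^ l - 1)) + θ * (ε * ε ^ l) := by
          have h3 : 0 ≤ ε ^ l * ((1 + θ) ^ l - 1) :=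
            mul_nonneg (by positivity) (by linarith)
          gcongr
          · linarith
          · nlinarith
      _ = ε ^ (l + 1) * ((1 + θ) ^ (l + 1) - 1) := by ring

lemma one_add_div_pow_le {x : ℝ} (hx : 0 ≤ x) (hx1 : x ≤ 1) {l : ℕ} (hl : l ≠ 0) :
    (1 + x / (8 * l)) ^ l ≤ 1 + x / 7 := by
  have hl' : (0 : ℝ) < l := by positivity
  have h := Real.add_one_le_exp (-(x / 8))
  calc (1 + x / (8 * l)) ^ l ≤ Real.exp (x / (8 * l)) ^ l := by
        gcongr
        linarith [Real.add_one_le_exp (x / (8 * l))]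
    _ = Real.exp (x / 8) := by
        rw [← Real.exp_nat_mul]
        congr 1
        field_simp
    _ = (Real.exp (-(x / 8)))⁻¹ := by rw [Real.exp_neg, inv_inv]
    _ ≤ (1 - x / 8)⁻¹ := by gcongr <;> linarith
    _ ≤ 1 + x / 7 := by
        rw [inv_le_iff_one_le_mul₀ (by linarith)]
        nlinarith

lemma one_add_min_pow_le {ε : ℝ} (hε : 0 < ε) {l : ℕ} (hl : l ≠ 0) :
    (1 + ε * min ε 1 ^ (l - 1) / (8 * l)) ^ l ≤ 1 + ε ^ l / 7 := by
  rcases le_total ε 1 with h | h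
  · rw [min_eq_left h, mul_pow_sub_one hl]
    exact one_add_div_pow_le (by positivity) (pow_le_one₀ hε.le h) hl
  · rw [min_eq_right h, one_pow, mul_one]
    have h1 := one_add_mul_pow_le (θ := 1 / (8 * l)) (by positivity) h l
    have h2 := one_add_div_pow_le zero_le_one le_rfl hl
    have h3 : ε ^ l * ((1 + 1 / (8 * l : ℝ)) ^ l - 1) ≤ ε ^ l * (1 / 7) := by
      gcongr
      linarith
    rw [one_div_mul_eq_div] at h1
    linarith

lemma one_le_Lg {t : ℝ} (ht : 0 < t) (ht1 : t ≤ 1) : 1 ≤ Lg t := by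
  rw [Lg, Real.le_logb_iff_rpow_le one_lt_two (by positivity), Real.rpow_one,
    le_div_iff₀ ht]
  linarith

theorem statement5 :
    ∃ C : ℝ, 0 < C ∧
      ∀ (G : Type*) [AddCommGroup G] [Fintype G] (A : Finset G) (δ ε : ℝ) (l k : ℕ),
        0 < δ → (A.card : ℝ) = δ * (Fintype.card G : ℝ) → 2 ≤ l → 0 < ε →
        Odd k → 5 ≤ k →
        energy G k l (bal A) = ε ^ (l * k) * δ ^ (l * k) * (Fintype.card G : ℝ) ^ (l + k) →
        (∀ ks : ℕ, Even ks →
          (ks : ℝ) ≤ C * (k : ℝ) * (l : ℝ) * (min ε 1) ^ (-(l : ℤ)) * Lg (min ε 1) →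
          unif G (ε * (min ε 1) ^ (l - 1) / (8 * (l : ℝ))) ks (l - 1) A) →
        ∃ k₁ : ℕ, Even k₁ ∧
          (k₁ : ℝ) ≤ C * (k : ℝ) * (l : ℝ) * (min ε 1) ^ (-(l : ℤ)) * Lg (min ε 1) ∧
          (1 + ε * (min ε 1) ^ (l - 1) / (8 * (l : ℝ))) ^ (l * k₁) * δ ^ (l * k₁) *
              (Fintype.card G : ℝ) ^ (l + k₁) ≤ energy G k₁ l (ind A) := by
  refine ⟨8, by norm_num, ?_⟩
  intro G _ _ A δ ε l k hδ hA hl hε hk hk5 hE hunif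
  have hN : (0 : ℝ) < Fintype.card G := by exact_mod_cast Fintype.card_pos
  have hδA : (A.card : ℝ) / Fintype.card G = δ := by rw [hA, mul_div_cancel_right₀ _ hN.ne']
  set F : G → ℝ := fun x => ind A x / δ - 1 with hFdef
  have hbal : bal A = fun x => δ * F x := by
    funext x
    simp only [bal, hδA, hFdef]
    field_simp
  have hind : ind A = fun x => δ * (1 + F) x := by
    funext x
    simp only [hFdef, Pi.add_apply, Pi.one_apply]
    field_simp
    ring
  have hF : 𝔼 z, F z = 0 := by
    rw [hFdef, Finset.expect_sub_distrib, Fintype.expect_const, ← Finset.expect_div,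
      Fintype.expect_eq_sum_div_card]
    simp only [ind, Finset.sum_ite_mem, Finset.univ_inter, Finset.sum_const, nsmul_eq_mul, mul_one]
    rw [hδA, div_self hδ.ne', sub_self]
  set η := ε * min ε 1 ^ (l - 1) / (8 * (l : ℝ)) with hηdef
  have he' : 0 < min ε 1 := lt_min hε one_pos
  have hl0 : (0 : ℝ) < l := by positivity
  have hη : 0 < η := by positivity
  have hηl : (1 + η) ^ l ≤ 1 + ε ^ l / 7 := one_add_min_pow_le hε (by omega)
  have hmin : min (ε ^ l) 1 = min ε 1 ^ l := by
    rcases le_total ε 1 with h | h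
    · rw [min_eq_left h, min_eq_left (pow_le_one₀ hε.le h)]
    · rw [min_eq_right h, min_eq_right (one_le_pow₀ h), one_pow]
  set n := 2 * ⌈3 / min ε 1 ^ l⌉₊ with hn
  have hnpos : 0 < ⌈3 / min ε 1 ^ l⌉₊ := Nat.ceil_pos.2 (by positivity)
  have hneven : Even n := even_two_mul _
  have hm : Even (k * n) := hneven.mul_left k
  have hbound : ((k * n : ℕ) : ℝ) ≤ 8 * k * l * min ε 1 ^ (-(l : ℤ)) * Lg (min ε 1) := by
    have h1 := (Nat.ceil_lt_add_one (by positivity : 0 ≤ 3 / min ε 1 ^ l)).le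
    have h2 : 1 ≤ (min ε 1 ^ l)⁻¹ :=
      (one_le_inv₀ (by positivity)).2 (pow_le_one₀ he'.le (min_le_right _ _))
    have h3 := one_le_Lg he' (min_le_right ε 1)
    have h4 : (1 : ℝ) ≤ l := by exact_mod_cast (by omega : 1 ≤ l)
    have h5 : (n : ℝ) ≤ 8 * (min ε 1 ^ l)⁻¹ := by
      have h6 : 3 / min ε 1 ^ l = 3 * (min ε 1 ^ l)⁻¹ := div_eq_mul_inv _ _
      rw [hn]
      push_cast
      linarith
    rw [zpow_neg, zpow_natCast]
    calc ((k * n : ℕ) : ℝ) = k * n := by push_cast; rfl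
      _ ≤ k * (8 * (min ε 1 ^ l)⁻¹) := by gcongr
      _ = 8 * k * 1 * (min ε 1 ^ l)⁻¹ * 1 := by ring
      _ ≤ _ := by gcongr
  refine ⟨k * n, hm, hbound, ?_⟩
  have hU := hunif (k * n) hm hbound
  rw [unif, hδA, hbal, energy_const_mul, mul_comm (k * n) (l - 1), add_comm (k * n) (l - 1)] at hU
  rw [hbal, energy_const_mul] at hE
  rw [hind, energy_const_mul, mul_assoc, mul_comm]
  have hlarge : (2 * (1 + η) ^ l - 1) ^ (k * n) <
      𝔼 x : Fin l → G, (1 + rowMean (fun _ => F) x) ^ (k * n) := by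
    refine lt_of_le_of_lt ?_ (lt_expect_one_add_pow (pow_pos hε l) hk hk5 hneven ?_ ?_)
    · have : 1 ≤ (1 + η) ^ l := one_le_pow₀ (by linarith)
      refine pow_le_pow_left₀ (by linarith) ?_ _
      linarith
    · rw [hmin, ← div_le_iff₀ (by positivity), hn]
      have := Nat.le_ceil (3 / min ε 1 ^ l)
      push_cast
      calc 6 / min ε 1 ^ l = 2 * (3 / min ε 1 ^ l) := by ring
        _ ≤ _ := by gcongr
    · rw [← pow_mul]
      refine le_of_eq (mul_left_cancel₀
        (by positivity : δ ^ (l * k) * (Fintype.card G : ℝ) ^ (l + k) ≠ 0) ?_)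
      rw [hE]
      ring
  have hsmall : 𝔼 z : Fin (k * n) → G, (𝔼 y, ∏ j, F (z j + y)) ^ (l - 1) ≤
      (η ^ (k * n)) ^ (l - 1) := by
    have h := expect_rowMean_restr_pow F (Finset.univ : Finset (Fin (l - 1))) (k * n)
    rw [rowMean_restr_univ, Finset.card_univ, Fintype.card_fin] at h
    rw [← h, ← pow_mul, mul_comm (k * n)]
    refine le_of_mul_le_mul_left (hU.trans_eq ?_) (by positivity :
      0 < δ ^ ((l - 1) * (k * n)) * (Fintype.card G : ℝ) ^ (l - 1 + k * n))
    ring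
  have hfinal := le_expect_rowMean_one_add_pow hl hm
    (Nat.mul_ne_zero (by omega) (by omega)) hη hF hsmall hlarge
  exact mul_le_mul_of_nonneg_left hfinal (by positivity)
end
end
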